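/- For every ε > 0 there exists N such that for all n ≥ N, the generalized Ramsey number satisfies (6/7 − ε)·n ≤ f(n,5,8) ≤ (6/7 + ε)·n; equivalently, f(n,5,8)/n tends to 6/7 as n → ∞. -/

import Mathlib

/-- The number of distinct colors appearing on the (non-loop) edges of `K_n`
inside the vertex set `S`, under the edge-coloring `c`. -/
noncomputable def numColorsOn {n : ℕ} {C : Type*} (c : Sym2 (Fin n) → C) (S : Finset (Fin n)) : ℕ :=
  (c '' {e : Sym2 (Fin n) | e ∈ S.sym2 ∧ ¬ e.IsDiag}).ncard

/-- `c` is a `(p,q)`-coloring of `K_n`: every set of `p` vertices spans edges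
bearing at least `q` distinct colors. -/
def IsPQColoring (n p q : ℕ) {C : Type*} (c : Sym2 (Fin n) → C) : Prop :=
  ∀ S : Finset (Fin n), S.card = p → q ≤ numColorsOn c S

/-- The generalized Ramsey number `f(n,p,q)`: the minimum number of colors
for which `K_n` admits a `(p,q)`-coloring. -/
noncomputable def genRamsey (n p q : ℕ) : ℕ :=
  sInf {k : ℕ | ∃ c : Sym2 (Fin n) → Fin k, IsPQColoring n p q c}

set_option linter.unusedVariables false

/-- A cherry centred at `b` with leaves `a`, `c`. -/
def Cherry {P L : Type*} (χ : P → P → L) (b a c : P) : Prop :=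
  a ≠ b ∧ c ≠ b ∧ a ≠ c ∧ χ b a = χ b c

theorem Cherry.symm {P L : Type*} {χ : P → P → L} {b a c : P} (h : Cherry χ b a c) :
    Cherry χ b c a := ⟨h.2.1, h.1, h.2.2.1.symm, h.2.2.2.symm⟩

/-- A labelling of the pairs of parts satisfying the local conditions. -/
structure Tmpl (P L : Type*) where
  χ : P → P → L
  symm : ∀ p q, χ p q = χ q p
  t1a : ∀ b a c x, Cherry χ b a c → x ≠ a → x ≠ b → x ≠ c → χ b x ≠ χ b a
  t1b : ∀ b a c x, Cherry χ b a c → x ≠ a → x ≠ b → χ a x ≠ χ a b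
  t2a : ∀ b a c x, Cherry χ b a c → x ≠ a → x ≠ c → χ a x ≠ χ a c
  t2b : ∀ b a c d w, Cherry χ b a c → d ≠ b → χ b d = χ a c → w ≠ b → w ≠ d → χ b w ≠ χ a c
  t2c : ∀ b a c d w, Cherry χ b a c → d ≠ b → χ b d = χ a c → w ≠ b → w ≠ d → χ d w ≠ χ a c
  t2d : ∀ b a c d w, Cherry χ b a c → d ≠ b → χ b d = χ a c → w ≠ b → w ≠ d → χ w b ≠ χ w d
  t3 : ∀ b a c y, Cherry χ b a c → y ≠ b → y ≠ a → y ≠ c → χ y a ≠ χ y c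
  t4 : ∀ b a c d e, Cherry χ b a c → Cherry χ b d e → a ≠ d → a ≠ e → c ≠ d → c ≠ e →
    χ a c ≠ χ d e

/-- Transport of a template along an injection. -/
def Tmpl.comap {P Q L : Type*} (T : Tmpl P L) (f : Q → P) (hf : Function.Injective f) :
    Tmpl Q L where
  χ := fun p q => T.χ (f p) (f q)
  symm := fun p q => T.symm _ _
  t1a := fun b a c x h h1 h2 h3 => T.t1a (f b) (f a) (f c) (f x)
    ⟨hf.ne h.1, hf.ne h.2.1, hf.ne h.2.2.1, h.2.2.2⟩ (hf.ne h1) (hf.ne h2) (hf.ne h3)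
  t1b := fun b a c x h h1 h2 => T.t1b (f b) (f a) (f c) (f x)
    ⟨hf.ne h.1, hf.ne h.2.1, hf.ne h.2.2.1, h.2.2.2⟩ (hf.ne h1) (hf.ne h2)
  t2a := fun b a c x h h1 h2 => T.t2a (f b) (f a) (f c) (f x)
    ⟨hf.ne h.1, hf.ne h.2.1, hf.ne h.2.2.1, h.2.2.2⟩ (hf.ne h1) (hf.ne h2)
  t2b := fun b a c d w h h1 h2 h3 h4 => T.t2b (f b) (f a) (f c) (f d) (f w)
    ⟨hf.ne h.1, hf.ne h.2.1, hf.ne h.2.2.1, h.2.2.2⟩ (hf.ne h1) h2 (hf.ne h3) (hf.ne h4)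
  t2c := fun b a c d w h h1 h2 h3 h4 => T.t2c (f b) (f a) (f c) (f d) (f w)
    ⟨hf.ne h.1, hf.ne h.2.1, hf.ne h.2.2.1, h.2.2.2⟩ (hf.ne h1) h2 (hf.ne h3) (hf.ne h4)
  t2d := fun b a c d w h h1 h2 h3 h4 => T.t2d (f b) (f a) (f c) (f d) (f w)
    ⟨hf.ne h.1, hf.ne h.2.1, hf.ne h.2.2.1, h.2.2.2⟩ (hf.ne h1) h2 (hf.ne h3) (hf.ne h4)
  t3 := fun b a c y h h1 h2 h3 => T.t3 (f b) (f a) (f c) (f y)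
    ⟨hf.ne h.1, hf.ne h.2.1, hf.ne h.2.2.1, h.2.2.2⟩ (hf.ne h1) (hf.ne h2) (hf.ne h3)
  t4 := fun b a c d e h h' h1 h2 h3 h4 => T.t4 (f b) (f a) (f c) (f d) (f e)
    ⟨hf.ne h.1, hf.ne h.2.1, hf.ne h.2.2.1, h.2.2.2⟩
    ⟨hf.ne h'.1, hf.ne h'.2.1, hf.ne h'.2.2.1, h'.2.2.2⟩
    (hf.ne h1) (hf.ne h2) (hf.ne h3) (hf.ne h4)

/-- The template without cherries on an additive group. -/
def baseTmpl (R : Type*) [AddCommGroup R] : Tmpl R R :=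
  have key : ∀ b a c : R, ¬ Cherry (fun x y : R => x + y) b a c :=
    fun _ _ _ h => h.2.2.1 (add_left_cancel h.2.2.2)
  { χ := fun x y => x + y
    symm := fun p q => add_comm p q
    t1a := fun b a c x h => (key b a c h).elim
    t1b := fun b a c x h => (key b a c h).elim
    t2a := fun b a c x h => (key b a c h).elim
    t2b := fun b a c d w h => (key b a c h).elim
    t2c := fun b a c d w h => (key b a c h).elim
    t2d := fun b a c d w h => (key b a c h).elim
    t3 := fun b a c x h => (key b a c h).elim
    t4 := fun b a c d e h => (key b a c h).elim }

/-- Rows of the finite template, in base 16. -/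
def t0row : ℕ → ℕ
  | 0 => 475816616861992240
  | 1 => 772113901661082627
  | 2 => 687826063152361541
  | 3 => 158857541275224920
  | 4 => 310768690434974569
  | 5 => 222092709132474276
  | 6 => 1004156654997802
  | 7 => 90394871132819634
  | 8 => 369922992836868353
  | 9 => 448465506956415627
  | 10 => 335289866030024336
  | 11 => 830073293305375255
  | 12 => 603578634968517498
  | 13 => 506243956553889977
  | 14 => 33975343361829286
  | _ => 0

def t0 (p q : ℕ) : ℕ := (t0row p >>> (4 * q)) % 16

theorem t0_lt : ∀ p < 15, ∀ q < 15, t0 p q < 12 := by decide +kernel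
theorem t0_symm : ∀ p < 15, ∀ q < 15, t0 p q = t0 q p := by decide +kernel

/-- Boolean test for cherries in the finite template. -/
def t0ch (b a c : ℕ) : Bool := a != b && c != b && a != c && t0 b a == t0 b c

theorem t0_a : ∀ b a c : Fin 15, t0ch b a c = true →
    ∀ x : Fin 15, (x ≠ a ∧ x ≠ b ∧ x ≠ c → t0 b x ≠ t0 b a) ∧
    (x ≠ a ∧ x ≠ b → t0 a x ≠ t0 a b) ∧
    (x ≠ a ∧ x ≠ c → t0 a x ≠ t0 a c) ∧ (x ≠ b ∧ x ≠ a ∧ x ≠ c → t0 x a ≠ t0 x c) := by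
  decide +kernel

theorem t0_b : ∀ b a c : Fin 15, t0ch b a c = true →
    ∀ d : Fin 15, d ≠ b ∧ t0 b d = t0 a c → ∀ w : Fin 15, w ≠ b ∧ w ≠ d →
    t0 b w ≠ t0 a c ∧ t0 d w ≠ t0 a c ∧ t0 w b ≠ t0 w d := by
  decide +kernel

theorem t0_c : ∀ b a c : Fin 15, t0ch b a c = true →
    ∀ d e : Fin 15, t0ch b d e = true →
    a ≠ d ∧ a ≠ e ∧ c ≠ d ∧ c ≠ e → t0 a c ≠ t0 d e := by
  decide +kernel

theorem t0ch_of {b a c : Fin 15} (h : Cherry (fun p q : Fin 15 => t0 p q) b a c) :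
    t0ch b a c = true := by
  obtain ⟨h1, h2, h3, h4⟩ := h
  simp only [ne_eq, Fin.ext_iff] at h1 h2 h3
  simp [t0ch, h1, h2, h3, h4]

/-- The finite template on 15 parts, with natural number labels. -/
def tmpl15N : Tmpl (Fin 15) ℕ where
  χ := fun p q => t0 p q
  symm := fun p q => t0_symm p p.2 q q.2
  t1a := fun b a c x h h1 h2 h3 => (t0_a b a c (t0ch_of h) x).1
    ⟨h1, h2, h3⟩
  t1b := fun b a c x h h1 h2 => (t0_a b a c (t0ch_of h) x).2.1
    ⟨h1, h2⟩
  t2a := fun b a c x h h1 h2 => (t0_a b a c (t0ch_of h) x).2.2.1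
    ⟨h1, h2⟩
  t2b := fun b a c d w h h1 h2 h3 h4 => (t0_b b a c (t0ch_of h) d
    ⟨h1, h2⟩ w ⟨h3, h4⟩).1
  t2c := fun b a c d w h h1 h2 h3 h4 => (t0_b b a c (t0ch_of h) d
    ⟨h1, h2⟩ w ⟨h3, h4⟩).2.1
  t2d := fun b a c d w h h1 h2 h3 h4 => (t0_b b a c (t0ch_of h) d
    ⟨h1, h2⟩ w ⟨h3, h4⟩).2.2
  t3 := fun b a c x h h1 h2 h3 => (t0_a b a c (t0ch_of h) x).2.2.2
    ⟨h1, h2, h3⟩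
  t4 := fun b a c d e h h' h1 h2 h3 h4 => t0_c b a c (t0ch_of h) d e
    (t0ch_of h') ⟨h1, h2, h3,
      h4⟩

/-- The coefficients used in the blow-up: 2 from a centre to the larger leaf, otherwise 1. -/
noncomputable def bcoef {P L : Type*} [LinearOrder P] (T : Tmpl P L) (R : Type*) [CommRing R]
    (p q : P) : R :=
  open Classical in if ∃ r, r < q ∧ Cherry T.χ p r q then 2 else 1

section blow
variable {P L : Type*} [LinearOrder P] (T : Tmpl P L) (R : Type*) [CommRing R]

theorem bcoef_unit (h2 : IsUnit (2 : R)) (p q : P) : IsUnit (bcoef T R p q) := by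
  unfold bcoef; split_ifs <;> simp [h2]

theorem bcoef_one {p q : P} (h : ∀ r, ¬ Cherry T.χ p r q) : bcoef T R p q = 1 := by
  unfold bcoef; rw [if_neg]; rintro ⟨r, -, hr⟩; exact h r hr

theorem bcoef_lc {b a c : P} (h : Cherry T.χ b a c) : bcoef T R a b = 1 := by
  apply bcoef_one
  intro r hr
  exact T.t1b b a c r h hr.1 (hr.2.2.1) hr.2.2.2

theorem bcoef_ll {b a c : P} (h : Cherry T.χ b a c) : bcoef T R a c = 1 := by
  apply bcoef_one
  intro r hr
  exact T.t2a b a c r h hr.1 (hr.2.2.1) hr.2.2.2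

theorem bcoef_lt {b a c : P} (h : Cherry T.χ b a c) (hac : a < c) :
    bcoef T R b a = 1 ∧ bcoef T R b c = 2 := by
  constructor
  · unfold bcoef; rw [if_neg]; rintro ⟨r, hra, hr⟩
    have hrc : r ≠ c := fun e => absurd hra (not_lt.2 (e ▸ hac.le))
    exact T.t1a b a c r h hr.2.2.1 hr.1 hrc hr.2.2.2
  · unfold bcoef; rw [if_pos ⟨a, hac, h⟩]

theorem bcoef_sub {b a c : P} (h : Cherry T.χ b a c) :
    IsUnit (bcoef T R b a - bcoef T R b c) := by
  rcases lt_or_gt_of_ne h.2.2.1 with h1 | h1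
  · obtain ⟨e1, e2⟩ := bcoef_lt T R h h1
    rw [e1, e2]; norm_num
  · obtain ⟨e1, e2⟩ := bcoef_lt T R h.symm h1
    rw [e1, e2]; norm_num

/-- The labelling of the blow-up. -/
noncomputable def blowχ {LY : Type*} (TY : Tmpl R LY) (x y : P × R) : (L × R) ⊕ LY :=
  if x.1 = y.1 then Sum.inr (TY.χ x.2 y.2)
  else Sum.inl (T.χ x.1 y.1, bcoef T R x.1 y.1 * x.2 + bcoef T R y.1 x.1 * y.2)

variable {T R} {LY : Type*} {TY : Tmpl R LY}

theorem blowχ_inl (h2 : IsUnit (2 : R)) {x y z : P × R} (hxy : x.1 ≠ y.1) (hyz : y ≠ z)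
    (h : blowχ T R TY x y = blowχ T R TY x z) : x.1 ≠ z.1 ∧ y.1 ≠ z.1 ∧
      T.χ x.1 y.1 = T.χ x.1 z.1 ∧ bcoef T R x.1 y.1 * x.2 + bcoef T R y.1 x.1 * y.2 =
        bcoef T R x.1 z.1 * x.2 + bcoef T R z.1 x.1 * z.2 := by
  unfold blowχ at h
  rw [if_neg hxy] at h
  split_ifs at h with h1
  simp only [Sum.inl.injEq, Prod.mk.injEq] at h
  refine ⟨h1, ?_, h.1, h.2⟩
  intro e
  rw [← e] at h
  have := (bcoef_unit T R h2 y.1 x.1).mul_left_cancel (add_left_cancel h.2)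
  exact hyz (Prod.ext e this)

theorem blowχ_inr {x y z w : P × R} (hxy : x.1 = y.1)
    (h : blowχ T R TY x y = blowχ T R TY z w) : z.1 = w.1 ∧ TY.χ x.2 y.2 = TY.χ z.2 w.2 := by
  unfold blowχ at h
  rw [if_pos hxy] at h
  split_ifs at h with h1
  simp only [Sum.inr.injEq] at h
  exact ⟨h1, h⟩

theorem blowχ_inl' {x y z w : P × R} (hxy : x.1 ≠ y.1)
    (h : blowχ T R TY x y = blowχ T R TY z w) : z.1 ≠ w.1 ∧ T.χ x.1 y.1 = T.χ z.1 w.1 ∧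
      bcoef T R x.1 y.1 * x.2 + bcoef T R y.1 x.1 * y.2 =
        bcoef T R z.1 w.1 * z.2 + bcoef T R w.1 z.1 * w.2 := by
  unfold blowχ at h
  rw [if_neg hxy] at h
  split_ifs at h with h1
  simp only [Sum.inl.injEq, Prod.mk.injEq] at h
  exact ⟨h1, h.1, h.2⟩

theorem blow_cherry (h2 : IsUnit (2 : R)) {b a c : P × R} (h : Cherry (blowχ T R TY) b a c) :
    (a.1 = b.1 ∧ c.1 = b.1 ∧ Cherry TY.χ b.2 a.2 c.2) ∨
    (Cherry T.χ b.1 a.1 c.1 ∧ bcoef T R b.1 a.1 * b.2 + a.2 = bcoef T R b.1 c.1 * b.2 + c.2) := by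
  obtain ⟨h1, h3, h4, h5⟩ := h
  by_cases e : b.1 = a.1
  · left
    obtain ⟨e1, e2⟩ := blowχ_inr e h5
    refine ⟨e.symm, e1.symm, fun e' => h1 (Prod.ext e.symm e'), fun e' => h3 (Prod.ext e1.symm e'),
      fun e' => h4 (Prod.ext (e.symm.trans e1) e'), e2⟩
  · right
    obtain ⟨e1, e2, e3, e4⟩ := blowχ_inl h2 e h4 h5
    have hc : Cherry T.χ b.1 a.1 c.1 := ⟨Ne.symm e, Ne.symm e1, e2, e3⟩
    rw [bcoef_lc T R hc, bcoef_lc T R hc.symm, one_mul, one_mul] at e4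
    exact ⟨hc, e4⟩

end blow

/-- Relabelling of a template. -/
def Tmpl.relabel {P L L' : Type*} (T : Tmpl P L) (χ' : P → P → L') (g : L' → L)
    (hs : ∀ p q, χ' p q = χ' q p) (hg : ∀ p q, g (χ' p q) = T.χ p q) : Tmpl P L' :=
  have hc : ∀ b a c, Cherry χ' b a c → Cherry T.χ b a c := fun b a c h =>
    ⟨h.1, h.2.1, h.2.2.1, by rw [← hg, ← hg, h.2.2.2]⟩
  have he : ∀ a b c d, χ' a b = χ' c d → T.χ a b = T.χ c d := fun a b c d h => by
    rw [← hg, ← hg, h]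
  { χ := χ'
    symm := hs
    t1a := fun b a c x h h1 h2 h3 e => T.t1a b a c x (hc _ _ _ h) h1 h2 h3 (he _ _ _ _ e)
    t1b := fun b a c x h h1 h2 e => T.t1b b a c x (hc _ _ _ h) h1 h2 (he _ _ _ _ e)
    t2a := fun b a c x h h1 h2 e => T.t2a b a c x (hc _ _ _ h) h1 h2 (he _ _ _ _ e)
    t2b := fun b a c d w h h1 h2 h3 h4 e =>
      T.t2b b a c d w (hc _ _ _ h) h1 (he _ _ _ _ h2) h3 h4 (he _ _ _ _ e)
    t2c := fun b a c d w h h1 h2 h3 h4 e =>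
      T.t2c b a c d w (hc _ _ _ h) h1 (he _ _ _ _ h2) h3 h4 (he _ _ _ _ e)
    t2d := fun b a c d w h h1 h2 h3 h4 e =>
      T.t2d b a c d w (hc _ _ _ h) h1 (he _ _ _ _ h2) h3 h4 (he _ _ _ _ e)
    t3 := fun b a c x h h1 h2 h3 e => T.t3 b a c x (hc _ _ _ h) h1 h2 h3 (he _ _ _ _ e)
    t4 := fun b a c d w h h' h1 h2 h3 h4 e =>
      T.t4 b a c d w (hc _ _ _ h) (hc _ _ _ h') h1 h2 h3 h4 (he _ _ _ _ e) }

/-- The finite template with 15 parts and 12 labels. -/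
def tmpl15 : Tmpl (Fin 15) (Fin 12) :=
  tmpl15N.relabel (fun p q => ⟨t0 p q, t0_lt p p.2 q q.2⟩) (fun l => (l : ℕ))
    (fun p q => by simp only [t0_symm p p.2 q q.2]) (fun p q => rfl)

/-- The blow-up template. -/
noncomputable def blowTmpl {P L : Type*} [LinearOrder P] (T : Tmpl P L) (R : Type*) [CommRing R]
    (h2 : IsUnit (2 : R)) {LY : Type*} (TY : Tmpl R LY) : Tmpl (P × R) ((L × R) ⊕ LY) where
  χ := blowχ T R TY
  symm := by
    intro p q
    unfold blowχ
    by_cases h : p.1 = q.1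
    · rw [if_pos h, if_pos h.symm, TY.symm]
    · rw [if_neg h, if_neg (Ne.symm h), T.symm, add_comm]
  t1a := by
    intro b a c x h hxa hxb hxc e
    rcases blow_cherry h2 h with ⟨h3, h4, h5⟩ | ⟨h3, h4⟩
    · obtain ⟨e1, e2⟩ := blowχ_inr h3.symm e.symm
      exact TY.t1a _ _ _ x.2 h5 (fun h => hxa (Prod.ext (e1.symm.trans h3.symm) h))
        (fun h => hxb (Prod.ext e1.symm h)) (fun h => hxc (Prod.ext (e1.symm.trans h4.symm) h))
        e2.symm
    · obtain ⟨e1, e2, e3, -⟩ := blowχ_inl h2 h3.1.symm hxa.symm e.symm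
      have e' : blowχ T R TY b x = blowχ T R TY b c := e.trans h.2.2.2
      obtain ⟨-, e4, -, -⟩ := blowχ_inl h2 e1 hxc e'
      exact T.t1a _ _ _ x.1 h3 e2.symm e1.symm e4 e3.symm
  t1b := by
    intro b a c x h hxa hxb e
    rcases blow_cherry h2 h with ⟨h3, h4, h5⟩ | ⟨h3, h4⟩
    · obtain ⟨e1, e2⟩ := blowχ_inr h3 e.symm
      exact TY.t1b _ _ _ x.2 h5 (fun h => hxa (Prod.ext e1.symm h))
        (fun h => hxb (Prod.ext (e1.symm.trans h3) h)) e2.symm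
    · obtain ⟨e1, e2, e3, -⟩ := blowχ_inl h2 h3.1 hxb.symm e.symm
      exact T.t1b _ _ _ x.1 h3 e1.symm e2.symm e3.symm
  t2a := by
    intro b a c x h hxa hxc e
    rcases blow_cherry h2 h with ⟨h3, h4, h5⟩ | ⟨h3, h4⟩
    · obtain ⟨e1, e2⟩ := blowχ_inr (h3.trans h4.symm) e.symm
      exact TY.t2a _ _ _ x.2 h5 (fun h => hxa (Prod.ext e1.symm h))
        (fun h => hxc (Prod.ext (e1.symm.trans (h3.trans h4.symm)) h)) e2.symm
    · obtain ⟨e1, e2, e3, -⟩ := blowχ_inl h2 h3.2.2.1 hxc.symm e.symm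
      exact T.t2a _ _ _ x.1 h3 e1.symm e2.symm e3.symm
  t2b := by
    intro b a c d w h hdb hd hwb hwd e
    rcases blow_cherry h2 h with ⟨h3, h4, h5⟩ | ⟨h3, h4⟩
    · obtain ⟨e1, e2⟩ := blowχ_inr (h3.trans h4.symm) hd.symm
      obtain ⟨e3, e4⟩ := blowχ_inr (h3.trans h4.symm) e.symm
      exact TY.t2b _ _ _ d.2 w.2 h5 (fun h => hdb (Prod.ext e1.symm h)) e2.symm
        (fun h => hwb (Prod.ext e3.symm h)) (fun h => hwd (Prod.ext (e3.symm.trans e1) h)) e4.symm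
    · obtain ⟨e1, e2, -⟩ := blowχ_inl' h3.2.2.1 hd.symm
      obtain ⟨e3, e4, e5, -⟩ := blowχ_inl h2 e1 hwd.symm (hd.trans e.symm)
      exact T.t2b _ _ _ d.1 w.1 h3 e1.symm e2.symm e3.symm e4.symm (e5.symm.trans e2.symm)
  t2c := by
    intro b a c d w h hdb hd hwb hwd e
    rcases blow_cherry h2 h with ⟨h3, h4, h5⟩ | ⟨h3, h4⟩
    · obtain ⟨e1, e2⟩ := blowχ_inr (h3.trans h4.symm) hd.symm
      obtain ⟨e3, e4⟩ := blowχ_inr (h3.trans h4.symm) e.symm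
      exact TY.t2c _ _ _ d.2 w.2 h5 (fun h => hdb (Prod.ext e1.symm h)) e2.symm
        (fun h => hwb (Prod.ext (e3.symm.trans e1.symm) h))
        (fun h => hwd (Prod.ext e3.symm h)) e4.symm
    · obtain ⟨e1, e2, -⟩ := blowχ_inl' h3.2.2.1 hd.symm
      have hs : blowχ T R TY b d = blowχ T R TY d b := by
        unfold blowχ
        rw [if_neg e1, if_neg (Ne.symm e1), T.symm, add_comm]
      obtain ⟨e3, e4, e5, -⟩ := blowχ_inl h2 e1.symm hwb.symm (hs.symm.trans (hd.trans e.symm))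
      refine T.t2c _ _ _ d.1 w.1 h3 e1.symm e2.symm e4.symm e3.symm ?_
      rw [← e5, T.symm, e2]
  t2d := by
    intro b a c d w h hdb hd hwb hwd e
    rcases blow_cherry h2 h with ⟨h3, h4, h5⟩ | ⟨h3, h4⟩
    · obtain ⟨e1, e2⟩ := blowχ_inr (h3.trans h4.symm) hd.symm
      by_cases hw : w.1 = b.1
      · obtain ⟨e3, e4⟩ := blowχ_inr hw e
        exact TY.t2d _ _ _ d.2 w.2 h5 (fun h => hdb (Prod.ext e1.symm h)) e2.symm
          (fun h => hwb (Prod.ext hw h)) (fun h => hwd (Prod.ext e3 h)) e4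
      · obtain ⟨e3, e4, -, -⟩ := blowχ_inl h2 hw hdb.symm e
        exact e4 e1
    · obtain ⟨e1, e2, -⟩ := blowχ_inl' h3.2.2.1 hd.symm
      by_cases hw : w.1 = b.1
      · obtain ⟨e3, e4⟩ := blowχ_inr hw e
        exact e1 (hw.symm.trans e3)
      · obtain ⟨e3, e4, e5, -⟩ := blowχ_inl h2 hw hdb.symm e
        exact T.t2d _ _ _ d.1 w.1 h3 e1.symm e2.symm hw e3 e5
  t3 := by
    intro b a c y h hyb hya hyc e
    have hy : Cherry (blowχ T R TY) y a c := ⟨hya.symm, hyc.symm, h.2.2.1, e⟩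
    rcases blow_cherry h2 h with ⟨h3, h4, h5⟩ | ⟨h3, h4⟩
    · rcases blow_cherry h2 hy with ⟨h3', h4', h5'⟩ | ⟨h3', h4'⟩
      · exact TY.t3 _ _ _ y.2 h5 (fun h => hyb (Prod.ext (h3'.symm.trans h3) h)) h5'.1.symm
          h5'.2.1.symm h5'.2.2.2
      · exact h3'.2.2.1 (h3.trans h4.symm)
    · rcases blow_cherry h2 hy with ⟨h3', h4', h5'⟩ | ⟨h3', h4'⟩
      · exact h3.2.2.1 (h3'.trans h4'.symm)
      · by_cases hb : y.1 = b.1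
        · rw [hb] at h4'
          have : (bcoef T R b.1 a.1 - bcoef T R b.1 c.1) * y.2 =
            (bcoef T R b.1 a.1 - bcoef T R b.1 c.1) * b.2 := by linear_combination h4' - h4
          exact hyb (Prod.ext hb ((bcoef_sub T R h3).mul_left_cancel this))
        · exact T.t3 _ _ _ y.1 h3 hb h3'.1.symm h3'.2.1.symm h3'.2.2.2
  t4 := by
    intro b a c d e h h' h1 h3 h4 h5 he
    rcases blow_cherry h2 h with ⟨g3, g4, g5⟩ | ⟨g3, g4⟩
    · rcases blow_cherry h2 h' with ⟨g3', g4', g5'⟩ | ⟨g3', g4'⟩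
      · obtain ⟨e1, e2⟩ := blowχ_inr (g3.trans g4.symm) he
        exact TY.t4 _ _ _ _ _ g5 g5' (fun h => h1 (Prod.ext (g3.trans g3'.symm) h))
          (fun h => h3 (Prod.ext (g3.trans g4'.symm) h))
          (fun h => h4 (Prod.ext (g4.trans g3'.symm) h))
          (fun h => h5 (Prod.ext (g4.trans g4'.symm) h)) e2
      · exact g3'.2.2.1 (blowχ_inr (g3.trans g4.symm) he).1
    · rcases blow_cherry h2 h' with ⟨g3', g4', g5'⟩ | ⟨g3', g4'⟩
      · exact g3.2.2.1 (blowχ_inr (g3'.trans g4'.symm) he.symm).1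
      · obtain ⟨-, e1, e2⟩ := blowχ_inl' g3.2.2.1 he
        rw [bcoef_ll T R g3, bcoef_ll T R g3', bcoef_ll T R g3.symm, bcoef_ll T R g3'.symm] at e2
        -- the two projected cherries coincide
        have key : ∀ d e : P × R, Cherry T.χ b.1 d.1 e.1 →
            bcoef T R b.1 d.1 * b.2 + d.2 = bcoef T R b.1 e.1 * b.2 + e.2 →
            1 * a.2 + 1 * c.2 = 1 * d.2 + 1 * e.2 → a ≠ d → a.1 = d.1 → False := by
          intro d e g3' g4' e2 h1 had
          have hce : e.1 = c.1 := by
            by_contra hne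
            exact T.t1a _ _ _ e.1 g3 (had ▸ g3'.2.2.1.symm) g3'.2.1 hne
              (had ▸ g3'.2.2.2.symm)
          rw [← had, hce] at g4'
          have : (2 : R) * a.2 = 2 * d.2 := by linear_combination g4 - g4' + e2
          exact h1 (Prod.ext had (h2.mul_left_cancel this))
        by_cases had : a.1 = d.1
        · exact key d e g3' g4' e2 h1 had
        by_cases hae : a.1 = e.1
        · exact key e d g3'.symm g4'.symm (by rw [e2]; ring) h3 hae
        by_cases hcd : c.1 = d.1
        · exact T.t1a _ _ _ a.1 g3' had g3.1 hae (hcd ▸ g3.2.2.2)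
        by_cases hce : c.1 = e.1
        · exact T.t1a _ _ _ a.1 g3' had g3.1 hae (g3.2.2.2.trans (hce ▸ g3'.2.2.2.symm))
        exact T.t4 _ _ _ _ _ g3 g3' had hae hcd hce e1

/-- Templates with about `6/7` as many labels as parts. -/
theorem tmpl_exists (s N : ℕ) (hN : Odd N) : ∃ l : ℕ, Nonempty (Tmpl (Fin (15 ^ s * N)) (Fin l)) ∧
    7 * l ≤ 6 * (15 ^ s * N) + N := by
  induction s with
  | zero =>
    have : NeZero N := ⟨by rintro rfl; simp at hN⟩
    refine ⟨N, ⟨?_⟩, by ring_nf; omega⟩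
    have e : Fin (15 ^ 0 * N) ≃ Fin N := finCongr (by simp)
    exact (baseTmpl (Fin N)).comap e e.injective
  | succ s ih =>
    obtain ⟨l, ⟨T⟩, hl⟩ := ih
    set m := 15 ^ s * N with hm
    have hodd : Odd m := (Odd.pow (by decide)).mul hN
    have : NeZero m := ⟨by intro h; rw [h] at hodd; simp at hodd⟩
    have e : ZMod m ≃ Fin m := (ZMod.finEquiv m).symm.toEquiv
    have TY : Tmpl (ZMod m) (Fin l) := T.comap e e.injective
    have h2 : IsUnit (2 : ZMod m) := by
      have : ((2 : ℕ) : ZMod m) = 2 := by norm_num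
      rw [← this, ZMod.isUnit_iff_coprime]
      exact (Nat.coprime_two_left).2 hodd
    have B := blowTmpl tmpl15 (ZMod m) h2 TY
    have e1 : Fin (15 ^ (s + 1) * N) ≃ Fin 15 × ZMod m := by
      apply Fintype.equivOfCardEq
      simp [ZMod.card, hm]; ring
    have e2 : (Fin 12 × ZMod m) ⊕ Fin l ≃ Fin (12 * m + l) := by
      apply Fintype.equivOfCardEq
      simp [ZMod.card]
    have B' := B.comap e1 e1.injective
    refine ⟨12 * m + l, ⟨B'.relabel (fun p q => e2 (B'.χ p q)) e2.symm ?_ ?_⟩, ?_⟩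
    · intro p q; simp [B'.symm p q]
    · intro p q; simp
    · have : 15 ^ (s + 1) * N = 15 * m := by rw [hm]; ring
      rw [this]; omega

set_option linter.unusedVariables false

/-! ### Line lemma -/

section LineLemma
variable {F : Type} [Field F] [Fintype F] [DecidableEq F]

theorem quad_roots_card (c0 c1 c2 : F) (τ0 : F) (h : c0 + c1 * τ0 + c2 * τ0 ^ 2 ≠ 0) :
    (Finset.univ.filter (fun τ : F => c0 + c1 * τ + c2 * τ ^ 2 = 0)).card ≤ 2 := by
  classical
  let Q : Polynomial F := Polynomial.C c0 + Polynomial.C c1 * Polynomial.X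
    + Polynomial.C c2 * Polynomial.X ^ 2
  have hev : ∀ τ, Q.eval τ = c0 + c1 * τ + c2 * τ ^ 2 := by
    intro τ; simp [Q]
  have hQ : Q ≠ 0 := by
    intro h0
    apply h
    rw [← hev, h0, Polynomial.eval_zero]
  have hdeg : Q.natDegree ≤ 2 := by
    simp only [Q]
    compute_degree
  have hsub : (Finset.univ.filter (fun τ : F => c0 + c1 * τ + c2 * τ ^ 2 = 0)) ⊆
      Q.roots.toFinset := by
    intro τ hτ
    rw [Finset.mem_filter] at hτ
    rw [Multiset.mem_toFinset, Polynomial.mem_roots hQ, Polynomial.IsRoot, hev]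
    exact hτ.2
  calc _ ≤ Q.roots.toFinset.card := Finset.card_le_card hsub
    _ ≤ Q.roots.card := Multiset.toFinset_card_le _
    _ ≤ Q.natDegree := Polynomial.card_roots' Q
    _ ≤ 2 := hdeg

/-- `g` is quadratic along lines. -/
def IsQ {W : Type} [AddCommGroup W] [Module F W] (g : W → F) : Prop :=
  ∀ a b : W, ∃ c0 c1 c2 : F, ∀ τ : F, g (a + τ • (b - a)) = c0 + c1 * τ + c2 * τ ^ 2

theorem line_lemma {W ι : Type} [AddCommGroup W] [Module F W] [DecidableEq ι] (A : Set W)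
    (hA : ∀ a ∈ A, ∀ b ∈ A, ∀ τ : F, a + τ • (b - a) ∈ A) (hne : A.Nonempty) (g : ι → W → F)
    (hg : ∀ i, IsQ (g i)) (J : Finset ι) (hJ : ∀ j ∈ J, ∃ a ∈ A, g j a ≠ 0)
    (hcard : 2 * J.card < Fintype.card F) : ∃ a ∈ A, ∀ j ∈ J, g j a ≠ 0 := by
  induction J using Finset.induction_on with
  | empty => obtain ⟨a, ha⟩ := hne; exact ⟨a, ha, by simp⟩
  | insert j J hj ih =>
    have hc := Finset.card_insert_of_notMem hj
    obtain ⟨a, ha, hga⟩ := ih (fun i hi => hJ i (Finset.mem_insert_of_mem hi)) (by omega)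
    obtain ⟨b, hb, hgb⟩ := hJ j (Finset.mem_insert_self _ _)
    choose c0 c1 c2 hl using fun i => hg i a b
    have hbad : ((insert j J).biUnion (fun i => Finset.univ.filter
        (fun τ : F => c0 i + c1 i * τ + c2 i * τ ^ 2 = 0))).card ≤ (insert j J).card * 2 := by
      apply Finset.card_biUnion_le_card_mul
      intro i hi
      rcases Finset.mem_insert.1 hi with rfl | hi
      · apply quad_roots_card _ _ _ 1
        rw [← hl]; simpa using hgb
      · apply quad_roots_card _ _ _ 0
        rw [← hl]; simpa using hga i hi
    obtain ⟨τ, hτ⟩ : ∃ τ, τ ∉ ((insert j J).biUnion (fun i => Finset.univ.filter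
        (fun τ : F => c0 i + c1 i * τ + c2 i * τ ^ 2 = 0))) := by
      by_contra hcon
      push Not at hcon
      have : (Finset.univ : Finset F) ⊆ _ := fun τ _ => hcon τ
      have := Finset.card_le_card this
      rw [Finset.card_univ] at this
      omega
    refine ⟨a + τ • (b - a), hA a ha b hb τ, fun i hi => ?_⟩
    rw [hl]
    intro h0
    apply hτ
    rw [Finset.mem_biUnion]
    exact ⟨i, hi, by simpa using h0⟩
end LineLemma

/-! ### Good coefficients -/

section GoodCoef
variable {F : Type} [Field F]

/-- The constraint polynomials. -/
def gv {R : Type} [CommRing R] (k : Fin 20) (x y q' r' e e' : R) : R :=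
  match k.val with
  | 0 => x | 1 => x + q' | 2 => x - q' | 3 => x + 2 * q' | 4 => x - 2 * q'
  | 5 => y + x | 6 => y - x | 7 => y + 2 * x | 8 => y - 2 * x | 9 => y ^ 2 + x * y + x ^ 2
  | 10 => q' + y | 11 => q' - y | 12 => q' + y + x | 13 => q' + y - x | 14 => q' - y + x
  | 15 => q' - y - x | 16 => q' + r' | 17 => q' - r' | 18 => q' * e' + r' * e
  | _ => q' * e' - r' * e

theorem gv9 (x y q' r' e e' : F) : gv 9 x y q' r' e e' = y ^ 2 + x * y + x ^ 2 := rfl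
theorem gv18 (x y q' r' e e' : F) : gv 18 x y q' r' e e' = q' * e' + r' * e := rfl
theorem gv19 (x y q' r' e e' : F) : gv 19 x y q' r' e e' = q' * e' - r' * e := rfl

theorem gv_cast (k : Fin 20) (x y q' r' e e' : ℤ) :
    gv k (x : F) (y : F) (q' : F) (r' : F) (e : F) (e' : F) = ((gv k x y q' r' e e' : ℤ) : F) := by
  fin_cases k <;> simp [gv]

/-- evaluation of a constraint on a coefficient function -/
def gα {P : Type} (k : Fin 20) (p q r : P) (α : P → P → F) : F :=
  gv k (α p q) (α p r) (α q p) (α r p) (α q r) (α r q)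

variable {P L : Type}

def GRel (T : Tmpl P L) (k : Fin 20) (p q r : P) : Prop :=
  p ≠ q ∧ (5 ≤ k.val → Cherry T.χ p q r)

def Good (T : Tmpl P L) (α : P → P → F) : Prop :=
  ∀ k p q r, GRel T k p q r → gα k p q r α ≠ 0

theorem gα_isQ (k : Fin 20) (p q r : P) : IsQ (F := F) (gα (F := F) k p q r) := by
  intro a b
  by_cases hk9 : k = 9
  · subst hk9
    simp only [gα, gv9, Pi.add_apply, Pi.smul_apply, Pi.sub_apply, smul_eq_mul]
    exact ⟨a p r ^ 2 + a p q * a p r + a p q ^ 2, 2 * a p r * (b p r - a p r) + a p q * (b p r - a p r) + a p r * (b p q - a p q)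
      + 2 * a p q * (b p q - a p q), (b p r - a p r) ^ 2 + (b p q - a p q) * (b p r - a p r)
      + (b p q - a p q) ^ 2, fun τ => by ring⟩
  by_cases hk18 : k = 18
  · subst hk18
    simp only [gα, gv18, Pi.add_apply, Pi.smul_apply, Pi.sub_apply, smul_eq_mul]
    exact ⟨a q p * a r q + a r p * a q r, a q p * (b r q - a r q) + a r q * (b q p - a q p) + a r p * (b q r - a q r)
      + a q r * (b r p - a r p), (b q p - a q p) * (b r q - a r q) +
      (b r p - a r p) * (b q r - a q r), fun τ => by ring⟩
  by_cases hk19 : k = 19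
  · subst hk19
    simp only [gα, gv19, Pi.add_apply, Pi.smul_apply, Pi.sub_apply, smul_eq_mul]
    exact ⟨a q p * a r q - a r p * a q r, a q p * (b r q - a r q) + a r q * (b q p - a q p) - a r p * (b q r - a q r)
      - a q r * (b r p - a r p), (b q p - a q p) * (b r q - a r q) -
      (b r p - a r p) * (b q r - a q r), fun τ => by ring⟩
  refine ⟨gα k p q r a, gα k p q r (b - a), 0, fun τ => ?_⟩
  fin_cases k <;> first
    | exact absurd rfl hk9 | exact absurd rfl hk18 | exact absurd rfl hk19
    | (simp only [gα, gv, Pi.add_apply, Pi.smul_apply, Pi.sub_apply, smul_eq_mul]; ring)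

/-! ### cherry triangles are edge disjoint -/

theorem Tmpl.ch_unique (T : Tmpl P L) {b a c c' : P} (h : Cherry T.χ b a c)
    (h' : Cherry T.χ b a c') : c' = c := by
  by_contra hne
  exact T.t1a b a c c' h h'.2.2.1.symm h'.2.1 hne h'.2.2.2.symm

theorem Tmpl.ch_no1 (T : Tmpl P L) {b a c x : P} (h : Cherry T.χ b a c) :
    ¬ Cherry T.χ a b x := by
  intro h'
  exact T.t1b b a c x h h'.2.1 h'.2.2.1.symm h'.2.2.2.symm

theorem Tmpl.ch_no2 (T : Tmpl P L) {b a c x : P} (h : Cherry T.χ b a c) :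
    ¬ Cherry T.χ a c x := by
  intro h'
  exact T.t2a b a c x h h'.2.1 h'.2.2.1.symm h'.2.2.2.symm

theorem Tmpl.ch_no3 (T : Tmpl P L) {b a c x : P} (h : Cherry T.χ b a c) :
    ¬ Cherry T.χ x a b := by
  intro h'
  exact T.ch_no2 h'.symm h

theorem Tmpl.ch_centre (T : Tmpl P L) {b a c x : P} (h : Cherry T.χ b a c)
    (h' : Cherry T.χ x a c) : x = b := by
  by_contra hne
  exact T.t3 b a c x h hne h'.1.symm h'.2.1.symm (by
    have := h'.2.2.2
    exact this)

variable [LinearOrder P]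

open Classical in
/-- Default coefficients. -/
noncomputable def αdef (F : Type) [Field F] (T : Tmpl P L) (p q : P) : F :=
  if ∃ r, Cherry T.χ p q r ∧ q < r then 1
  else if ∃ r, Cherry T.χ p q r then 3
  else if ∃ r, Cherry T.χ q p r ∧ p < r then 5
  else if ∃ r, Cherry T.χ q p r then 7
  else if p < q then 1 else 3

theorem αdef_cl (T : Tmpl P L) {b a c : P} (h : Cherry T.χ b a c) :
    αdef F T b a = (if a < c then 1 else 3) ∧ αdef F T a b = (if a < c then 5 else 7) ∧
    αdef F T a c = (if a < c then 1 else 3) := by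
  have e1 : (∃ r, Cherry T.χ b a r) := ⟨c, h⟩
  have e2 : (∃ r, Cherry T.χ b a r ∧ a < r) ↔ a < c := by
    constructor
    · rintro ⟨r, hr, hl⟩; rwa [← T.ch_unique h hr]
    · intro hl; exact ⟨c, h, hl⟩
  have e3 : ¬ ∃ r, Cherry T.χ a b r := by rintro ⟨r, hr⟩; exact T.ch_no1 h hr
  have e4 : ¬ ∃ r, Cherry T.χ a c r := by rintro ⟨r, hr⟩; exact T.ch_no2 h hr
  have e5 : ¬ ∃ r, Cherry T.χ c a r := by rintro ⟨r, hr⟩; exact T.ch_no2 h.symm hr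
  have e3' : ¬ ∃ r, Cherry T.χ a b r ∧ b < r := fun ⟨r, hr⟩ => e3 ⟨r, hr.1⟩
  have e4' : ¬ ∃ r, Cherry T.χ a c r ∧ c < r := fun ⟨r, hr⟩ => e4 ⟨r, hr.1⟩
  have e5' : ¬ ∃ r, Cherry T.χ c a r ∧ a < r := fun ⟨r, hr⟩ => e5 ⟨r, hr.1⟩
  refine ⟨?_, ?_, ?_⟩
  · unfold αdef
    by_cases hl : a < c
    · rw [if_pos (e2.2 hl), if_pos hl]
    · rw [if_neg (fun x => hl (e2.1 x)), if_pos e1, if_neg hl]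
  · unfold αdef
    rw [if_neg e3', if_neg e3]
    by_cases hl : a < c
    · rw [if_pos (e2.2 hl), if_pos hl]
    · rw [if_neg (fun x => hl (e2.1 x)), if_pos e1, if_neg hl]
  · unfold αdef
    rw [if_neg e4', if_neg e4, if_neg e5', if_neg e5]

theorem αdef_pair (T : Tmpl P L) {p q : P} (hne : p ≠ q) :
    (αdef F T p q = 1 ∧ αdef F T q p = 5) ∨ (αdef F T p q = 5 ∧ αdef F T q p = 1) ∨
    (αdef F T p q = 3 ∧ αdef F T q p = 7) ∨ (αdef F T p q = 7 ∧ αdef F T q p = 3) ∨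
    (αdef F T p q = 1 ∧ αdef F T q p = 3) ∨ (αdef F T p q = 3 ∧ αdef F T q p = 1) := by
  by_cases h1 : ∃ r, Cherry T.χ p q r
  · obtain ⟨r, hr⟩ := h1
    obtain ⟨h2, h3, -⟩ := αdef_cl (F := F) T hr
    rw [h2, h3]; split_ifs <;> simp
  by_cases h2 : ∃ r, Cherry T.χ q p r
  · obtain ⟨r, hr⟩ := h2
    obtain ⟨h2, h3, -⟩ := αdef_cl (F := F) T hr
    rw [h2, h3]; split_ifs <;> simp
  have h1' : ¬ ∃ r, Cherry T.χ p q r ∧ q < r := fun ⟨r, hr⟩ => h1 ⟨r, hr.1⟩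
  have h2' : ¬ ∃ r, Cherry T.χ q p r ∧ p < r := fun ⟨r, hr⟩ => h2 ⟨r, hr.1⟩
  unfold αdef
  rw [if_neg h1', if_neg h1, if_neg h2', if_neg h2, if_neg h2', if_neg h2, if_neg h1', if_neg h1]
  rcases lt_or_gt_of_ne hne with h | h
  · rw [if_pos h, if_neg (not_lt.2 h.le)]; simp
  · rw [if_pos h, if_neg (not_lt.2 h.le)]; simp

/-- Small nonzero integers stay nonzero. -/
def BigChar (F : Type) [Field F] : Prop := ∀ z : ℤ, z ≠ 0 → |z| < 5000 → (z : F) ≠ 0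

theorem αdef_good (hF : BigChar F) (T : Tmpl P L) : Good T (αdef F T) := by
  have key : ∀ (k : Fin 20) (x y q' r' e e' : ℤ), gv k x y q' r' e e' ≠ 0 →
      |gv k x y q' r' e e'| < 5000 →
      gv k (x : F) (y : F) (q' : F) (r' : F) (e : F) (e' : F) ≠ 0 := by
    intro k x y q' r' e e' h1 h2
    rw [gv_cast]; exact hF _ h1 h2
  intro k p q r hrel
  unfold gα
  by_cases hk : k.val < 5
  · have hdum : ∀ x q' y r' e e' : F, gv k x y q' r' e e' = gv k x 0 q' 0 0 0 := by
      intro x q' y r' e e'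
      obtain ⟨k, hk20⟩ := k
      simp only at hk
      interval_cases k <;> simp [gv]
    rw [hdum]
    rcases αdef_pair (F := F) T hrel.1 with h | h | h | h | h | h <;> rw [h.1, h.2]
    · simpa using key k 1 0 5 0 0 0 (by clear * - hk; revert k; decide) (by clear * - hk; revert k; decide)
    · simpa using key k 5 0 1 0 0 0 (by clear * - hk; revert k; decide) (by clear * - hk; revert k; decide)
    · simpa using key k 3 0 7 0 0 0 (by clear * - hk; revert k; decide) (by clear * - hk; revert k; decide)
    · simpa using key k 7 0 3 0 0 0 (by clear * - hk; revert k; decide) (by clear * - hk; revert k; decide)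
    · simpa using key k 1 0 3 0 0 0 (by clear * - hk; revert k; decide) (by clear * - hk; revert k; decide)
    · simpa using key k 3 0 1 0 0 0 (by clear * - hk; revert k; decide) (by clear * - hk; revert k; decide)
  · have hc := hrel.2 (by omega)
    obtain ⟨h1, h2, h3⟩ := αdef_cl (F := F) T hc
    obtain ⟨h4, h5, h6⟩ := αdef_cl (F := F) T hc.symm
    have hne : q ≠ r := hc.2.2.1
    rw [h1, h2, h3, h4, h5, h6]
    rcases lt_or_gt_of_ne hne with h | h
    · simp only [if_pos h, if_neg (not_lt.2 h.le)]
      simpa using key k 1 3 5 7 1 3 (by clear * - hk; revert k; decide) (by clear * - hk; revert k; decide)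
    · simp only [if_pos h, if_neg (not_lt.2 h.le)]
      simpa using key k 3 1 7 5 3 1 (by clear * - hk; revert k; decide) (by clear * - hk; revert k; decide)

end GoodCoef

set_option linter.unusedVariables false
set_option linter.unusedSectionVars false
set_option linter.unusedTactic false

section Kill
variable {F : Type} [Field F] {P L : Type}

/-- membership in a triangle -/
def InTri (b a c x : P) : Prop := x = b ∨ x = a ∨ x = c

theorem ch_norm {χ : P → P → L} {b a c x y : P} (h : Cherry χ b a c) (hxy : x ≠ y)
    (hx : InTri b a c x) (hy : InTri b a c y) :
    ∃ a1 c1, Cherry χ b a1 c1 ∧ ((a1 = a ∧ c1 = c) ∨ (a1 = c ∧ c1 = a)) ∧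
      ((x = b ∧ y = a1) ∨ (x = a1 ∧ y = b) ∨ (x = a1 ∧ y = c1)) := by
  rcases hx with rfl | rfl | rfl <;> rcases hy with rfl | rfl | rfl <;>
    first | exact absurd rfl hxy | skip
  · exact ⟨_, _, h, by simp, by simp⟩
  · exact ⟨_, _, h.symm, by simp, by simp⟩
  · exact ⟨_, _, h, by simp, by simp⟩
  · exact ⟨_, _, h, by simp, by simp⟩
  · exact ⟨_, _, h.symm, by simp, by simp⟩
  · exact ⟨_, _, h.symm, by simp, by simp⟩

theorem Tmpl.ch_share (T : Tmpl P L) {b a c b' a' c' x y : P} (h : Cherry T.χ b a c)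
    (h' : Cherry T.χ b' a' c') (hxy : x ≠ y) (hx : InTri b a c x) (hy : InTri b a c y)
    (hx' : InTri b' a' c' x) (hy' : InTri b' a' c' y) :
    b = b' ∧ ((a = a' ∧ c = c') ∨ (a = c' ∧ c = a')) := by
  obtain ⟨a1, c1, k, o, n⟩ := ch_norm h hxy hx hy
  obtain ⟨a2, c2, k', o', n'⟩ := ch_norm h' hxy hx' hy'
  suffices hh : b = b' ∧ ((a1 = a2 ∧ c1 = c2) ∨ (a1 = c2 ∧ c1 = a2)) by
    refine ⟨hh.1, ?_⟩
    rcases o with ⟨rfl, rfl⟩ | ⟨rfl, rfl⟩ <;> rcases o' with ⟨rfl, rfl⟩ | ⟨rfl, rfl⟩ <;> tauto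
  clear h h' o o' hx hy hx' hy'
  rcases n with ⟨rfl, rfl⟩ | ⟨rfl, rfl⟩ | ⟨rfl, rfl⟩ <;>
    rcases n' with ⟨rfl, rfl⟩ | ⟨rfl, rfl⟩ | ⟨rfl, rfl⟩
  · exact ⟨rfl, Or.inl ⟨rfl, T.ch_unique k' k⟩⟩
  · exact absurd k' (T.ch_no1 k)
  · exact absurd k'.symm (T.ch_no3 k)
  · exact absurd k' (T.ch_no1 k)
  · exact ⟨rfl, Or.inl ⟨rfl, T.ch_unique k' k⟩⟩
  · exact absurd k' (T.ch_no3 k)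
  · exact absurd k.symm (T.ch_no3 k')
  · exact absurd k (T.ch_no3 k')
  · exact ⟨T.ch_centre k' k, Or.inl ⟨rfl, rfl⟩⟩

/-- Conditions on weights ensuring that a good coefficient function kills all rows but `v`. -/
structure KillOK (s : Fin 5 → Fin 5 → F) (v : Fin 5) : Prop where
  symm : ∀ u w, s u w = s w u
  diag : ∀ u, s u u = 0
  nz : ∃ w, s v w ≠ 0
  one : ∀ u, u ≠ v → ∀ w, s u w ≠ 0 → ∃ w', w' ≠ w ∧ s u w' ≠ 0
  two : ∀ u, u ≠ v → ∀ w w', w ≠ w' → s u w ≠ 0 → s u w' ≠ 0 →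
    (∀ x, s u x ≠ 0 → x = w ∨ x = w') →
    s u w + s u w' ≠ 0 ∧ s u w - s u w' ≠ 0 ∧ s u w + 2 * s u w' ≠ 0 ∧ s u w - 2 * s u w' ≠ 0 ∧
    s u w ^ 2 - s u w * s u w' + s u w' ^ 2 ≠ 0
  four : ∀ p q r, p ≠ q → p ≠ r → q ≠ r → q ≠ v → r ≠ v →
    s q p ≠ 0 → s q r ≠ 0 → s r p ≠ 0 →
    (∀ x, s q x ≠ 0 → x = p ∨ x = r) → (∀ x, s r x ≠ 0 → x = p ∨ x = q) →
    s q p + s r p ≠ 0 ∧ s q p - s r p ≠ 0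

variable (U : Fin 5 → P) (s : Fin 5 → Fin 5 → F) (v : Fin 5)

def RowOK (p : P) (a : P → F) : Prop :=
  ∀ u, u ≠ v → U u = p → ∑ w, s u w * a (U w) = 0

variable [DecidableEq P] {U s v}

theorem sum_single (hU : Function.Injective U) (f : Fin 5 → F) (w : Fin 5) (z : F) :
    ∑ x, f x * (Pi.single (U w) z : P → F) (U x) = f w * z := by
  rw [Finset.sum_eq_single w]
  · simp
  · intro b _ hb
    rw [Pi.single_eq_of_ne (fun h => hb (hU h)), mul_zero]
  · simp

theorem sum_single' (f : Fin 5 → F) (q : P) (hq : ∀ w, U w ≠ q) (z : F) :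
    ∑ x, f x * (Pi.single q z : P → F) (U x) = 0 := by
  apply Finset.sum_eq_zero
  intro x _
  rw [Pi.single_eq_of_ne (hq x), mul_zero]

theorem rowR1 (hU : Function.Injective U) (hs : KillOK s v) (p q : P) :
    ∃ a, RowOK U s v p a ∧ a q ≠ 0 := by
  by_cases h : ∃ u w, u ≠ v ∧ U u = p ∧ U w = q ∧ s u w ≠ 0
  · obtain ⟨u, w, huv, rfl, rfl, hsw⟩ := h
    obtain ⟨w', hw', hsw'⟩ := hs.one u huv w hsw
    refine ⟨Pi.single (U w) (s u w') + Pi.single (U w') (- s u w), ?_, ?_⟩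
    · intro u' hu' he
      obtain rfl := hU he
      simp only [Pi.add_apply, mul_add, Finset.sum_add_distrib]
      rw [sum_single hU, sum_single hU]; ring
    · simp only [Pi.add_apply, Pi.single_eq_same]
      rw [Pi.single_eq_of_ne (fun h => hw' (hU h).symm)]
      simpa using hsw'
  · refine ⟨Pi.single q 1, ?_, by simp⟩
    intro u huv hu
    by_cases hq : ∃ w, U w = q
    · obtain ⟨w, hw⟩ := hq
      have : s u w = 0 := by
        by_contra h0; exact h ⟨u, w, huv, hu, hw, h0⟩
      rw [← hw, sum_single hU, this, zero_mul]
    · push Not at hq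
      exact sum_single' _ _ hq _

theorem rowR2 (hU : Function.Injective U) (hs : KillOK s v) (p q r : P) (hqr : q ≠ r) :
    (∃ a, RowOK U s v p a ∧ a q = 0 ∧ a r ≠ 0) ∨
    ∃ u w w', u ≠ v ∧ U u = p ∧ U w = q ∧ U w' = r ∧ s u w ≠ 0 ∧ s u w' ≠ 0 ∧
      (∀ x, s u x ≠ 0 → x = w ∨ x = w') := by
  by_cases h : ∃ u w, u ≠ v ∧ U u = p ∧ U w = r ∧ s u w ≠ 0
  · obtain ⟨u, w', huv, rfl, rfl, hsw⟩ := h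
    by_cases h2 : ∃ x, x ≠ w' ∧ s u x ≠ 0 ∧ U x ≠ q
    · left
      obtain ⟨x, hx, hsx, hxq⟩ := h2
      refine ⟨Pi.single (U w') (s u x) + Pi.single (U x) (- s u w'), ?_, ?_, ?_⟩
      · intro u' hu' he
        obtain rfl := hU he
        simp only [Pi.add_apply, mul_add, Finset.sum_add_distrib]
        rw [sum_single hU, sum_single hU]; ring
      · simp only [Pi.add_apply]
        rw [Pi.single_eq_of_ne hqr, Pi.single_eq_of_ne hxq.symm, add_zero]
      · simp only [Pi.add_apply, Pi.single_eq_same]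
        rw [Pi.single_eq_of_ne (fun h => hx (hU h).symm)]
        simpa using hsx
    · right
      push Not at h2
      obtain ⟨w, hw, hsw2⟩ := hs.one u huv w' hsw
      have hwq := h2 w hw hsw2
      refine ⟨u, w, w', huv, rfl, hwq, rfl, hsw2, hsw, fun x hx => ?_⟩
      by_cases hxw : x = w'
      · exact Or.inr hxw
      · left; apply hU; rw [h2 x hxw hx, hwq]
  · left
    refine ⟨Pi.single r 1, ?_, Pi.single_eq_of_ne hqr _, by simp⟩
    intro u huv hu
    by_cases hq : ∃ w, U w = r
    · obtain ⟨w, hw⟩ := hq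
      have : s u w = 0 := by
        by_contra h0; exact h ⟨u, w, huv, hu, hw, h0⟩
      rw [← hw, sum_single hU, this, zero_mul]
    · push Not at hq
      exact sum_single' _ _ hq _

variable (U s v) in
/-- The linear space of coefficient functions killing all rows but `v`. -/
def ASp : Set (P → P → F) := {β | ∀ p, RowOK U s v p (β p)}

theorem RowOK.zero (p : P) : RowOK U s v p (0 : P → F) := by
  intro u _ _; simp

/-- one prescribed row -/
theorem asp_one (p : P) (a : P → F) (ha : RowOK U s v p a) :
    (Pi.single p a : P → P → F) ∈ ASp U s v := by
  intro x
  by_cases h : x = p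
  · subst h; simpa using ha
  · rw [Pi.single_eq_of_ne h]; exact RowOK.zero x

theorem asp_two (p q : P) (hpq : p ≠ q) (a b : P → F) (ha : RowOK U s v p a)
    (hb : RowOK U s v q b) : ∃ β ∈ ASp U s v, β p = a ∧ β q = b := by
  refine ⟨fun x => if x = p then a else if x = q then b else 0, ?_, by simp, by simp [hpq.symm]⟩
  intro x
  by_cases h : x = p
  · subst h; simpa using ha
  · by_cases h2 : x = q
    · subst h2; simpa [h] using hb
    · simpa [h, h2] using RowOK.zero x

theorem asp_nonvanish (hU : Function.Injective U) (hs : KillOK s v) (T : Tmpl P L) (k : Fin 20)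
    (p q r : P) (hrel : GRel T k p q r) : ∃ β ∈ ASp U s v, gα k p q r β ≠ 0 := by
  have hpq := hrel.1
  by_cases hk5 : k.val < 5
  · obtain ⟨a, ha, haq⟩ := rowR1 hU hs p q
    refine ⟨_, asp_one p a ha, ?_⟩
    have e1 : (Pi.single p a : P → P → F) q = 0 := Pi.single_eq_of_ne hpq.symm _
    unfold gα
    rw [e1, Pi.single_eq_same]
    obtain ⟨k, hk⟩ := k
    simp only at hk5
    interval_cases k <;> simpa [gv] using haq
  have hc := hrel.2 (by omega)
  have hpr : p ≠ r := hc.2.1.symm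
  have hqr : q ≠ r := hc.2.2.1
  by_cases hk10 : k.val < 10
  · rcases rowR2 hU hs p q r hqr with ⟨a, ha, h1, h2⟩ | ⟨u, w, w', huv, rfl, rfl, rfl, h1, h2, h3⟩
    · refine ⟨_, asp_one p a ha, ?_⟩
      have e1 : (Pi.single p a : P → P → F) q = 0 := Pi.single_eq_of_ne hpq.symm _
      have e2 : (Pi.single p a : P → P → F) r = 0 := Pi.single_eq_of_ne hpr.symm _
      unfold gα
      rw [e1, e2, Pi.single_eq_same, h1]
      obtain ⟨k, hk⟩ := k
      simp only at hk5 hk10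
      interval_cases k <;> first | omega | simpa [gv] using h2
    · have hww : w ≠ w' := fun h => hqr (by rw [h])
      obtain ⟨g1, g2, g3, g4, g5⟩ := hs.two u huv w w' hww h1 h2 h3
      refine ⟨_, asp_one (U u) (Pi.single (U w) (s u w') + Pi.single (U w') (- s u w)) ?_, ?_⟩
      · intro u' hu' he
        obtain rfl := hU he
        simp only [Pi.add_apply, mul_add, Finset.sum_add_distrib]
        rw [sum_single hU, sum_single hU]; ring
      · set a : P → F := (Pi.single (U w) (s u w') + Pi.single (U w') (- s u w)) with hadef
        have ea : a (U w) = s u w' := by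
          simp [hadef, Pi.single_eq_of_ne hqr]
        have eb : a (U w') = - s u w := by
          simp [hadef, Pi.single_eq_of_ne hqr.symm]
        have e1 : (Pi.single (U u) a : P → P → F) (U w) = 0 := Pi.single_eq_of_ne hpq.symm _
        have e2 : (Pi.single (U u) a : P → P → F) (U w') = 0 := Pi.single_eq_of_ne hpr.symm _
        unfold gα
        rw [e1, e2, Pi.single_eq_same, ea, eb]
        obtain ⟨k, hk⟩ := k
        simp only at hk5 hk10
        interval_cases k <;> first | omega | skip
        all_goals simp only [gv]
        · intro h; exact g2 (by linear_combination -h)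
        · intro h; exact g1 (by linear_combination -h)
        · intro h; exact g4 (by linear_combination -h)
        · intro h; exact g3 (by linear_combination -h)
        · intro h; exact g5 (by linear_combination h)
  by_cases hk18 : k.val < 18
  · obtain ⟨a, ha, haq⟩ := rowR1 hU hs q p
    refine ⟨_, asp_one q a ha, ?_⟩
    have e1 : (Pi.single q a : P → P → F) p = 0 := Pi.single_eq_of_ne hpq _
    have e2 : (Pi.single q a : P → P → F) r = 0 := Pi.single_eq_of_ne hqr.symm _
    unfold gα
    rw [e1, e2, Pi.single_eq_same]
    obtain ⟨k, hk⟩ := k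
    simp only at hk5 hk10 hk18
    interval_cases k <;> first | omega | simpa [gv] using haq
  have hlast : ∀ β : P → P → F, (β q p * β r q + β r p * β q r ≠ 0) →
      (β q p * β r q - β r p * β q r ≠ 0) → gα k p q r β ≠ 0 := by
    intro β h1 h2
    unfold gα
    obtain ⟨k, hk⟩ := k
    simp only at hk5 hk10 hk18
    interval_cases k <;> first | omega | skip
    · simpa [gv] using h1
    · simpa [gv] using h2
  rcases rowR2 hU hs q r p hpr.symm with ⟨a, ha, h1, h2⟩ |
      ⟨u, w, w', huv, hu, hw, hw', h1, h2, h3⟩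
  · obtain ⟨b, hb, hbq⟩ := rowR1 hU hs r q
    obtain ⟨β, hβ, e1, e2⟩ := asp_two q r hqr a b ha hb
    refine ⟨β, hβ, hlast β ?_ ?_⟩ <;> rw [e1, e2, h1] <;> simpa using ⟨h2, hbq⟩
  rcases rowR2 hU hs r q p hpq.symm with ⟨a, ha, g1, g2⟩ |
      ⟨u', y, y', huv', hu', hy, hy', g1, g2, g3⟩
  · obtain ⟨b, hb, hbq⟩ := rowR1 hU hs q r
    obtain ⟨β, hβ, e1, e2⟩ := asp_two r q hqr.symm a b ha hb
    refine ⟨β, hβ, hlast β ?_ ?_⟩ <;> rw [e1, e2, g1] <;> simpa using ⟨g2, hbq⟩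
  -- both rows have support of size two
  have : y = u := hU (by rw [hy, hu])
  subst this
  have : w = u' := hU (by rw [hw, hu'])
  subst this
  have : y' = w' := hU (by rw [hy', hw'])
  subst this
  have hne1 : y' ≠ y := fun h => hpq (by rw [← hy', ← hy, h])
  have hne2 : y' ≠ w := fun h => hpr (by rw [← hy', ← hw, h])
  have hne3 : y ≠ w := fun h => hqr (by rw [← hw, ← hy, h])
  obtain ⟨f1, f2⟩ := hs.four y' y w hne1 hne2 hne3 huv huv' h2 h1 g2
    (fun x hx => (h3 x hx).symm) (fun x hx => (g3 x hx).symm)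
  have hra : RowOK U s v q (Pi.single p (s y w) + Pi.single r (- s y y')) := by
    intro u hu' he
    have : u = y := hU (by rw [he, hy])
    subst this
    rw [← hw, ← hy']
    simp only [Pi.add_apply, mul_add, Finset.sum_add_distrib]
    rw [sum_single hU, sum_single hU]; ring
  have hrb : RowOK U s v r (Pi.single p (s w y) + Pi.single q (- s w y')) := by
    intro u hu' he
    have : u = w := hU (by rw [he, hw])
    subst this
    rw [← hy, ← hy']
    simp only [Pi.add_apply, mul_add, Finset.sum_add_distrib]
    rw [sum_single hU, sum_single hU]; ring
  obtain ⟨β, hβ, e1, e2⟩ := asp_two q r hqr _ _ hra hrb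
  have c1 : β q p = s y w := by rw [e1]; simp [Pi.single_eq_of_ne hpr]
  have c2 : β q r = - s y y' := by rw [e1]; simp [Pi.single_eq_of_ne hpr.symm]
  have c3 : β r p = s y w := by rw [e2, hs.symm y w]; simp [Pi.single_eq_of_ne hpq]
  have c4 : β r q = - s w y' := by rw [e2]; simp [Pi.single_eq_of_ne hpq.symm]
  refine ⟨β, hβ, hlast β ?_ ?_⟩
  · rw [c1, c2, c3, c4]
    intro h
    have : s y w * (s y y' + s w y') = 0 := by linear_combination -h
    rcases mul_eq_zero.1 this with h | h
    · exact h1 h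
    · exact f1 h
  · rw [c1, c2, c3, c4]
    intro h
    have : s y w * (s y y' - s w y') = 0 := by linear_combination h
    rcases mul_eq_zero.1 this with h | h
    · exact h1 h
    · exact f2 h


variable (U) in
def InU (x : P) : Prop := ∃ i, U i = x

variable (U) in
/-- triangles with two parts in the range of `U` -/
def HotTri (T : Tmpl P L) (b a c : P) : Prop :=
  Cherry T.χ b a c ∧ ((InU U b ∧ InU U a) ∨ (InU U b ∧ InU U c) ∨ (InU U a ∧ InU U c))

variable (U) in
def Touched (T : Tmpl P L) (p q : P) : Prop :=
  p ≠ q ∧ ((InU U p ∧ InU U q) ∨ ∃ b a c, HotTri U T b a c ∧ InTri b a c p ∧ InTri b a c q)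

theorem Touched.symm {T : Tmpl P L} {p q : P} (h : Touched U T p q) : Touched U T q p := by
  refine ⟨h.1.symm, ?_⟩
  rcases h.2 with h | ⟨b, a, c, h1, h2, h3⟩
  · exact Or.inl h.symm
  · exact Or.inr ⟨b, a, c, h1, h3, h2⟩

theorem touched_hot {T : Tmpl P L} {b a c x y : P} (h : Cherry T.χ b a c)
    (hx : InTri b a c x) (hy : InTri b a c y) (ht : Touched U T x y) : HotTri U T b a c := by
  obtain ⟨hxy, ht | ⟨b', a', c', h1, h2, h3⟩⟩ := ht
  · refine ⟨h, ?_⟩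
    rcases hx with rfl | rfl | rfl <;> rcases hy with rfl | rfl | rfl <;> first
      | exact absurd rfl hxy | tauto
  · obtain ⟨rfl, ⟨rfl, rfl⟩ | ⟨rfl, rfl⟩⟩ := T.ch_share h1.1 h hxy h2 h3 hx hy
    · exact h1
    · refine ⟨h, ?_⟩
      have := h1.2
      tauto

theorem hot_touched {T : Tmpl P L} {b a c x y : P} (h : HotTri U T b a c)
    (hxy : x ≠ y) (hx : InTri b a c x) (hy : InTri b a c y) : Touched U T x y :=
  ⟨hxy, Or.inr ⟨b, a, c, h, hx, hy⟩⟩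

variable (U) in
/-- the property of being the third vertex over two parts of `U` -/
def IsThird (T : Tmpl P L) (i j : Fin 5) (w : P) : Prop :=
  U i ≠ U j ∧ w ≠ U i ∧ w ≠ U j ∧
    ∃ b a c, Cherry T.χ b a c ∧ InTri b a c (U i) ∧ InTri b a c (U j) ∧ InTri b a c w

theorem isThird_unique {T : Tmpl P L} {i j : Fin 5} {w w' : P} (h : IsThird U T i j w)
    (h' : IsThird U T i j w') : w = w' := by
  obtain ⟨h0, h1, h2, b, a, c, hc, hi, hj, hw⟩ := h
  obtain ⟨-, h1', h2', b', a', c', hc', hi', hj', hw'⟩ := h'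
  have hh := T.ch_share hc hc' h0 hi hj hi' hj'
  have hset : ∀ x, InTri b' a' c' x → InTri b a c x := by
    intro x hx
    obtain ⟨e1, ⟨e2, e3⟩ | ⟨e2, e3⟩⟩ := hh
    · rw [e1, e2, e3]; exact hx
    · rw [e1, e2, e3]
      rcases hx with h | h | h
      · exact Or.inl h
      · exact Or.inr (Or.inr h)
      · exact Or.inr (Or.inl h)
  have hw2 := hset w' hw'
  clear hset hh hi' hj' hw' hc' hc
  generalize U i = x at *
  generalize U j = y at *
  rcases hi with rfl | rfl | rfl <;> rcases hj with rfl | rfl | rfl <;>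
  rcases hw with rfl | rfl | rfl <;> rcases hw2 with rfl | rfl | rfl <;> first
    | rfl
    | exact absurd rfl h0
    | exact absurd rfl h1
    | exact absurd rfl h2
    | exact absurd rfl h1'
    | exact absurd rfl h2'

open Classical in
variable (U) in
noncomputable def third (T : Tmpl P L) (ij : Fin 5 × Fin 5) : P :=
  if h : ∃ w, IsThird U T ij.1 ij.2 w then h.choose else U 0

variable (U) in
noncomputable def Vset (T : Tmpl P L) : Finset P :=
  Finset.univ.image U ∪ Finset.univ.image (third U T)

theorem Vset_card (T : Tmpl P L) : (Vset U T).card ≤ 30 := by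
  refine (Finset.card_union_le _ _).trans ?_
  have h1 := Finset.card_image_le (s := (Finset.univ : Finset (Fin 5))) (f := U)
  have h2 := Finset.card_image_le (s := (Finset.univ : Finset (Fin 5 × Fin 5))) (f := third U T)
  simp only [Finset.card_univ, Fintype.card_prod, Fintype.card_fin] at h1 h2
  omega

theorem inU_V (T : Tmpl P L) {x : P} (h : InU U x) : x ∈ Vset U T := by
  obtain ⟨i, rfl⟩ := h
  exact Finset.mem_union_left _ (Finset.mem_image_of_mem _ (Finset.mem_univ _))

theorem hot_V {T : Tmpl P L} {b a c x : P} (h : HotTri U T b a c) (hx : InTri b a c x) :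
    x ∈ Vset U T := by
  by_cases hxU : InU U x
  · exact inU_V T hxU
  have : ∃ i j, IsThird U T i j x := by
    obtain ⟨hc, hh⟩ := h
    have e1 := hc.1; have e2 := hc.2.1; have e3 := hc.2.2.1
    have hne : ∀ i, x ≠ U i := fun i hi => hxU ⟨i, hi.symm⟩
    rcases hh with ⟨⟨i, hi⟩, ⟨j, hj⟩⟩ | ⟨⟨i, hi⟩, ⟨j, hj⟩⟩ | ⟨⟨i, hi⟩, ⟨j, hj⟩⟩
    · exact ⟨i, j, by rw [hi, hj]; exact e1.symm, hne i, hne j, b, a, c, hc,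
        by rw [hi]; simp [InTri], by rw [hj]; simp [InTri], hx⟩
    · exact ⟨i, j, by rw [hi, hj]; exact e2.symm, hne i, hne j, b, a, c, hc,
        by rw [hi]; simp [InTri], by rw [hj]; simp [InTri], hx⟩
    · exact ⟨i, j, by rw [hi, hj]; exact e3, hne i, hne j, b, a, c, hc,
        by rw [hi]; simp [InTri], by rw [hj]; simp [InTri], hx⟩
  obtain ⟨i, j, hij⟩ := this
  refine Finset.mem_union_right _ (Finset.mem_image.2 ⟨(i, j), Finset.mem_univ _, ?_⟩)
  unfold third
  have hex : ∃ w, IsThird U T i j w := ⟨x, hij⟩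
  rw [dif_pos hex]
  exact isThird_unique hex.choose_spec hij

theorem touched_V {T : Tmpl P L} {p q : P} (h : Touched U T p q) : p ∈ Vset U T := by
  obtain ⟨hxy, ht | ⟨b, a, c, h1, h2, h3⟩⟩ := h
  · exact inU_V T ht.1
  · exact hot_V h1 h2

end Kill

section Kill2
variable {F : Type} [Field F] [Fintype F] [DecidableEq F] {P L : Type} [LinearOrder P]

/-- The kill lemma. -/
theorem kill_lemma (hF : BigChar F) (hbig : 2000000 < Fintype.card F) (T : Tmpl P L)
    (U : Fin 5 → P) (hU : Function.Injective U) (s : Fin 5 → Fin 5 → F) (v : Fin 5)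
    (hs : KillOK s v) : ∃ α : P → P → F, Good T α ∧
      (∀ u, u ≠ v → ∑ w, s u w * α (U u) (U w) = 0) ∧ ∑ w, s v w * α (U v) (U w) ≠ 0 := by
  classical
  let g : Option (Fin 20 × P × P × P) → (P → P → F) → F := fun i β => match i with
    | none => ∑ w, s v w * β (U v) (U w)
    | some (k, p, q, r) => gα k p q r β
  let V := Vset U T
  let J0 : Finset (Fin 20 × P × P × P) :=
    (Finset.univ ×ˢ V ×ˢ V ×ˢ V).filter (fun i => GRel T i.1 i.2.1 i.2.2.1 i.2.2.2)
  have hJ0 : J0.card ≤ 20 * (30 * (30 * 30)) := by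
    refine (Finset.card_filter_le _ _).trans ?_
    simp only [Finset.card_product, Finset.card_univ, Fintype.card_fin]
    have := Vset_card (U := U) T
    gcongr
  have hA : ∀ a ∈ ASp U s v, ∀ b ∈ ASp U s v, ∀ τ : F, a + τ • (b - a) ∈ ASp U s v := by
      intro a ha b hb τ p u huv hu
      have h1 := ha p u huv hu
      have h2 := hb p u huv hu
      simp only [Pi.add_apply, Pi.smul_apply, Pi.sub_apply, smul_eq_mul]
      calc ∑ w, s u w * (a p (U w) + τ * (b p (U w) - a p (U w)))
          = (1 - τ) * ∑ w, s u w * a p (U w) + τ * ∑ w, s u w * b p (U w) := by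
            rw [Finset.mul_sum, Finset.mul_sum, ← Finset.sum_add_distrib]
            exact Finset.sum_congr rfl fun w _ => by ring
        _ = 0 := by rw [h1, h2]; ring
  have hline := line_lemma (F := F) (ASp U s v) hA
    ⟨0, fun p => RowOK.zero p⟩ g (by
      intro i
      match i with
      | none =>
        intro a b
        refine ⟨∑ w, s v w * a (U v) (U w), ∑ w, s v w * (b (U v) (U w) - a (U v) (U w)), 0, ?_⟩
        intro τ
        simp only [g, Pi.add_apply, Pi.smul_apply, Pi.sub_apply, smul_eq_mul]
        rw [Finset.sum_mul, zero_mul, add_zero, ← Finset.sum_add_distrib]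
        exact Finset.sum_congr rfl fun w _ => by ring
      | some (k, p, q, r) => exact gα_isQ k p q r)
    (Finset.insertNone J0) (by
      intro j hj
      rcases j with _ | ⟨k, p, q, r⟩
      · obtain ⟨w, hw⟩ := hs.nz
        refine ⟨Pi.single (U v) (Pi.single (U w) 1), asp_one _ _ ?_, ?_⟩
        · intro u huv hu
          exact absurd (hU hu) huv
        · simp only [g, Pi.single_eq_same]
          rw [sum_single hU]; simpa using hw
      · have : (k, p, q, r) ∈ J0 := by simpa using hj
        exact asp_nonvanish hU hs T k p q r (Finset.mem_filter.1 this).2)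
    (by rw [Finset.card_insertNone]; omega)
  obtain ⟨β, hβ, hne⟩ := hline
  refine ⟨fun p q => if Touched U T p q then β p q else αdef F T p q, ?_, ?_, ?_⟩
  · intro k p q r hrel
    by_cases hk : k.val < 5
    · have hdum : ∀ x q' y r' e e' : F, gv k x y q' r' e e' = gv k x 0 q' 0 0 0 := by
        intro x q' y r' e e'
        obtain ⟨k, hk20⟩ := k
        simp only at hk
        interval_cases k <;> simp [gv]
      unfold gα
      rw [hdum]
      by_cases ht : Touched U T p q
      · simp only [if_pos ht, if_pos ht.symm]
        have hm : (k, p, q, p) ∈ J0 := by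
          simp only [J0, Finset.mem_filter, Finset.mem_product, Finset.mem_univ, true_and]
          exact ⟨⟨touched_V ht, touched_V ht.symm, touched_V ht⟩, hrel.1, fun h => by omega⟩
        have := hne (some (k, p, q, p)) (by simpa using hm)
        simp only [g, gα] at this
        rwa [hdum] at this
      · have ht' : ¬ Touched U T q p := fun h => ht h.symm
        simp only [if_neg ht, if_neg ht']
        have := αdef_good hF T k p q r hrel
        unfold gα at this
        rwa [hdum] at this
    · have hc := hrel.2 (by omega)
      have e1 := hc.1; have e2 := hc.2.1; have e3 := hc.2.2.1
      have i1 : InTri p q r p := Or.inl rfl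
      have i2 : InTri p q r q := Or.inr (Or.inl rfl)
      have i3 : InTri p q r r := Or.inr (Or.inr rfl)
      by_cases ht : HotTri U T p q r
      · have hm : (k, p, q, r) ∈ J0 := by
          simp only [J0, Finset.mem_filter, Finset.mem_product, Finset.mem_univ, true_and]
          exact ⟨⟨hot_V ht i1, hot_V ht i2, hot_V ht i3⟩, hrel⟩
        have := hne (some (k, p, q, r)) (by simpa using hm)
        simp only [g, gα] at this
        unfold gα
        beta_reduce
        rw [if_pos (hot_touched ht e1.symm i1 i2), if_pos (hot_touched ht e2.symm i1 i3),
          if_pos (hot_touched ht e1 i2 i1), if_pos (hot_touched ht e2 i3 i1),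
          if_pos (hot_touched ht e3 i2 i3), if_pos (hot_touched ht e3.symm i3 i2)]
        exact this
      · have := αdef_good hF T k p q r hrel
        unfold gα at this ⊢
        beta_reduce
        rw [if_neg (fun h => ht (touched_hot hc i1 i2 h)),
          if_neg (fun h => ht (touched_hot hc i1 i3 h)),
          if_neg (fun h => ht (touched_hot hc i2 i1 h)),
          if_neg (fun h => ht (touched_hot hc i3 i1 h)),
          if_neg (fun h => ht (touched_hot hc i2 i3 h)),
          if_neg (fun h => ht (touched_hot hc i3 i2 h))]
        exact this
  · intro u huv
    have := hβ (U u) u huv rfl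
    rw [← this]
    refine Finset.sum_congr rfl fun w _ => ?_
    by_cases huw : u = w
    · subst huw; rw [hs.diag, zero_mul, zero_mul]
    · beta_reduce
      rw [if_pos ⟨fun h => huw (hU h), Or.inl ⟨⟨u, rfl⟩, ⟨w, rfl⟩⟩⟩]
  · have := hne none (by simp)
    simp only [g] at this
    convert this using 1
    refine Finset.sum_congr rfl fun w _ => ?_
    by_cases huw : v = w
    · subst huw; rw [hs.diag, zero_mul, zero_mul]
    · beta_reduce
      rw [if_pos ⟨fun h => huw (hU h), Or.inl ⟨⟨v, rfl⟩, ⟨w, rfl⟩⟩⟩]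

end Kill2

set_option linter.unusedVariables false
set_option linter.unusedSectionVars false

section Lead
variable {F Tt : Type} [Field F]

/-- The entry of a vector at a position depending only on its support. -/
noncomputable def lead [Nonempty Tt] (D : Tt → F) : F :=
  D (Classical.epsilon (fun t => D t ≠ 0))

variable [Nonempty Tt]

theorem lead_pt {D E : Tt → F} (hD : D ≠ 0) (h : ∀ t, D t = 0 ↔ E t = 0) :
    ∃ t, D t ≠ 0 ∧ lead D = D t ∧ lead E = E t := by
  have h2 : (fun t => E t ≠ 0) = (fun t => D t ≠ 0) := by
    funext t; rw [ne_eq, ne_eq, h t]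
  refine ⟨Classical.epsilon (fun t => D t ≠ 0), ?_, rfl, ?_⟩
  · apply Classical.epsilon_spec (p := fun t => D t ≠ 0)
    by_contra hc
    push Not at hc
    exact hD (funext hc)
  · rw [lead, h2]

theorem lead_sq_neg (D E : Tt → F) : lead (D - E) ^ 2 = lead (E - D) ^ 2 := by
  by_cases h : D - E = 0
  · have : E - D = 0 := by rw [← neg_sub, h, neg_zero]
    rw [h, this]
  · obtain ⟨t, ht, h1, h2⟩ := lead_pt (D := D - E) (E := E - D) h (by
      intro t
      simp only [Pi.sub_apply, sub_eq_zero]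
      exact eq_comm)
    rw [h1, h2]
    simp only [Pi.sub_apply]; ring

end Lead

section Col
variable {P L F Tt : Type} [LinearOrder P] [Field F] [Fintype F] [DecidableEq F] [Nonempty Tt]

/-- The colour set. -/
abbrev Colr (L F Tt : Type) := (L × (Tt → F)) ⊕ (F × (Tt → F))

/-- The colouring. -/
noncomputable def col (T : Tmpl P L) (code : Tt → P → P → F) (a b : P × (Tt → F)) :
    Colr L F Tt :=
  if a.1 = b.1 then Sum.inr (lead (a.2 - b.2) ^ 2, a.2 + b.2)
  else Sum.inl (T.χ a.1 b.1, fun t => code t a.1 b.1 * a.2 t + code t b.1 a.1 * b.2 t)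

variable (T : Tmpl P L) (code : Tt → P → P → F)

theorem col_symm (a b : P × (Tt → F)) : col T code a b = col T code b a := by
  unfold col
  by_cases h : a.1 = b.1
  · rw [if_pos h, if_pos h.symm, lead_sq_neg, add_comm]
  · rw [if_neg h, if_neg (fun h' => h h'.symm), T.symm]
    congr 2
    funext t; ring

variable {T code}

theorem col_bulk {a b c d : P × (Tt → F)} (h1 : a.1 ≠ b.1) (h2 : c.1 ≠ d.1)
    (h : col T code a b = col T code c d) :
    T.χ a.1 b.1 = T.χ c.1 d.1 ∧ ∀ t, code t a.1 b.1 * a.2 t + code t b.1 a.1 * b.2 t =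
      code t c.1 d.1 * c.2 t + code t d.1 c.1 * d.2 t := by
  unfold col at h
  rw [if_neg h1, if_neg h2] at h
  have h := Sum.inl.inj h
  rw [Prod.mk.injEq] at h
  exact ⟨h.1, fun t => congrFun h.2 t⟩

theorem col_loop {a b c d : P × (Tt → F)} (h1 : a.1 = b.1) (h2 : c.1 = d.1)
    (h : col T code a b = col T code c d) :
    lead (a.2 - b.2) ^ 2 = lead (c.2 - d.2) ^ 2 ∧ ∀ t, a.2 t + b.2 t = c.2 t + d.2 t := by
  unfold col at h
  rw [if_pos h1, if_pos h2] at h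
  have h := Sum.inr.inj h
  rw [Prod.mk.injEq] at h
  exact ⟨h.1, fun t => congrFun h.2 t⟩

theorem col_mixed {a b c d : P × (Tt → F)} (h1 : a.1 = b.1) (h2 : c.1 ≠ d.1)
    (h : col T code a b = col T code c d) : False := by
  unfold col at h
  rw [if_pos h1, if_neg h2] at h
  exact Sum.inr_ne_inl h

/-- two distinct vertices of one part have distinct vectors -/
theorem exists_ne_of {a b : P × (Tt → F)} (h : a ≠ b) (h1 : a.1 = b.1) :
    ∃ t, a.2 t - b.2 t ≠ 0 := by
  by_contra hc
  push Not at hc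
  exact h (Prod.ext h1 (funext fun t => sub_eq_zero.1 (hc t)))

variable (hG : ∀ t, Good T (code t)) (hF : BigChar F)

include hG in
theorem gd0 (t : Tt) {p q : P} (h : p ≠ q) : code t p q ≠ 0 :=
  hG t 0 p q q ⟨h, fun h => absurd h (by decide)⟩

include hG in
theorem gd (t : Tt) (k : Fin 20) {p q r : P} (h : Cherry T.χ p q r) :
    gα k p q r (code t) ≠ 0 :=
  hG t k p q r ⟨h.1.symm, fun _ => h⟩

include hF in
theorem two_ne : (2 : F) ≠ 0 := by
  have := hF 2 (by norm_num) (by norm_num); exact_mod_cast this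

include hF in
theorem three_ne : (3 : F) ≠ 0 := by
  have := hF 3 (by norm_num) (by norm_num); exact_mod_cast this

include hG in
theorem cl_G1 {i j k : P × (Tt → F)} (hjk : j ≠ k) (h : j.1 = k.1)
    (e : col T code i j = col T code i k) : False := by
  obtain ⟨t, ht⟩ := exists_ne_of hjk h
  by_cases hi : i.1 = j.1
  · have := (col_loop hi (hi.trans h) e).2 t
    exact ht (by linear_combination this)
  · have h2 := (col_bulk hi (h ▸ hi) e).2 t
    rw [← h] at h2
    have : code t j.1 i.1 * (j.2 t - k.2 t) = 0 := by linear_combination h2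
    rcases mul_eq_zero.1 this with h3 | h3
    · exact gd0 hG t (Ne.symm hi) h3
    · exact ht h3

include hF in
theorem cl_C5a {a b c d : P × (Tt → F)} (had : a ≠ d) (hab : a.1 = b.1) (hac : a.1 = c.1)
    (hd : a.1 = d.1) (e1 : col T code a b = col T code c d)
    (e2 : col T code a c = col T code b d) : False := by
  obtain ⟨t, ht⟩ := exists_ne_of had hd
  have h1 := (col_loop hab (hac ▸ hd) e1).2 t
  have h2 := (col_loop hac (hab ▸ hd) e2).2 t
  have : (2 : F) * (a.2 t - d.2 t) = 0 := by linear_combination h1 + h2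
  rcases mul_eq_zero.1 this with h3 | h3
  · exact two_ne hF h3
  · exact ht h3

include hG hF in
theorem cl_A2 {a b c d : P × (Tt → F)} (hne : a ≠ b) (hab : a.1 = b.1) (hcd : c.1 = d.1)
    (hac : a.1 ≠ c.1) (e1 : col T code a c = col T code b d)
    (e2 : col T code b c = col T code a d) : False := by
  obtain ⟨t, ht⟩ := exists_ne_of hne hab
  have h1 := (col_bulk hac (hab ▸ hcd ▸ hac) e1).2 t
  have h2 := (col_bulk (hab ▸ hac) (hcd ▸ hac) e2).2 t
  rw [← hab, ← hcd] at h1 h2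
  have : (2 : F) * (code t a.1 c.1 * (a.2 t - b.2 t)) = 0 := by linear_combination h1 - h2
  rcases mul_eq_zero.1 this with h3 | h3
  · exact two_ne hF h3
  rcases mul_eq_zero.1 h3 with h3 | h3
  · exact gd0 hG t hac h3
  · exact ht h3

theorem sq_cases {x y : F} (h : x ^ 2 = y ^ 2) : x = y ∨ x = -y := sq_eq_sq_iff_eq_or_eq_neg.1 h

/-- The common argument for the clauses that use a loop colour coincidence. -/
theorem loop_scalar {a b c d : P × (Tt → F)} (hne : a ≠ b) (hab : a.1 = b.1) (hcd : c.1 = d.1)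
    (e : col T code a b = col T code c d) (m n : Tt → F) (hm : ∀ t, m t ≠ 0) (hn : ∀ t, n t ≠ 0)
    (h : ∀ t, m t * (a.2 t - b.2 t) = n t * (c.2 t - d.2 t)) :
    ∃ t, m t = n t ∨ m t = - n t := by
  have h0 := (col_loop hab hcd e).1
  obtain ⟨t, ht, h1, h2⟩ := lead_pt (D := a.2 - b.2) (E := c.2 - d.2) (by
      obtain ⟨t, ht⟩ := exists_ne_of hne hab
      intro h; exact ht (congrFun h t)) (by
    intro t
    simp only [Pi.sub_apply]
    have := h t
    constructor
    · intro h3; rw [h3, mul_zero] at this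
      exact (mul_eq_zero.1 this.symm).resolve_left (hn t)
    · intro h3; rw [h3, mul_zero] at this
      exact (mul_eq_zero.1 this).resolve_left (hm t))
  rw [h1, h2] at h0
  simp only [Pi.sub_apply] at h0 ht
  refine ⟨t, ?_⟩
  have h3 := h t
  rcases sq_cases h0 with h4 | h4
  · left
    rw [← h4] at h3
    exact mul_right_cancel₀ ht h3
  · right
    have : (m t + n t) * (a.2 t - b.2 t) = 0 := by linear_combination h3 + n t * h4
    rcases mul_eq_zero.1 this with h5 | h5
    · linear_combination h5
    · exact absurd h5 ht

include hG in
theorem gk (t : Tt) (k : Fin 20) (hk : ¬ 5 ≤ k.val) {p q : P} (h : p ≠ q) :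
    gv k (code t p q) (code t p q) (code t q p) (code t q p) (code t q q) (code t q q) ≠ 0 :=
  hG t k p q q ⟨h, fun h => absurd h hk⟩

include hG in
theorem cl_AL {a b c d : P × (Tt → F)} (hne : a ≠ b) (hab : a.1 = b.1) (hcd : c.1 = d.1)
    (hac : a.1 ≠ c.1) (e1 : col T code a b = col T code c d)
    (e2 : col T code a c = col T code b d) : False := by
  have h2 := (col_bulk hac (hab ▸ hcd ▸ hac) e2).2
  rw [← hab, ← hcd] at h2
  obtain ⟨t, ht⟩ := loop_scalar hne hab hcd e1 (fun t => code t a.1 c.1)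
    (fun t => - code t c.1 a.1) (fun t => gd0 hG t hac) (fun t => neg_ne_zero.2 (gd0 hG t hac.symm))
    (fun t => by linear_combination h2 t)
  rcases ht with ht | ht
  · apply gk hG t 1 (by decide) hac
    show code t a.1 c.1 + code t c.1 a.1 = 0
    linear_combination ht
  · apply gk hG t 2 (by decide) hac
    show code t a.1 c.1 - code t c.1 a.1 = 0
    linear_combination ht

include hG hF in
theorem cl_A3 {a b c d e : P × (Tt → F)} (hac : a ≠ c) (hde : d ≠ e) (hab : a.1 = b.1)
    (hac' : a.1 = c.1) (hde' : d.1 = e.1)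
    (had : a.1 ≠ d.1) (e1 : col T code a d = col T code b e) (e2 : col T code b d = col T code c e)
    (e3 : col T code c d = col T code a e ∨ col T code a c = col T code d e) : False := by
  have h1 := (col_bulk had (hab ▸ hde' ▸ had) e1).2
  have h2 := (col_bulk (hab ▸ had) (hac' ▸ hde' ▸ had) e2).2
  rw [← hab, ← hde'] at h1
  rw [← hab, ← hde', ← hac'] at h2
  rcases e3 with e3 | e3
  · have h3 := (col_bulk (hac' ▸ had) (hde' ▸ had) e3).2
    rw [← hde', ← hac'] at h3
    obtain ⟨t, ht⟩ := exists_ne_of hde hde'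
    have : (3 : F) * (code t d.1 a.1 * (d.2 t - e.2 t)) = 0 := by
      linear_combination h1 t + h2 t + h3 t
    rcases mul_eq_zero.1 this with h3 | h3
    · exact three_ne hF h3
    rcases mul_eq_zero.1 h3 with h3 | h3
    · exact gd0 hG t had.symm h3
    · exact ht h3
  · obtain ⟨t, ht⟩ := loop_scalar hac hac' hde' e3 (fun t => code t a.1 d.1)
      (fun t => - (2 * code t d.1 a.1)) (fun t => gd0 hG t had)
      (fun t => neg_ne_zero.2 (mul_ne_zero (two_ne hF) (gd0 hG t had.symm)))
      (fun t => by linear_combination h1 t + h2 t)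
    rcases ht with ht | ht
    · apply gk hG t 3 (by decide) had
      show code t a.1 d.1 + 2 * code t d.1 a.1 = 0
      linear_combination ht
    · apply gk hG t 4 (by decide) had
      show code t a.1 d.1 - 2 * code t d.1 a.1 = 0
      linear_combination ht

include hG in
theorem cl_C1 {a b c d : P × (Tt → F)} (hne : a ≠ b) (hab : a.1 = b.1) (hac : a.1 ≠ c.1)
    (had : a.1 ≠ d.1) (hcd : c.1 ≠ d.1) (e1 : col T code a c = col T code a d)
    (e2 : col T code b c = col T code b d) : False := by
  have h1 := col_bulk hac had e1
  have h2 := (col_bulk (hab ▸ hac) (hab ▸ had) e2).2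
  rw [← hab] at h2
  have hch : Cherry T.χ a.1 c.1 d.1 := ⟨hac.symm, had.symm, hcd, h1.1⟩
  obtain ⟨t, ht⟩ := exists_ne_of hne hab
  have : (code t a.1 d.1 - code t a.1 c.1) * (a.2 t - b.2 t) = 0 := by
    linear_combination h2 t - h1.2 t
  rcases mul_eq_zero.1 this with h3 | h3
  · exact gd hG t 6 hch h3
  · exact ht h3

include hG in
theorem cl_C2 {a b c d : P × (Tt → F)} (hne : a ≠ b) (hab : a.1 = b.1) (hac : a.1 ≠ c.1)
    (had : a.1 ≠ d.1) (hcd : c.1 ≠ d.1) (e1 : col T code a c = col T code b d)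
    (e2 : col T code b c = col T code a d) : False := by
  have h1 := col_bulk hac (hab ▸ had) e1
  have h2 := (col_bulk (hab ▸ hac) had e2).2
  rw [← hab] at h1 h2
  have hch : Cherry T.χ a.1 c.1 d.1 := ⟨hac.symm, had.symm, hcd, h1.1⟩
  obtain ⟨t, ht⟩ := exists_ne_of hne hab
  have : (code t a.1 d.1 + code t a.1 c.1) * (a.2 t - b.2 t) = 0 := by
    linear_combination h1.2 t - h2 t
  rcases mul_eq_zero.1 this with h3 | h3
  · exact gd hG t 5 hch h3
  · exact ht h3

include hG in
theorem cl_C3 {a b c d e : P × (Tt → F)} (hbc : b ≠ c) (hab : a.1 = b.1) (hac : a.1 = c.1)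
    (had : a.1 ≠ d.1) (hae : a.1 ≠ e.1) (hde : d.1 ≠ e.1) (e1 : col T code a d = col T code b e)
    (e2 : col T code b d = col T code c e) (e3 : col T code c d = col T code a e) : False := by
  have h1 := col_bulk had (hab ▸ hae) e1
  have h2 := (col_bulk (hab ▸ had) (hac ▸ hae) e2).2
  have h3 := (col_bulk (hac ▸ had) hae e3).2
  rw [← hab] at h1 h2
  rw [← hac] at h2 h3
  have hch : Cherry T.χ a.1 d.1 e.1 := ⟨had.symm, hae.symm, hde, h1.1⟩
  obtain ⟨t, ht⟩ := exists_ne_of hbc (hab.symm.trans hac)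
  have : (code t a.1 e.1 ^ 2 + code t a.1 d.1 * code t a.1 e.1 + code t a.1 d.1 ^ 2)
      * (b.2 t - c.2 t) = 0 := by
    have h1 := h1.2 t
    have h2 := h2 t
    have h3 := h3 t
    generalize code t a.1 d.1 = x at *
    generalize code t a.1 e.1 = y at *
    linear_combination x * (h2 - h3) - y * (h1 - h2)
  rcases mul_eq_zero.1 this with h3 | h3
  · exact gd hG t 9 hch h3
  · exact ht h3

include hG in
theorem cl_TTA {a b c d e i j : P × (Tt → F)} (hne : a ≠ b) (hab : a.1 = b.1) (hcd : c.1 = d.1)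
    (hac : a.1 ≠ c.1) (hae : a.1 ≠ e.1) (hce : c.1 ≠ e.1)
    (hi : i = a ∨ i = b) (hj : j = a ∨ j = b)
    (e1 : col T code a e = col T code i c) (e2 : col T code b e = col T code j d)
    (e3 : col T code a c = col T code b d ∨ col T code a d = col T code b c ∨
      col T code a b = col T code c d) : False := by
  have hi1 : i.1 = a.1 := by rcases hi with rfl | rfl; exacts [rfl, hab.symm]
  have hj1 : j.1 = a.1 := by rcases hj with rfl | rfl; exacts [rfl, hab.symm]
  have h1 := col_bulk hae (by rw [hi1]; exact hac) e1
  have h2 := (col_bulk (hab ▸ hae) (by rw [hj1, ← hcd]; exact hac) e2).2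
  rw [hi1] at h1
  rw [hj1, ← hab, ← hcd] at h2
  have hch : Cherry T.χ a.1 c.1 e.1 := ⟨hac.symm, hae.symm, hce, h1.1.symm⟩
  have hε : ∃ ε : F, (ε = 0 ∨ ε = 1 ∨ ε = -1) ∧ ∀ t, i.2 t - j.2 t = ε * (a.2 t - b.2 t) := by
    rcases hi with rfl | rfl <;> rcases hj with rfl | rfl
    · exact ⟨0, by simp, fun t => by ring⟩
    · exact ⟨1, by simp, fun t => by ring⟩
    · exact ⟨-1, by simp, fun t => by ring⟩
    · exact ⟨0, by simp, fun t => by ring⟩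
  obtain ⟨ε, hε1, hε2⟩ := hε
  have key : ∀ t, (code t a.1 e.1 - ε * code t a.1 c.1) * (a.2 t - b.2 t)
      = code t c.1 a.1 * (c.2 t - d.2 t) := fun t => by
    linear_combination h1.2 t - h2 t + code t a.1 c.1 * hε2 t
  obtain ⟨t, ht⟩ := exists_ne_of hne hab
  rcases e3 with e3 | e3 | e3
  · have h3 := (col_bulk hac (hab ▸ hcd ▸ hac) e3).2 t
    rw [← hab, ← hcd] at h3
    have : (code t a.1 e.1 - ε * code t a.1 c.1 + code t a.1 c.1) * (a.2 t - b.2 t) = 0 := by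
      linear_combination key t + h3
    have := (mul_eq_zero.1 this).resolve_right ht
    rcases hε1 with rfl | rfl | rfl
    · apply gd hG t 5 hch
      show code t a.1 e.1 + code t a.1 c.1 = 0
      linear_combination this
    · apply gd0 hG t hae
      linear_combination this
    · apply gd hG t 7 hch
      show code t a.1 e.1 + 2 * code t a.1 c.1 = 0
      linear_combination this
  · have h3 := (col_bulk (hcd ▸ hac) (hab ▸ hac) e3).2 t
    rw [← hab, ← hcd] at h3
    have : (code t a.1 e.1 - ε * code t a.1 c.1 - code t a.1 c.1) * (a.2 t - b.2 t) = 0 := by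
      linear_combination key t - h3
    have := (mul_eq_zero.1 this).resolve_right ht
    rcases hε1 with rfl | rfl | rfl
    · apply gd hG t 6 hch
      show code t a.1 e.1 - code t a.1 c.1 = 0
      linear_combination this
    · apply gd hG t 8 hch
      show code t a.1 e.1 - 2 * code t a.1 c.1 = 0
      linear_combination this
    · apply gd0 hG t hae
      linear_combination this
  · obtain ⟨t, ht⟩ := loop_scalar hne hab hcd e3 _ _ (fun t => by
      show code t a.1 e.1 - ε * code t a.1 c.1 ≠ 0
      rcases hε1 with rfl | rfl | rfl
      · rw [zero_mul, sub_zero]; exact gd0 hG t hae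
      · rw [one_mul]; exact gd hG t 6 hch
      · intro h0; apply gd hG t 5 hch
        show code t a.1 e.1 + code t a.1 c.1 = 0
        linear_combination h0) (fun t => gd0 hG t hac.symm) key
    rcases hε1 with rfl | rfl | rfl <;> rcases ht with ht | ht
    · apply gd hG t 11 hch
      show code t c.1 a.1 - code t a.1 e.1 = 0
      linear_combination -ht
    · apply gd hG t 10 hch
      show code t c.1 a.1 + code t a.1 e.1 = 0
      linear_combination ht
    · apply gd hG t 14 hch
      show code t c.1 a.1 - code t a.1 e.1 + code t a.1 c.1 = 0
      linear_combination -ht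
    · apply gd hG t 13 hch
      show code t c.1 a.1 + code t a.1 e.1 - code t a.1 c.1 = 0
      linear_combination ht
    · apply gd hG t 15 hch
      show code t c.1 a.1 - code t a.1 e.1 - code t a.1 c.1 = 0
      linear_combination -ht
    · apply gd hG t 12 hch
      show code t c.1 a.1 + code t a.1 e.1 + code t a.1 c.1 = 0
      linear_combination ht

include hG in
theorem cl_R {a b c d e : P × (Tt → F)} (hne : a ≠ b) (hab : a.1 = b.1) (hcd : c.1 = d.1)
    (hac : a.1 ≠ c.1) (hae : a.1 ≠ e.1) (hce : c.1 ≠ e.1)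
    (e1 : col T code a e = col T code c e) (e2 : col T code b e = col T code d e)
    (e3 : col T code a c = col T code b d ∨ col T code a d = col T code b c ∨
      col T code a b = col T code c d) : False := by
  have h1 := col_bulk hae hce e1
  have h2 := (col_bulk (hab ▸ hae) (hcd ▸ hce) e2).2
  rw [← hab, ← hcd] at h2
  have hch : Cherry T.χ e.1 a.1 c.1 := ⟨hae, hce, hac, by rw [T.symm, h1.1, T.symm]⟩
  have key : ∀ t, code t a.1 e.1 * (a.2 t - b.2 t)
      = code t c.1 e.1 * (c.2 t - d.2 t) := fun t => by
    linear_combination h1.2 t - h2 t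
  obtain ⟨t, ht⟩ := exists_ne_of hne hab
  rcases e3 with e3 | e3 | e3
  · have h3 := (col_bulk hac (hab ▸ hcd ▸ hac) e3).2 t
    rw [← hab, ← hcd] at h3
    have : (code t a.1 e.1 * code t c.1 a.1 + code t c.1 e.1 * code t a.1 c.1)
        * (a.2 t - b.2 t) = 0 := by
      linear_combination code t c.1 a.1 * key t + code t c.1 e.1 * h3
    exact gd hG t 18 hch ((mul_eq_zero.1 this).resolve_right ht)
  · have h3 := (col_bulk (hcd ▸ hac) (hab ▸ hac) e3).2 t
    rw [← hab, ← hcd] at h3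
    have : (code t a.1 e.1 * code t c.1 a.1 - code t c.1 e.1 * code t a.1 c.1)
        * (a.2 t - b.2 t) = 0 := by
      linear_combination code t c.1 a.1 * key t - code t c.1 e.1 * h3
    exact gd hG t 19 hch ((mul_eq_zero.1 this).resolve_right ht)
  · obtain ⟨t, ht⟩ := loop_scalar hne hab hcd e3 _ _ (fun t => gd0 hG t hae)
      (fun t => gd0 hG t hce) key
    rcases ht with ht | ht
    · apply gd hG t 17 hch
      show code t a.1 e.1 - code t c.1 e.1 = 0
      linear_combination ht
    · apply gd hG t 16 hch
      show code t a.1 e.1 + code t c.1 e.1 = 0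
      linear_combination ht

/-- A repeated colour of matching type on four vertices. -/
def Rep4 (T : Tmpl P L) (code : Tt → P → P → F) (i j k l : P × (Tt → F)) : Prop :=
  col T code i j = col T code k l ∨ col T code i k = col T code j l ∨
    col T code i l = col T code j k

theorem vec_eq {a b : P × (Tt → F)} (h : a ≠ b) (h1 : a.1 = b.1) (z : F) (hz : z ≠ 0)
    (h2 : ∀ t, z * (a.2 t - b.2 t) = 0) : False := by
  obtain ⟨t, ht⟩ := exists_ne_of h h1
  exact ht ((mul_eq_zero.1 (h2 t)).resolve_left hz)

theorem rep4_eqs {i j d e : P × (Tt → F)} (hj : i.1 = j.1) (hd : i.1 = d.1) (he : i.1 = e.1)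
    (h : Rep4 T code i j d e) :
    (col T code i j = col T code d e ∧ ∀ t, i.2 t + j.2 t = d.2 t + e.2 t) ∨
    ∃ ε : F, (ε = 1 ∨ ε = -1) ∧ ∀ t, i.2 t - j.2 t = ε * (e.2 t - d.2 t) := by
  rcases h with h | h | h
  · exact Or.inl ⟨h, (col_loop hj (hd ▸ he) h).2⟩
  · have := (col_loop hd (hj ▸ he) h).2
    exact Or.inr ⟨1, Or.inl rfl, fun t => by linear_combination this t⟩
  · have := (col_loop he (hj ▸ hd) h).2
    exact Or.inr ⟨-1, Or.inr rfl, fun t => by linear_combination this t⟩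

include hF in
/-- one sum type and two difference types -/
theorem c5b_one {a b c d e : P × (Tt → F)} (hne : a ≠ b) (hde : d ≠ e) (hb : a.1 = b.1)
    (hde' : d.1 = e.1)
    (e1 : col T code a b = col T code d e)
    {ε ε' : F} (h1 : ε = 1 ∨ ε = -1) (h2 : ε' = 1 ∨ ε' = -1)
    (h3 : ∀ t, a.2 t - c.2 t = ε * (e.2 t - d.2 t))
    (h4 : ∀ t, b.2 t - c.2 t = ε' * (e.2 t - d.2 t)) : False := by
  have hD : ∀ t, a.2 t - b.2 t = (ε - ε') * (e.2 t - d.2 t) := fun t => by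
    linear_combination h3 t - h4 t
  by_cases hee : ε = ε'
  · exact vec_eq hne hb 1 one_ne_zero (fun t => by rw [one_mul, hD t, hee]; ring)
  have h20 := two_ne hF
  have hk : ε - ε' = 2 ∨ ε - ε' = -2 := by
    rcases h1 with rfl | rfl <;> rcases h2 with rfl | rfl
    · exact absurd rfl hee
    · left; ring
    · right; ring
    · exact absurd rfl hee
  obtain ⟨t, ht⟩ := loop_scalar hne hb hde' e1 (fun _ => 1) (fun _ => -(ε - ε'))
    (fun _ => one_ne_zero) (fun _ => by
      rcases hk with hk | hk <;> rw [hk]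
      · exact neg_ne_zero.2 h20
      · rw [neg_neg]; exact h20) (fun t => by linear_combination hD t)
  have h30 := three_ne hF
  rcases hk with hk | hk <;> rw [hk] at ht <;> rcases ht with ht | ht
  · exact h30 (by linear_combination ht)
  · exact one_ne_zero (α := F) (by linear_combination -ht)
  · exact one_ne_zero (α := F) (by linear_combination -ht)
  · exact h30 (by linear_combination ht)

include hF in
theorem cl_C5b {a b c d e : P × (Tt → F)} (hab : a ≠ b) (hac : a ≠ c) (hbc : b ≠ c)
    (hde : d ≠ e) (hb : a.1 = b.1) (hc : a.1 = c.1) (hd : a.1 = d.1) (he : a.1 = e.1)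
    (r1 : Rep4 T code b c d e) (r2 : Rep4 T code a c d e) (r3 : Rep4 T code a b d e) : False := by
  have hde' : d.1 = e.1 := hd ▸ he
  rcases rep4_eqs (hb ▸ hc) (hb ▸ hd) (hb ▸ he) r1 with ⟨c1, p1⟩ | ⟨ε1, q1, p1⟩ <;>
  rcases rep4_eqs hc hd he r2 with ⟨c2, p2⟩ | ⟨ε2, q2, p2⟩ <;>
  rcases rep4_eqs hb hd he r3 with ⟨c3, p3⟩ | ⟨ε3, q3, p3⟩
  · exact vec_eq hab hb 1 one_ne_zero (fun t => by linear_combination p2 t - p1 t)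
  · exact vec_eq hab hb 1 one_ne_zero (fun t => by linear_combination p2 t - p1 t)
  · exact vec_eq hac hc 1 one_ne_zero (fun t => by linear_combination p3 t - p1 t)
  · exact c5b_one hF hbc hde (hb ▸ hc) hde' c1
      (ε := -ε3) (ε' := -ε2) (c := a) (by rcases q3 with rfl | rfl <;> simp)
      (by rcases q2 with rfl | rfl <;> simp)
      (fun t => by linear_combination - p3 t) (fun t => by linear_combination - p2 t)
  · exact vec_eq hbc (hb ▸ hc) 1 one_ne_zero (fun t => by linear_combination p3 t - p2 t)
  · exact c5b_one hF hac hde hc hde' c2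
      (ε := ε3) (ε' := -ε1) (c := b) q3
      (by rcases q1 with rfl | rfl <;> simp)
      (fun t => p3 t) (fun t => by linear_combination - p1 t)
  · exact c5b_one hF hab hde hb hde' c3 (c := c) q2 q1 p2 p1
  · -- all differences
    have h : ∀ t, (ε3 + ε1 - ε2) * (d.2 t - e.2 t) = 0 := fun t => by
      linear_combination p3 t + p1 t - p2 t
    have h30 := three_ne hF
    refine vec_eq hde hde' _ ?_ h
    rcases q1 with rfl | rfl <;> rcases q2 with rfl | rfl <;> rcases q3 with rfl | rfl <;>
      intro h0
    · exact one_ne_zero (α := F) (by linear_combination h0)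
    · exact one_ne_zero (α := F) (by linear_combination -h0)
    · exact h30 (by linear_combination h0)
    · exact one_ne_zero (α := F) (by linear_combination h0)
    · exact one_ne_zero (α := F) (by linear_combination -h0)
    · exact h30 (by linear_combination -h0)
    · exact one_ne_zero (α := F) (by linear_combination h0)
    · exact one_ne_zero (α := F) (by linear_combination -h0)

/-- Every good coefficient function is seen by a nonzero coordinate. -/
def Nz (T : Tmpl P L) (code : Tt → P → P → F) (x : Tt → F) : Prop :=
  ∀ α, Good T α → ∃ t, code t = α ∧ x t ≠ 0

include hF in
theorem kill_use (hbig : 2000000 < Fintype.card F) (U : Fin 5 → P) (hU : Function.Injective U)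
    (s : Fin 5 → Fin 5 → F) (v : Fin 5) (hs : KillOK s v) (x : Fin 5 → Tt → F)
    (hx : Nz T code (x v))
    (h : ∀ t, ∑ u, ∑ w, s u w * (code t (U u) (U w) * x u t) = 0) : False := by
  obtain ⟨α, hα, h1, h2⟩ := kill_lemma hF hbig T U hU s v hs
  obtain ⟨t, ht, hxt⟩ := hx α hα
  have h3 := h t
  have h4 : ∀ u, ∑ w, s u w * (code t (U u) (U w) * x u t)
      = (∑ w, s u w * α (U u) (U w)) * x u t := by
    intro u
    rw [Finset.sum_mul, ht]
    exact Finset.sum_congr rfl fun w _ => by ring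
  rw [Finset.sum_congr rfl (fun u _ => h4 u), Finset.sum_eq_single v] at h3
  · rcases mul_eq_zero.1 h3 with h5 | h5
    · exact h2 h5
    · exact hxt h5
  · intro u _ hu; rw [h1 u hu, zero_mul]
  · intro hv; exact absurd (Finset.mem_univ _) hv

/-- symmetric indicator of an edge -/
def dl (i j u w : Fin 5) : ℤ := if (u = i ∧ w = j) ∨ (u = j ∧ w = i) then 1 else 0

theorem dl_sum (i j : Fin 5) (hij : i ≠ j) (f : Fin 5 → Fin 5 → F) :
    ∑ u, ∑ w, ((dl i j u w : ℤ) : F) * f u w = f i j + f j i := by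
  have h : ∀ u w, ((dl i j u w : ℤ) : F) * f u w =
      (if u = i then if w = j then f u w else 0 else 0) +
      (if u = j then if w = i then f u w else 0 else 0) := by
    intro u w
    unfold dl
    by_cases h1 : u = i <;> by_cases h2 : w = j <;> by_cases h3 : u = j <;> by_cases h4 : w = i <;>
      simp_all
  simp only [h, Finset.sum_add_distrib]
  simp

end Col

set_option linter.unusedVariables false
set_option linter.unusedSectionVars false

/-! ### The finite check -/

namespace Chk

/-- `List.any`, in a form that the kernel evaluates quickly -/
def _root_.List.anyL {α : Type} (l : List α) (p : α → Bool) : Bool :=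
  List.rec false (fun a _ ih => Bool.rec ih true (p a)) l

/-- `List.all`, in a form that the kernel evaluates quickly -/
def allL {α : Type} (l : List α) (p : α → Bool) : Bool :=
  List.rec true (fun a _ ih => Bool.rec false ih (p a)) l

def v5 : List ℕ := [0, 1, 2, 3, 4]

def ne (a b : ℕ) : Bool := !(Nat.beq a b)

/-- ordered 5-tuples of distinct vertices -/
def perms : List (ℕ × ℕ × ℕ × ℕ × ℕ) :=
  v5.flatMap fun a => (v5.filter (ne a)).flatMap fun b =>
    (v5.filter fun c => ne a c && ne b c).flatMap fun c =>
      (v5.filter fun d => ne a d && (ne b d && ne c d)).flatMap fun d =>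
        (v5.filter fun e => ne a e && (ne b e && (ne c e && ne d e))).map fun e => (a, b, c, d, e)

def tris : List (ℕ × ℕ × ℕ) :=
  v5.flatMap fun a => (v5.filter (ne a)).flatMap fun b =>
    (v5.filter fun c => ne a c && (ne b c && Nat.blt b c)).map fun c => (a, b, c)

def tab : List (List ℕ) :=
  [[10, 0, 1, 2, 3], [0, 10, 4, 5, 6], [1, 4, 10, 7, 8], [2, 5, 7, 10, 9], [3, 6, 8, 9, 10]]

def C0 (a b : ℕ) : ℕ := (tab.getD a []).getD b 0

def Es : List (ℕ × ℕ) :=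
  [(0, 1), (0, 2), (0, 3), (0, 4), (1, 2), (1, 3), (1, 4), (2, 3), (2, 4), (3, 4)]

def E1 (e : ℕ) : ℕ := (Es.getD e (0, 1)).1
def E2 (e : ℕ) : ℕ := (Es.getD e (0, 1)).2

/-- value of the class of an edge, the classes being packed in base 16 -/
def nib (n k : ℕ) : ℕ := Nat.land (Nat.shiftRight n (Nat.mul 4 k)) 15

def getP (n a b : ℕ) : ℕ := nib n (C0 a b)

/-- evaluate the argument first -/
def force {α : Type} (x : ℕ) (f : ℕ → α) : α := Nat.rec (f 0) (fun n _ => f (n + 1)) x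

def pack (f : ℕ → ℕ) : ℕ :=
  f 0 + 16 * (f 1 + 16 * (f 2 + 16 * (f 3 + 16 * (f 4 + 16 * (f 5 + 16 * (f 6 + 16 * (f 7 +
    16 * (f 8 + 16 * f 9))))))))

/-- merge the classes of the edges `e` and `r` -/
def mg (n e r : ℕ) : ℕ :=
  pack fun k => bif Nat.beq (nib n k) (nib n e) then nib n r else nib n k

def cInit : ℕ := pack fun k => k

/-- part pattern -/
def pt (π : List ℕ) (i : ℕ) : ℕ := π.getD i 0

def sp (π : List ℕ) (i j : ℕ) : Bool := Nat.beq (pt π i) (pt π j)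
def dp (π : List ℕ) (i j : ℕ) : Bool := !(sp π i j)

/-- index of the first edge joining the same two parts -/
def lInit (π : List ℕ) : ℕ := pack fun k =>
  ((List.range 10).filter fun m =>
    (sp π (E1 m) (E1 k) && sp π (E2 m) (E2 k)) || (sp π (E1 m) (E2 k) && sp π (E2 m) (E1 k))).headD 0

def eqC (C : ℕ → ℕ → ℕ) (a b c d : ℕ) : Bool := Nat.beq (C a b) (C c d)

def G0 (π : List ℕ) (C : ℕ → ℕ → ℕ) : Bool :=
  (perms.filter fun (a, b, c, d, e) => sp π a b && dp π c d).anyL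
      fun (a, b, c, d, e) => eqC C a b c d
def G0' (π : List ℕ) (C : ℕ → ℕ → ℕ) : Bool :=
  (perms.filter fun (a, b, c, d, e) => sp π a b && dp π a c).anyL
      fun (a, b, c, d, e) => eqC C a b a c
def G1 (π : List ℕ) (C : ℕ → ℕ → ℕ) : Bool :=
  (perms.filter fun (a, b, c, d, e) => sp π b c && (Nat.blt b c && Nat.blt d e)).anyL
      fun (a, b, c, d, e) => eqC C a b a c

/-- violations of the template at a cherry -/
def tvc (π : List ℕ) (B : ℕ → ℕ → ℕ) (b a c : ℕ) : Bool :=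
  eqC B a c a b || (v5.filter fun y => dp π y a && (dp π y b && dp π y c)).anyL fun y =>
    eqC B b y b a || (eqC B a y a b || (eqC B a y a c || (eqC B c y c b || (eqC B c y c a ||
    (eqC B y a y c || (eqC B b y a c && (v5.filter fun w => dp π w b && dp π w y).anyL fun w =>
      eqC B b w a c || (eqC B y w a c || eqC B w b w y)))))))

def t4c (π : List ℕ) (B : ℕ → ℕ → ℕ) (b a c d e : ℕ) : Bool :=
  eqC B b a b c && (eqC B b d b e && eqC B a c d e)

def TV (π : List ℕ) (B : ℕ → ℕ → ℕ) : Bool :=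
  (tris.filter fun (b, a, c) => dp π b a && (dp π b c && dp π a c)).anyL
    fun (b, a, c) => eqC B b a b c && tvc π B b a c

def alld (π : List ℕ) (a b c d e : ℕ) : Bool :=
  dp π a b && (dp π a c && (dp π a d && (dp π a e && (dp π b c && (dp π b d && (dp π b e &&
    (dp π c d && (dp π c e && dp π d e))))))))

def T4 (π : List ℕ) (B : ℕ → ℕ → ℕ) : Bool :=
  (perms.filter fun (b, a, c, d, e) => (Nat.blt a c && (Nat.blt d e && Nat.blt a d)) &&
    alld π b a c d e).anyL fun (b, a, c, d, e) => t4c π B b a c d e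

def C5a (π : List ℕ) (C : ℕ → ℕ → ℕ) : Bool :=
  (perms.filter fun (a, b, c, d, e) => sp π a b && (sp π a c && sp π a d)).anyL
      fun (a, b, c, d, e) => eqC C a b c d && eqC C a c b d

def rep4 (C : ℕ → ℕ → ℕ) (i j k l : ℕ) : Bool :=
  eqC C i j k l || (eqC C i k j l || eqC C i l j k)

def C5b (π : List ℕ) (C : ℕ → ℕ → ℕ) : Bool :=
  (perms.filter fun (a, b, c, d, e) => sp π a b && (sp π a c && (sp π a d && (sp π a e &&
     (Nat.blt a b && (Nat.blt b c && Nat.blt d e)))))).anyL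
      fun (a, b, c, d, e) => rep4 C b c d e && (rep4 C a c d e && rep4 C a b d e)

/-- two parts, two plus two vertices -/
def A2 (π : List ℕ) (C : ℕ → ℕ → ℕ) : Bool :=
  (perms.filter fun (a, b, c, d, e) => sp π a b && (sp π c d && dp π a c)).anyL
      fun (a, b, c, d, e) => eqC C a c b d && (eqC C b c a d || eqC C a b c d)

def A3 (π : List ℕ) (C : ℕ → ℕ → ℕ) : Bool :=
  (perms.filter fun (a, b, c, d, e) => sp π a b && (sp π a c && (sp π d e && dp π a d))).anyL
      fun (a, b, c, d, e) => eqC C a d b e && (eqC C b d c e && (eqC C c d a e || eqC C a c d e))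

def C1 (π : List ℕ) (C : ℕ → ℕ → ℕ) : Bool :=
  (perms.filter fun (a, b, c, d, e) => sp π a b && (dp π a c && (dp π a d && dp π c d))).anyL
      fun (a, b, c, d, e) => (eqC C a c a d && eqC C b c b d) || (eqC C a c b d && eqC C b c a d)

def C3 (π : List ℕ) (C : ℕ → ℕ → ℕ) : Bool :=
  (perms.filter fun (a, b, c, d, e) =>
    sp π a b && (sp π a c && (dp π a d && (dp π a e && dp π d e)))).anyL
      fun (a, b, c, d, e) => eqC C a d b e && (eqC C b d c e && eqC C c d a e)

def TTA (π : List ℕ) (C : ℕ → ℕ → ℕ) : Bool :=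
  (perms.filter fun (a, b, c, d, e) =>
    sp π a b && (sp π c d && (dp π a c && (dp π a e && dp π c e)))).anyL
      fun (a, b, c, d, e) => (eqC C a c b d || (eqC C a d b c || eqC C a b c d)) &&
        (((eqC C a e a c || eqC C a e b c) && (eqC C b e a d || eqC C b e b d)) ||
          (eqC C a e c e && eqC C b e d e))

def X2 (π : List ℕ) (C : ℕ → ℕ → ℕ) : Bool :=
  (perms.filter fun (a, b, c, d, e) => (Nat.blt a b && (Nat.blt a c && Nat.blt a d)) &&
    (dp π a b && (dp π a c && (dp π a d && (dp π b c && (dp π b d && dp π c d)))))).anyL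
      fun (a, b, c, d, e) => eqC C a b c d && eqC C a c b d

def viol (π : List ℕ) (C B : ℕ → ℕ → ℕ) : Bool :=
  G0 π C || (G0' π C || (G1 π C || (TV π B || (T4 π B || (C5a π C || (C5b π C || (A2 π C ||
    (A3 π C || (C1 π C || (C3 π C || (TTA π C || X2 π C)))))))))))

def violN (π : List ℕ) (c b : ℕ) : Bool := viol π (getP c) (getP b)

/-! kill test -/

def ind (k e : ℕ) : ℤ := bif Nat.beq k e then 1 else 0

def wt (e1 r1 e2 r2 e3 r3 k : ℕ) : ℤ :=
  (ind k e1 - ind k r1) + (3 * (ind k e2 - ind k r2) + 9 * (ind k e3 - ind k r3))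

def absW (e1 r1 e2 r2 e3 r3 : ℕ) (u w : ℕ) : ℕ := (wt e1 r1 e2 r2 e3 r3 (C0 u w)).natAbs

def sup (A : ℕ → ℕ → ℕ) (u : ℕ) : List ℕ := v5.filter fun w => ne (A u w) 0

def pairOK (x y : ℕ) : Bool := ne x y && (ne x (2 * y) && ne y (2 * x))

def triOK (A : ℕ → ℕ → ℕ) (v q p r : ℕ) : Bool :=
  Nat.beq r v || (ne (A q p) (A r p) || !(allL (sup A r) fun x => Nat.beq x p || Nat.beq x q))

def rowOK (A : ℕ → ℕ → ℕ) (v u : ℕ) : Bool :=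
  Nat.beq u v || match sup A u with
    | [] => true
    | [_] => false
    | [w, w'] => pairOK (A u w) (A u w') && (triOK A v u w w' && triOK A v u w' w)
    | _ => true

def killB (A : ℕ → ℕ → ℕ) : Bool :=
  List.anyL v5 fun v => !((sup A v).isEmpty) && allL v5 (rowOK A v)

def mgL (π : List ℕ) (b e r : ℕ) : ℕ :=
  bif dp π (E1 e) (E2 e) && dp π (E1 r) (E2 r) then mg b e r else b

def all1 (π : List ℕ) : Bool := alld π 0 1 2 3 4

def lvl3 (π : List ℕ) (e1 r1 e2 r2 : ℕ) (c b : ℕ) (e3 : ℕ) : Bool :=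
  allL (List.range e3) fun r3 => Nat.beq r3 e1 || (Nat.beq r3 e2 ||
    ((all1 π && killB (absW e1 r1 e2 r2 e3 r3)) ||
    force (mg c e3 r3) fun c' => force (mgL π b e3 r3) fun b' => violN π c' b'))

def lvl2 (π : List ℕ) (e1 r1 : ℕ) (c b : ℕ) (e2 : ℕ) : Bool :=
  allL (List.range e2) fun r2 => Nat.beq r2 e1 ||
    force (mg c e2 r2) fun c' => force (mgL π b e2 r2) fun b' => (violN π c' b' ||
      allL (List.range' (e2 + 1) (9 - e2)) (lvl3 π e1 r1 e2 r2 c' b'))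

def lvl1 (π : List ℕ) (e1 : ℕ) : Bool :=
  allL (List.range e1) fun r1 =>
    force (mg cInit e1 r1) fun c' => force (mgL π (lInit π) e1 r1) fun b' => violN π c' b' ||
      allL (List.range' (e1 + 1) (9 - e1)) (lvl2 π e1 r1 c' b')

def check (π : List ℕ) : Bool := allL (List.range 10) (lvl1 π)

end Chk

set_option linter.unusedVariables false
set_option linter.unusedSectionVars false
set_option linter.unusedSimpArgs false

namespace Chk

theorem anyL_iff {α : Type} (l : List α) (p : α → Bool) :
    l.anyL p = true ↔ ∃ a ∈ l, p a = true := by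
  induction l with
  | nil => simp [List.anyL]
  | cons a l ih =>
    have : (a :: l).anyL p = (p a || l.anyL p) := by
      show @Bool.rec (fun _ => Bool) (l.anyL p) true (p a) = _
      cases p a <;> rfl
    rw [this, Bool.or_eq_true, ih]
    simp

theorem allL_iff {α : Type} (l : List α) (p : α → Bool) :
    allL l p = true ↔ ∀ a ∈ l, p a = true := by
  induction l with
  | nil => simp [allL]
  | cons a l ih =>
    have : allL (a :: l) p = (p a && allL l p) := by
      show @Bool.rec (fun _ => Bool) false (allL l p) (p a) = _
      cases p a <;> rfl
    rw [this, Bool.and_eq_true, ih]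
    simp

theorem perms_ok : ∀ t ∈ perms, (t.1 < 5 ∧ t.2.1 < 5 ∧ t.2.2.1 < 5 ∧ t.2.2.2.1 < 5 ∧
    t.2.2.2.2 < 5) ∧ (t.1 ≠ t.2.1 ∧ t.1 ≠ t.2.2.1 ∧ t.1 ≠ t.2.2.2.1 ∧ t.1 ≠ t.2.2.2.2) ∧
    (t.2.1 ≠ t.2.2.1 ∧ t.2.1 ≠ t.2.2.2.1 ∧ t.2.1 ≠ t.2.2.2.2) ∧
    (t.2.2.1 ≠ t.2.2.2.1 ∧ t.2.2.1 ≠ t.2.2.2.2) ∧ t.2.2.2.1 ≠ t.2.2.2.2 := by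
  decide +kernel

theorem tris_ok : ∀ t ∈ tris, (t.1 < 5 ∧ t.2.1 < 5 ∧ t.2.2 < 5) := by
  decide +kernel

theorem v5_ok : ∀ t ∈ v5, t < 5 := by decide

section Sound
variable {P L F Tt : Type} [LinearOrder P] [Field F] [Fintype F] [DecidableEq F] [Nonempty Tt]

/-- the five vertices have part pattern `π` -/
structure Ctx (T : Tmpl P L) (code : Tt → P → P → F) (u : ℕ → P × (Tt → F)) (π : List ℕ) :
    Prop where
  hG : ∀ t, Good T (code t)
  hF : BigChar F
  hbig : 2000000 < Fintype.card F
  hfive : ∃ U : Fin 5 → P, Function.Injective U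
  inj : ∀ i, i < 5 → ∀ j, j < 5 → i ≠ j → u i ≠ u j
  part : ∀ i, i < 5 → ∀ j, j < 5 → ((u i).1 = (u j).1 ↔ sp π i j = true)
  nz : ∀ i, i < 5 → Nz T code (u i).2

def COK (T : Tmpl P L) (code : Tt → P → P → F) (u : ℕ → P × (Tt → F)) (C : ℕ → ℕ → ℕ) : Prop :=
  ∀ a b c d, a < 5 → b < 5 → c < 5 → d < 5 → a ≠ b → c ≠ d → eqC C a b c d = true →
    col T code (u a) (u b) = col T code (u c) (u d)

def LOK (T : Tmpl P L) (u : ℕ → P × (Tt → F)) (π : List ℕ) (B : ℕ → ℕ → ℕ) : Prop :=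
  ∀ a b c d, a < 5 → b < 5 → c < 5 → d < 5 → dp π a b = true → dp π c d = true →
    eqC B a b c d = true → T.χ (u a).1 (u b).1 = T.χ (u c).1 (u d).1

variable {T : Tmpl P L} {code : Tt → P → P → F} {u : ℕ → P × (Tt → F)} {π : List ℕ}
  {C B : ℕ → ℕ → ℕ}

theorem Ctx.s (h : Ctx T code u π) {i j : ℕ} (hi : i < 5) (hj : j < 5) (e : sp π i j = true) :
    (u i).1 = (u j).1 := (h.part i hi j hj).2 e

theorem dp_iff {i j : ℕ} : dp π i j = true ↔ ¬ sp π i j = true := by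
  unfold dp; simp

theorem Ctx.d (h : Ctx T code u π) {i j : ℕ} (hi : i < 5) (hj : j < 5) (e : dp π i j = true) :
    (u i).1 ≠ (u j).1 := fun e' => dp_iff.1 e ((h.part i hi j hj).1 e')

theorem dp_symm {i j : ℕ} (e : dp π i j = true) : dp π j i = true := by
  rw [dp_iff] at *
  intro h; apply e
  unfold sp at *
  have := Nat.eq_of_beq_eq_true h
  rw [this]; exact Nat.beq_refl _

theorem G0_s (h : Ctx T code u π) (hC : COK T code u C) : G0 π C = true → False := by
  intro hv
  simp only [G0, anyL_iff, List.mem_filter, Bool.and_eq_true, Prod.exists] at hv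
  obtain ⟨a, b, c, d, e, ⟨hm, h1, h2⟩, h3⟩ := hv
  obtain ⟨⟨ha, hb, hc, hd, he⟩, ⟨ab, ac, ad, ae⟩, ⟨bc, bd, be⟩, ⟨cd, ce⟩, de⟩ := perms_ok _ hm
  exact col_mixed (h.s ha hb h1) (h.d hc hd h2) (hC a b c d ha hb hc hd ab cd h3)

theorem G0'_s (h : Ctx T code u π) (hC : COK T code u C) : G0' π C = true → False := by
  intro hv
  simp only [G0', anyL_iff, List.mem_filter, Bool.and_eq_true, Prod.exists] at hv
  obtain ⟨a, b, c, d, e, ⟨hm, h1, h2⟩, h3⟩ := hv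
  obtain ⟨⟨ha, hb, hc, hd, he⟩, ⟨ab, ac, ad, ae⟩, ⟨bc, bd, be⟩, ⟨cd, ce⟩, de⟩ := perms_ok _ hm
  exact col_mixed (h.s ha hb h1) (h.d ha hc h2) (hC a b a c ha hb ha hc ab ac h3)

theorem G1_s (h : Ctx T code u π) (hC : COK T code u C) : G1 π C = true → False := by
  intro hv
  simp only [G1, anyL_iff, List.mem_filter, Bool.and_eq_true, Prod.exists] at hv
  obtain ⟨a, b, c, d, e, ⟨hm, h1, h2⟩, h3⟩ := hv
  obtain ⟨⟨ha, hb, hc, hd, he⟩, ⟨ab, ac, ad, ae⟩, ⟨bc, bd, be⟩, ⟨cd, ce⟩, de⟩ := perms_ok _ hm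
  exact cl_G1 h.hG (h.inj b hb c hc bc) (h.s hb hc h1) (hC a b a c ha hb ha hc ab ac h3)

theorem C5a_s (h : Ctx T code u π) (hC : COK T code u C) : C5a π C = true → False := by
  intro hv
  simp only [C5a, anyL_iff, List.mem_filter, Bool.and_eq_true, Prod.exists] at hv
  obtain ⟨a, b, c, d, e, ⟨hm, h1, h2, h2'⟩, h3, h4⟩ := hv
  obtain ⟨⟨ha, hb, hc, hd, he⟩, ⟨ab, ac, ad, ae⟩, ⟨bc, bd, be⟩, ⟨cd, ce⟩, de⟩ := perms_ok _ hm
  exact cl_C5a h.hF (h.inj a ha d hd ad) (h.s ha hb h1) (h.s ha hc h2) (h.s ha hd h2')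
    (hC a b c d ha hb hc hd ab cd h3) (hC a c b d ha hc hb hd ac bd h4)

theorem rep4_s (hC : COK T code u C) {i j k l : ℕ} (hi : i < 5) (hj : j < 5) (hk : k < 5)
    (hl : l < 5) (ij : i ≠ j) (ik : i ≠ k) (il : i ≠ l) (jk : j ≠ k) (jl : j ≠ l) (kl : k ≠ l)
    (h : rep4 C i j k l = true) : Rep4 T code (u i) (u j) (u k) (u l) := by
  simp only [rep4, Bool.or_eq_true] at h
  rcases h with h | h | h
  · exact Or.inl (hC _ _ _ _ hi hj hk hl ij kl h)
  · exact Or.inr (Or.inl (hC _ _ _ _ hi hk hj hl ik jl h))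
  · exact Or.inr (Or.inr (hC _ _ _ _ hi hl hj hk il jk h))

theorem C5b_s (h : Ctx T code u π) (hC : COK T code u C) : C5b π C = true → False := by
  intro hv
  simp only [C5b, anyL_iff, List.mem_filter, Bool.and_eq_true, Prod.exists] at hv
  obtain ⟨a, b, c, d, e, ⟨hm, h1, h2, h3, h4, -⟩, r1, r2, r3⟩ := hv
  obtain ⟨⟨ha, hb, hc, hd, he⟩, ⟨ab, ac, ad, ae⟩, ⟨bc, bd, be⟩, ⟨cd, ce⟩, de⟩ := perms_ok _ hm
  exact cl_C5b h.hF (h.inj a ha b hb ab) (h.inj a ha c hc ac) (h.inj b hb c hc bc)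
    (h.inj d hd e he de) (h.s ha hb h1) (h.s ha hc h2) (h.s ha hd h3) (h.s ha he h4)
    (rep4_s hC hb hc hd he bc bd be cd ce de r1) (rep4_s hC ha hc hd he ac ad ae cd ce de r2)
    (rep4_s hC ha hb hd he ab ad ae bd be de r3)

theorem A2_s (h : Ctx T code u π) (hC : COK T code u C) : A2 π C = true → False := by
  intro hv
  simp only [A2, anyL_iff, List.mem_filter, Bool.and_eq_true, Bool.or_eq_true, Prod.exists] at hv
  obtain ⟨a, b, c, d, e, ⟨hm, h1, h2, h3⟩, r1, r2⟩ := hv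
  obtain ⟨⟨ha, hb, hc, hd, he⟩, ⟨ab, ac, ad, ae⟩, ⟨bc, bd, be⟩, ⟨cd, ce⟩, de⟩ := perms_ok _ hm
  rcases r2 with r2 | r2
  · exact cl_A2 h.hG h.hF (h.inj a ha b hb ab) (h.s ha hb h1) (h.s hc hd h2) (h.d ha hc h3)
      (hC _ _ _ _ ha hc hb hd ac bd r1) (hC _ _ _ _ hb hc ha hd bc ad r2)
  · exact cl_AL h.hG (h.inj a ha b hb ab) (h.s ha hb h1) (h.s hc hd h2) (h.d ha hc h3)
      (hC _ _ _ _ ha hb hc hd ab cd r2) (hC _ _ _ _ ha hc hb hd ac bd r1)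

theorem A3_s (h : Ctx T code u π) (hC : COK T code u C) : A3 π C = true → False := by
  intro hv
  simp only [A3, anyL_iff, List.mem_filter, Bool.and_eq_true, Bool.or_eq_true, Prod.exists] at hv
  obtain ⟨a, b, c, d, e, ⟨hm, h1, h2, h3, h4⟩, r1, r2, r3⟩ := hv
  obtain ⟨⟨ha, hb, hc, hd, he⟩, ⟨ab, ac, ad, ae⟩, ⟨bc, bd, be⟩, ⟨cd, ce⟩, de⟩ := perms_ok _ hm
  exact cl_A3 h.hG h.hF (h.inj a ha c hc ac) (h.inj d hd e he de) (h.s ha hb h1) (h.s ha hc h2)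
    (h.s hd he h3) (h.d ha hd h4) (hC _ _ _ _ ha hd hb he ad be r1)
    (hC _ _ _ _ hb hd hc he bd ce r2)
    (r3.imp (hC _ _ _ _ hc hd ha he cd ae) (hC _ _ _ _ ha hc hd he ac de))

theorem C1_s (h : Ctx T code u π) (hC : COK T code u C) : C1 π C = true → False := by
  intro hv
  simp only [C1, anyL_iff, List.mem_filter, Bool.and_eq_true, Bool.or_eq_true, Prod.exists] at hv
  obtain ⟨a, b, c, d, e, ⟨hm, h1, h2, h3, h4⟩, r⟩ := hv
  obtain ⟨⟨ha, hb, hc, hd, he⟩, ⟨ab, ac, ad, ae⟩, ⟨bc, bd, be⟩, ⟨cd, ce⟩, de⟩ := perms_ok _ hm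
  rcases r with ⟨r1, r2⟩ | ⟨r1, r2⟩
  · exact cl_C1 h.hG (h.inj a ha b hb ab) (h.s ha hb h1) (h.d ha hc h2) (h.d ha hd h3)
      (h.d hc hd h4) (hC _ _ _ _ ha hc ha hd ac ad r1) (hC _ _ _ _ hb hc hb hd bc bd r2)
  · exact cl_C2 h.hG (h.inj a ha b hb ab) (h.s ha hb h1) (h.d ha hc h2) (h.d ha hd h3)
      (h.d hc hd h4) (hC _ _ _ _ ha hc hb hd ac bd r1) (hC _ _ _ _ hb hc ha hd bc ad r2)

theorem C3_s (h : Ctx T code u π) (hC : COK T code u C) : C3 π C = true → False := by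
  intro hv
  simp only [C3, anyL_iff, List.mem_filter, Bool.and_eq_true, Bool.or_eq_true, Prod.exists] at hv
  obtain ⟨a, b, c, d, e, ⟨hm, h1, h2, h3, h4, h5⟩, r1, r2, r3⟩ := hv
  obtain ⟨⟨ha, hb, hc, hd, he⟩, ⟨ab, ac, ad, ae⟩, ⟨bc, bd, be⟩, ⟨cd, ce⟩, de⟩ := perms_ok _ hm
  exact cl_C3 h.hG (h.inj b hb c hc bc) (h.s ha hb h1) (h.s ha hc h2) (h.d ha hd h3)
    (h.d ha he h4) (h.d hd he h5) (hC _ _ _ _ ha hd hb he ad be r1)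
    (hC _ _ _ _ hb hd hc he bd ce r2) (hC _ _ _ _ hc hd ha he cd ae r3)

theorem TTA_s (h : Ctx T code u π) (hC : COK T code u C) : TTA π C = true → False := by
  intro hv
  simp only [TTA, anyL_iff, List.mem_filter, Bool.and_eq_true, Bool.or_eq_true, Prod.exists] at hv
  obtain ⟨a, b, c, d, e, ⟨hm, h1, h2, h3, h4, h5⟩, r3, r⟩ := hv
  obtain ⟨⟨ha, hb, hc, hd, he⟩, ⟨ab, ac, ad, ae⟩, ⟨bc, bd, be⟩, ⟨cd, ce⟩, de⟩ := perms_ok _ hm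
  have r3' : col T code (u a) (u c) = col T code (u b) (u d) ∨
      col T code (u a) (u d) = col T code (u b) (u c) ∨
      col T code (u a) (u b) = col T code (u c) (u d) := by
    rcases r3 with r3 | r3 | r3
    · exact Or.inl (hC _ _ _ _ ha hc hb hd ac bd r3)
    · exact Or.inr (Or.inl (hC _ _ _ _ ha hd hb hc ad bc r3))
    · exact Or.inr (Or.inr (hC _ _ _ _ ha hb hc hd ab cd r3))
  rcases r with ⟨r1, r2⟩ | ⟨r1, r2⟩
  · have : ∃ i, (u i = u a ∨ u i = u b) ∧ col T code (u a) (u e) = col T code (u i) (u c) := by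
      rcases r1 with r1 | r1
      · exact ⟨a, Or.inl rfl, hC _ _ _ _ ha he ha hc ae ac r1⟩
      · exact ⟨b, Or.inr rfl, hC _ _ _ _ ha he hb hc ae bc r1⟩
    obtain ⟨i, hi, hi'⟩ := this
    have : ∃ j, (u j = u a ∨ u j = u b) ∧ col T code (u b) (u e) = col T code (u j) (u d) := by
      rcases r2 with r2 | r2
      · exact ⟨a, Or.inl rfl, hC _ _ _ _ hb he ha hd be ad r2⟩
      · exact ⟨b, Or.inr rfl, hC _ _ _ _ hb he hb hd be bd r2⟩
    obtain ⟨j, hj, hj'⟩ := this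
    exact cl_TTA h.hG (h.inj a ha b hb ab) (h.s ha hb h1) (h.s hc hd h2) (h.d ha hc h3)
      (h.d ha he h4) (h.d hc he h5) hi hj hi' hj' r3'
  · exact cl_R h.hG (h.inj a ha b hb ab) (h.s ha hb h1) (h.s hc hd h2) (h.d ha hc h3)
      (h.d ha he h4) (h.d hc he h5) (hC _ _ _ _ ha he hc he ae ce r1)
      (hC _ _ _ _ hb he hd he be de r2) r3'

theorem T4_s (h : Ctx T code u π) (hB : LOK T u π B) : T4 π B = true → False := by
  intro hv
  simp only [T4, t4c, alld, anyL_iff, List.mem_filter, Bool.and_eq_true, Bool.or_eq_true,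
    Prod.exists] at hv
  obtain ⟨b, a, c, d, e, ⟨hm, -, h1, h2, h3, h4, h5, h6, h7, h8, h9, h10⟩, r1, r2, r3⟩ := hv
  obtain ⟨⟨hb, ha, hc, hd, he⟩, -⟩ := perms_ok _ hm
  simp only at hb ha hc hd he
  refine T.t4 (u b).1 (u a).1 (u c).1 (u d).1 (u e).1 ⟨(h.d hb ha h1).symm, (h.d hb hc h2).symm,
    h.d ha hc h5, hB _ _ _ _ hb ha hb hc h1 h2 r1⟩ ⟨(h.d hb hd h3).symm, (h.d hb he h4).symm,
    h.d hd he h10, hB _ _ _ _ hb hd hb he h3 h4 r2⟩ (h.d ha hd h6) (h.d ha he h7) (h.d hc hd h8)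
    (h.d hc he h9) (hB _ _ _ _ ha hc hd he h5 h10 r3)

theorem TV_s (h : Ctx T code u π) (hB : LOK T u π B) : TV π B = true → False := by
  intro hv
  simp only [TV, tvc, anyL_iff, List.mem_filter, Bool.and_eq_true, Bool.or_eq_true,
    Prod.exists] at hv
  obtain ⟨b, a, c, ⟨hm, h1, h2, h3⟩, r1, r2⟩ := hv
  obtain ⟨hb, ha, hc⟩ := tris_ok _ hm
  simp only at hb ha hc
  have ch : Cherry T.χ (u b).1 (u a).1 (u c).1 := ⟨(h.d hb ha h1).symm, (h.d hb hc h2).symm,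
    h.d ha hc h3, hB _ _ _ _ hb ha hb hc h1 h2 r1⟩
  rcases r2 with r2 | ⟨y, ⟨hy, h4, h5, h6⟩, r2⟩
  · exact T.t1b _ _ _ (u c).1 ch (h.d ha hc h3).symm (h.d hb hc h2).symm
      (hB _ _ _ _ ha hc ha hb h3 (dp_symm h1) r2)
  have hy := v5_ok y hy
  have ya := h.d hy ha h4
  have yb := h.d hy hb h5
  have yc := h.d hy hc h6
  rcases r2 with r2 | r2 | r2 | r2 | r2 | r2 | ⟨r2, w, ⟨hw, h7, h8⟩, r3⟩
  · exact T.t1a _ _ _ _ ch ya yb yc (hB _ _ _ _ hb hy hb ha (dp_symm h5) h1 r2)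
  · exact T.t1b _ _ _ _ ch ya yb (hB _ _ _ _ ha hy ha hb (dp_symm h4) (dp_symm h1) r2)
  · exact T.t2a _ _ _ _ ch ya yc (hB _ _ _ _ ha hy ha hc (dp_symm h4) h3 r2)
  · exact T.t1b _ _ _ _ ch.symm yc yb (hB _ _ _ _ hc hy hc hb (dp_symm h6) (dp_symm h2) r2)
  · exact T.t2a _ _ _ _ ch.symm yc ya (hB _ _ _ _ hc hy hc ha (dp_symm h6) (dp_symm h3) r2)
  · exact T.t3 _ _ _ _ ch yb ya yc (hB _ _ _ _ hy ha hy hc h4 h6 r2)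
  · have hw := v5_ok w hw
    have k := hB _ _ _ _ hb hy ha hc (dp_symm h5) h3 r2
    have wb := h.d hw hb h7
    have wy := h.d hw hy h8
    rcases r3 with r3 | r3 | r3
    · exact T.t2b _ _ _ _ _ ch yb k wb wy (hB _ _ _ _ hb hw ha hc (dp_symm h7) h3 r3)
    · exact T.t2c _ _ _ _ _ ch yb k wb wy (hB _ _ _ _ hy hw ha hc (dp_symm h8) h3 r3)
    · exact T.t2d _ _ _ _ _ ch yb k wb wy (hB _ _ _ _ hw hb hw hy h7 h8 r3)

end Sound
end Chk

set_option linter.unusedVariables false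
set_option linter.unusedSectionVars false
set_option linter.unusedSimpArgs false

namespace Chk

theorem ne_iff {a b : ℕ} : ne a b = true ↔ a ≠ b := by
  unfold ne
  rw [Bool.not_eq_true', ← Bool.not_eq_true, Nat.beq_eq]

theorem mem_v5 {i : ℕ} : i ∈ v5 ↔ i < 5 := by
  simp only [v5, List.mem_cons, List.not_mem_nil, or_false]; omega

theorem mem_sup {A : ℕ → ℕ → ℕ} {u w : ℕ} : w ∈ sup A u ↔ w < 5 ∧ A u w ≠ 0 := by
  simp only [sup, List.mem_filter, mem_v5, ne_iff]

theorem sup_nodup {A : ℕ → ℕ → ℕ} {u : ℕ} : (sup A u).Nodup := by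
  unfold sup
  exact List.Nodup.filter _ (by decide)

theorem pairOK_iff {x y : ℕ} : pairOK x y = true ↔ x ≠ y ∧ x ≠ 2 * y ∧ y ≠ 2 * x := by
  simp only [pairOK, Bool.and_eq_true, ne_iff]

theorem pairOK_symm {x y : ℕ} (h : pairOK x y = true) : pairOK y x = true := by
  rw [pairOK_iff] at *; omega

theorem triOK_s {A : ℕ → ℕ → ℕ} {v q p r : ℕ} (h : triOK A v q p r = true) (hr : r ≠ v)
    (hs : ∀ x, x < 5 → A r x ≠ 0 → x = p ∨ x = q) : A q p ≠ A r p := by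
  simp only [triOK, Bool.or_eq_true, Nat.beq_eq, ne_iff, Bool.not_eq_true', ← Bool.not_eq_true,
    allL_iff, mem_sup] at h
  rcases h with h | h | h
  · exact absurd h hr
  · exact h
  · exact absurd (fun x hx => hs x hx.1 hx.2) h

theorem rowOK_one {A : ℕ → ℕ → ℕ} {v u : ℕ} (h : rowOK A v u = true) (hu : u ≠ v) {w : ℕ}
    (hw : w < 5) (hA : A u w ≠ 0) : ∃ w', w' < 5 ∧ w' ≠ w ∧ A u w' ≠ 0 := by
  have hw' : w ∈ sup A u := mem_sup.2 ⟨hw, hA⟩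
  have hn := sup_nodup (A := A) (u := u)
  have hm := fun x => mem_sup (A := A) (u := u) (w := x)
  unfold rowOK at h
  rw [Bool.or_eq_true, Nat.beq_eq] at h
  replace h := h.resolve_left hu
  generalize sup A u = l at *
  match l, h, hw', hn, hm with
  | [], h, hw', hn, hm => simp at hw'
  | [_], h, hw', hn, hm => simp at h
  | a :: b :: l, h, hw', hn, hm =>
    by_cases hab : a = w
    · have := (hm b).1 (by simp)
      refine ⟨b, this.1, ?_, this.2⟩
      rintro rfl
      simp [hab] at hn
    · have := (hm a).1 (by simp)
      exact ⟨a, this.1, hab, this.2⟩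

theorem rowOK_two {A : ℕ → ℕ → ℕ} {v u : ℕ} (h : rowOK A v u = true) (hu : u ≠ v) {w w' : ℕ}
    (hw : w < 5) (hA : A u w ≠ 0) (hw' : w' < 5) (hA' : A u w' ≠ 0) (hww : w ≠ w')
    (hx : ∀ x, x < 5 → A u x ≠ 0 → x = w ∨ x = w') :
    pairOK (A u w) (A u w') = true ∧ triOK A v u w w' = true := by
  have h1 : w ∈ sup A u := mem_sup.2 ⟨hw, hA⟩
  have h2 : w' ∈ sup A u := mem_sup.2 ⟨hw', hA'⟩
  have hn := sup_nodup (A := A) (u := u)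
  have hm : ∀ x ∈ sup A u, x = w ∨ x = w' := fun x hh => hx x (mem_sup.1 hh).1 (mem_sup.1 hh).2
  unfold rowOK at h
  rw [Bool.or_eq_true, Nat.beq_eq] at h
  replace h := h.resolve_left hu
  generalize sup A u = l at *
  match l, h, h1, h2, hn, hm with
  | [], h, h1, h2, hn, hm => simp at h1
  | [_], h, h1, h2, hn, hm => simp at h
  | [a, b], h, h1, h2, hn, hm =>
    simp only [Bool.and_eq_true] at h
    have ha := hm a (by simp)
    have hb := hm b (by simp)
    have hab : a ≠ b := by intro e; simp [e] at hn
    rcases ha with rfl | rfl <;> rcases hb with rfl | rfl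
    · exact absurd rfl hab
    · exact ⟨h.1, h.2.1⟩
    · exact ⟨pairOK_symm h.1, h.2.2⟩
    · exact absurd rfl hab
  | a :: b :: c :: l, h, h1, h2, hn, hm =>
    have ha := hm a (by simp)
    have hb := hm b (by simp)
    have hc := hm c (by simp)
    simp only [List.nodup_cons, List.mem_cons, not_or] at hn
    omega

section
variable {F : Type} [Field F]

theorem cast_nz (hF : BigChar F) {z : ℤ} (h : |z| < 5000) : (z : F) ≠ 0 ↔ z ≠ 0 :=
  ⟨fun h1 h2 => h1 (by rw [h2]; simp), fun h1 => hF z h1 h⟩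

theorem killOK_of (hF : BigChar F) (W : ℕ → ℕ → ℤ) (hb : ∀ u w, |W u w| ≤ 13)
    (hsym : ∀ u w, u < 5 → w < 5 → W u w = W w u) (hd : ∀ u, u < 5 → W u u = 0)
    (hk : killB (fun u w => (W u w).natAbs) = true) :
    ∃ v : Fin 5, KillOK (fun u w : Fin 5 => ((W u w : ℤ) : F)) v := by
  simp only [killB, anyL_iff, Bool.and_eq_true, allL_iff, mem_v5] at hk
  obtain ⟨v, hv, hne, hrow⟩ := hk
  set A : ℕ → ℕ → ℕ := fun u w => (W u w).natAbs with hA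
  have hAz : ∀ u w, A u w ≠ 0 ↔ W u w ≠ 0 := fun u w => by simp [hA]
  have hnz : ∀ u w : ℕ, ((W u w : ℤ) : F) ≠ 0 ↔ W u w ≠ 0 := fun u w =>
    cast_nz hF (by have := hb u w; omega)
  have key : ∀ a b : ℤ, |a| ≤ 13 → |b| ≤ 13 → a ≠ 0 → b ≠ 0 →
      pairOK a.natAbs b.natAbs = true → (a : F) + b ≠ 0 ∧ (a : F) - b ≠ 0 ∧ (a : F) + 2 * b ≠ 0 ∧
      (a : F) - 2 * b ≠ 0 ∧ (a : F) ^ 2 - a * b + (b : F) ^ 2 ≠ 0 := by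
    intro a b ha hb' ha0 hb0 hp
    rw [pairOK_iff] at hp
    rw [abs_le] at ha hb'
    refine ⟨?_, ?_, ?_, ?_, ?_⟩
    · exact_mod_cast (cast_nz (F := F) hF (z := a + b) (by rw [abs_lt]; omega)).2 (by omega)
    · exact_mod_cast (cast_nz (F := F) hF (z := a - b) (by rw [abs_lt]; omega)).2 (by omega)
    · exact_mod_cast (cast_nz (F := F) hF (z := a + 2 * b) (by rw [abs_lt]; omega)).2 (by omega)
    · exact_mod_cast (cast_nz (F := F) hF (z := a - 2 * b) (by rw [abs_lt]; omega)).2 (by omega)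
    · have hpos : 0 < a ^ 2 - a * b + b ^ 2 := by
        have : 0 < a ^ 2 := by positivity
        nlinarith [sq_nonneg (a - 2 * b)]
      have hle : a ^ 2 - a * b + b ^ 2 < 5000 := by nlinarith
      have hz := (cast_nz (F := F) hF (z := (a ^ 2 - a * b + b ^ 2 : ℤ))
        (by rw [abs_lt]; constructor <;> linarith)).2 (ne_of_gt hpos)
      push_cast at hz
      exact hz
  refine ⟨⟨v, hv⟩, ?_, ?_, ?_, ?_, ?_, ?_⟩
  · intro u w; rw [hsym u w u.2 w.2]
  · intro u; rw [hd u u.2]; simp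
  · simp only [hnz]
    have : ∃ x, x ∈ sup A v := by
      rcases hh : sup A v with _ | ⟨x, l⟩
      · simp [hh] at hne
      · exact ⟨x, by simp⟩
    obtain ⟨x, hx⟩ := this
    rw [mem_sup] at hx
    exact ⟨⟨x, hx.1⟩, (hAz _ _).1 hx.2⟩
  · simp only [hnz]
    intro u hu w hw
    obtain ⟨w', h1, h2, h3⟩ := rowOK_one (hrow u u.2) (fun e => hu (Fin.ext e)) w.2 ((hAz _ _).2 hw)
    exact ⟨⟨w', h1⟩, fun e => h2 (by rw [← e]), (hAz _ _).1 h3⟩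
  · simp only [hnz]
    intro u hu w w' hww hw hw' hx
    have := rowOK_two (hrow u u.2) (fun e => hu (Fin.ext e)) w.2 ((hAz _ _).2 hw) w'.2
      ((hAz _ _).2 hw') (fun e => hww (Fin.ext e)) (fun x hx1 hx2 =>
        (hx ⟨x, hx1⟩ ((hAz _ _).1 hx2)).imp (fun e => by rw [← e]) (fun e => by rw [← e]))
    exact key _ _ (hb _ _) (hb _ _) hw hw' this.1
  · simp only [hnz]
    intro p q r hpq hpr hqr hqv hrv h1 h2 h3 hq hr
    have h := rowOK_two (hrow q q.2) (fun e => hqv (Fin.ext e)) p.2 ((hAz _ _).2 h1) r.2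
      ((hAz _ _).2 h2) (fun e => hpr (Fin.ext e)) (fun x hx1 hx2 =>
        (hq ⟨x, hx1⟩ ((hAz _ _).1 hx2)).imp (fun e => by rw [← e]) (fun e => by rw [← e]))
    have h' := triOK_s h.2 (fun e => hrv (Fin.ext e)) (fun x hx1 hx2 =>
        (hr ⟨x, hx1⟩ ((hAz _ _).1 hx2)).imp (fun e => by rw [← e]) (fun e => by rw [← e]))
    have b1 := hb q p
    have b2 := hb r p
    rw [abs_le] at b1 b2
    simp only [hA] at h'
    refine ⟨?_, ?_⟩
    · exact_mod_cast (cast_nz (F := F) hF (z := W q p + W r p) (by rw [abs_lt]; omega)).2 (by omega)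
    · exact_mod_cast (cast_nz (F := F) hF (z := W q p - W r p) (by rw [abs_lt]; omega)).2 (by omega)

theorem ind_cases (k e : ℕ) : ind k e = 0 ∨ ind k e = 1 := by
  unfold ind; cases Nat.beq k e <;> simp

theorem ind_eq (k e : ℕ) : ind k e = if k = e then 1 else 0 := by
  unfold ind
  by_cases h : k = e
  · subst h; simp
  · rw [if_neg h]
    have : Nat.beq k e = false := by rw [← Bool.not_eq_true, Nat.beq_eq]; exact h
    rw [this]; rfl

theorem wt_bd (e1 r1 e2 r2 e3 r3 k : ℕ) : |wt e1 r1 e2 r2 e3 r3 k| ≤ 13 := by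
  unfold wt
  rw [abs_le]
  have h1 := ind_cases k e1
  have h2 := ind_cases k r1
  have h3 := ind_cases k e2
  have h4 := ind_cases k r2
  have h5 := ind_cases k e3
  have h6 := ind_cases k r3
  omega

theorem sum_C0 (w : ℕ → F) (h10 : w 10 = 0) (f : ℕ → ℕ → F) :
    ∑ u : Fin 5, ∑ x : Fin 5, w (C0 u x) * f u x =
      ∑ k ∈ Finset.range 10, w k * (f (E1 k) (E2 k) + f (E2 k) (E1 k)) := by
  simp only [Fin.sum_univ_five, Finset.sum_range_succ, Finset.sum_range_zero, C0, tab, E1, E2, Es]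
  simp [h10]
  ring

theorem ind_sum (e : ℕ) (he : e < 10) (g : ℕ → F) :
    ∑ k ∈ Finset.range 10, ((ind k e : ℤ) : F) * g k = g e := by
  rw [Finset.sum_eq_single e]
  · rw [ind_eq, if_pos rfl]; simp
  · intro b _ hb; rw [ind_eq, if_neg hb]; simp
  · intro h; simp at h; omega

end

section Sound
variable {P L F Tt : Type} [LinearOrder P] [Field F] [Fintype F] [DecidableEq F] [Nonempty Tt]
variable {T : Tmpl P L} {code : Tt → P → P → F}

def ev (code : Tt → P → P → F) (u : ℕ → P × (Tt → F)) (t : Tt) (a b : ℕ) : F :=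
  code t (u a).1 (u b).1 * (u a).2 t + code t (u b).1 (u a).1 * (u b).2 t

theorem kill_sound (hF : BigChar F) (hbig : 2000000 < Fintype.card F) (u : ℕ → P × (Tt → F))
    (hU : ∀ i, i < 5 → ∀ j, j < 5 → i ≠ j → (u i).1 ≠ (u j).1)
    (hx : ∀ i, i < 5 → Nz T code (u i).2) (e1 r1 e2 r2 e3 r3 : ℕ) (he1 : e1 < 10) (hr1 : r1 < 10)
    (he2 : e2 < 10) (hr2 : r2 < 10) (he3 : e3 < 10) (hr3 : r3 < 10)
    (h1 : ∀ t, ev code u t (E1 e1) (E2 e1) = ev code u t (E1 r1) (E2 r1))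
    (h2 : ∀ t, ev code u t (E1 e2) (E2 e2) = ev code u t (E1 r2) (E2 r2))
    (h3 : ∀ t, ev code u t (E1 e3) (E2 e3) = ev code u t (E1 r3) (E2 r3))
    (hk : killB (absW e1 r1 e2 r2 e3 r3) = true) : False := by
  have h10 : wt e1 r1 e2 r2 e3 r3 10 = 0 := by
    unfold wt
    simp only [ind_eq]
    rw [if_neg (by omega), if_neg (by omega), if_neg (by omega), if_neg (by omega),
      if_neg (by omega), if_neg (by omega)]
    rfl
  obtain ⟨v, hv⟩ := killOK_of hF (fun u w => wt e1 r1 e2 r2 e3 r3 (C0 u w))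
    (fun u w => wt_bd _ _ _ _ _ _ _)
    (fun u w hu hw => by
      have : C0 u w = C0 w u := by interval_cases u <;> interval_cases w <;> rfl
      simp only [this])
    (fun u hu => by
      have : C0 u u = 10 := by interval_cases u <;> rfl
      simp only [this, h10]) hk
  refine kill_use (T := T) (code := code) hF hbig (fun i => (u i).1) ?_ _ v hv (fun i => (u i).2)
    (hx v v.2) ?_
  · intro i j hij
    by_contra hc
    exact hU i i.2 j j.2 (fun e => hc (Fin.ext e)) hij
  · intro t
    have := sum_C0 (F := F) (fun k => ((wt e1 r1 e2 r2 e3 r3 k : ℤ) : F)) (by simp [h10])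
      (fun a b => code t (u a).1 (u b).1 * (u a).2 t)
    rw [this]
    have h4 : ∀ k, ((wt e1 r1 e2 r2 e3 r3 k : ℤ) : F) *
      (code t (u (E1 k)).1 (u (E2 k)).1 * (u (E1 k)).2 t +
        code t (u (E2 k)).1 (u (E1 k)).1 * (u (E2 k)).2 t) =
      ((ind k e1 : ℤ) : F) * ev code u t (E1 k) (E2 k)
      - ((ind k r1 : ℤ) : F) * ev code u t (E1 k) (E2 k)
      + 3 * (((ind k e2 : ℤ) : F) * ev code u t (E1 k) (E2 k)
      - ((ind k r2 : ℤ) : F) * ev code u t (E1 k) (E2 k))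
      + 9 * (((ind k e3 : ℤ) : F) * ev code u t (E1 k) (E2 k)
      - ((ind k r3 : ℤ) : F) * ev code u t (E1 k) (E2 k)) := by
      intro k
      unfold wt ev
      push_cast
      ring
    rw [Finset.sum_congr rfl (fun k _ => h4 k)]
    simp only [Finset.sum_add_distrib, Finset.sum_sub_distrib, ← Finset.mul_sum]
    rw [ind_sum e1 he1 (fun k => ev code u t (E1 k) (E2 k)),
      ind_sum r1 hr1 (fun k => ev code u t (E1 k) (E2 k)),
      ind_sum e2 he2 (fun k => ev code u t (E1 k) (E2 k)),
      ind_sum r2 hr2 (fun k => ev code u t (E1 k) (E2 k)),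
      ind_sum e3 he3 (fun k => ev code u t (E1 k) (E2 k)),
      ind_sum r3 hr3 (fun k => ev code u t (E1 k) (E2 k)), h1, h2, h3]
    ring

variable {u : ℕ → P × (Tt → F)} {π : List ℕ} {C B : ℕ → ℕ → ℕ}

theorem X2_s (h : Ctx T code u π) (hC : COK T code u C) : X2 π C = true → False := by
  intro hv
  simp only [X2, anyL_iff, List.mem_filter, Bool.and_eq_true, Bool.or_eq_true, Prod.exists] at hv
  obtain ⟨a, b, c, d, e, ⟨hm, -, h1, h2, h3, h4, h5, h6⟩, r1, r2⟩ := hv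
  obtain ⟨⟨ha, hb, hc, hd, he⟩, ⟨ab, ac, ad, ae⟩, ⟨bc, bd, be⟩, ⟨cd, ce⟩, de⟩ := perms_ok _ hm
  simp only at ha hb hc hd he ab ac ad ae bc bd be cd ce de
  have d1 := h.d ha hb h1
  have d2 := h.d ha hc h2
  have d3 := h.d ha hd h3
  have d4 := h.d hb hc h4
  have d5 := h.d hb hd h5
  have d6 := h.d hc hd h6
  obtain ⟨U, hU⟩ := h.hfive
  have : ∃ p : P, p ≠ (u a).1 ∧ p ≠ (u b).1 ∧ p ≠ (u c).1 ∧ p ≠ (u d).1 := by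
    by_contra hcon
    push Not at hcon
    have hsub : (Finset.univ.image U) ⊆ {(u a).1, (u b).1, (u c).1, (u d).1} := by
      intro p hp
      simp only [Finset.mem_insert, Finset.mem_singleton]
      by_contra hc'
      push Not at hc'
      exact hc'.2.2.2 (hcon p hc'.1 hc'.2.1 hc'.2.2.1)
    have := Finset.card_le_card hsub
    rw [Finset.card_image_of_injective _ hU] at this
    simp only [Finset.card_univ, Fintype.card_fin] at this
    have := this.trans Finset.card_le_four
    omega
  obtain ⟨p, p1, p2, p3, p4⟩ := this
  have b1 := (col_bulk d1 d6 (hC _ _ _ _ ha hb hc hd ab cd r1)).2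
  have b2 := (col_bulk d2 d5 (hC _ _ _ _ ha hc hb hd ac bd r2)).2
  refine kill_sound (T := T) (code := code) h.hF h.hbig
    (fun i => if i = 0 then u a else if i = 1 then u b else if i = 2 then u c else
      if i = 3 then u d else (p, (u a).2)) ?_ ?_ 0 7 1 5 0 0 (by norm_num) (by norm_num)
    (by norm_num) (by norm_num) (by norm_num) (by norm_num) ?_ ?_ (fun t => rfl) (by decide +kernel)
  · intro i hi j hj hij
    interval_cases i <;> interval_cases j <;> first
      | exact absurd rfl hij
      | (simp; first | assumption | (intro e; first | exact p1 e.symm | exact p2 e.symm | exact p3 e.symm | exact p4 e.symm | exact d1 e.symm | exact d2 e.symm | exact d3 e.symm | exact d4 e.symm | exact d5 e.symm | exact d6 e.symm))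
  · intro i hi
    interval_cases i
    · exact h.nz a ha
    · exact h.nz b hb
    · exact h.nz c hc
    · exact h.nz d hd
    · exact h.nz a ha
  · intro t; simpa [ev, E1, E2, Es] using b1 t
  · intro t; simpa [ev, E1, E2, Es] using b2 t

theorem viol_s (h : Ctx T code u π) (hC : COK T code u C) (hB : LOK T u π B) :
    viol π C B = true → False := by
  intro hv
  simp only [viol, Bool.or_eq_true] at hv
  rcases hv with hv | hv | hv | hv | hv | hv | hv | hv | hv | hv | hv | hv | hv
  · exact G0_s h hC hv
  · exact G0'_s h hC hv
  · exact G1_s h hC hv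
  · exact TV_s h hB hv
  · exact T4_s h hB hv
  · exact C5a_s h hC hv
  · exact C5b_s h hC hv
  · exact A2_s h hC hv
  · exact A3_s h hC hv
  · exact C1_s h hC hv
  · exact C3_s h hC hv
  · exact TTA_s h hC hv
  · exact X2_s h hC hv

end Sound
end Chk

set_option linter.unusedVariables false
set_option linter.unusedSectionVars false
set_option linter.unusedSimpArgs false

namespace Chk

theorem nib_eq (n k : ℕ) : nib n k = n / 16 ^ k % 16 := by
  unfold nib
  show (n >>> (4 * k)) &&& 15 = _
  rw [Nat.shiftRight_eq_div_pow, show (15 : ℕ) = 2 ^ 4 - 1 by norm_num,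
    Nat.and_two_pow_sub_one_eq_mod, pow_mul]
  norm_num

theorem nib_lt (n k : ℕ) : nib n k < 16 := by rw [nib_eq]; omega

theorem nib_pack (f : ℕ → ℕ) (hf : ∀ k, f k < 16) (k : ℕ) (hk : k < 10) :
    nib (pack f) k = f k := by
  rw [nib_eq]
  unfold pack
  have h0 := hf 0
  have h1 := hf 1
  have h2 := hf 2
  have h3 := hf 3
  have h4 := hf 4
  have h5 := hf 5
  have h6 := hf 6
  have h7 := hf 7
  have h8 := hf 8
  have h9 := hf 9
  interval_cases k <;> norm_num <;> omega

theorem force_eq {α : Type} (x : ℕ) (f : ℕ → α) : force x f = f x := by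
  cases x <;> rfl

/-- classes of the partition coded by `n` are finer than the fibres of `g` on `S` -/
def EOK {α : Type} (S : ℕ → Prop) (g : ℕ → α) (n : ℕ) : Prop :=
  ∀ k m, k < 10 → m < 10 → S k → S m → nib n k = nib n m → g k = g m

theorem nib_mg (n e r k : ℕ) (hk : k < 10) :
    nib (mg n e r) k = if nib n k = nib n e then nib n r else nib n k := by
  unfold mg
  rw [nib_pack _ _ k hk]
  · by_cases h : nib n k = nib n e
    · rw [if_pos h, h, Nat.beq_refl]; rfl
    · have : Nat.beq (nib n k) (nib n e) = false := by
        rw [← Bool.not_eq_true, Nat.beq_eq]; exact h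
      rw [if_neg h, this]; rfl
  · intro k
    cases Nat.beq (nib n k) (nib n e)
    · exact nib_lt _ _
    · exact nib_lt _ _

theorem EOK.mg {α : Type} {S : ℕ → Prop} {g : ℕ → α} {n e r : ℕ} (h : EOK S g n) (he : e < 10)
    (hr : r < 10) (he' : S e) (hr' : S r) (hg : g e = g r) : EOK S g (mg n e r) := by
  intro k m hk hm hk' hm' hkm
  rw [nib_mg _ _ _ _ hk, nib_mg _ _ _ _ hm] at hkm
  split_ifs at hkm with h1 h2 h2
  · rw [h k e hk he hk' he' h1, h m e hm he hm' he' h2]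
  · rw [h k e hk he hk' he' h1, hg, h r m hr hm hr' hm' hkm]
  · rw [h m e hm he hm' he' h2, hg, h k r hk hr hk' hr' hkm]
  · exact h k m hk hm hk' hm' hkm

theorem EOK_init {α : Type} {S : ℕ → Prop} {g : ℕ → α} : EOK S g cInit := by
  intro k m hk hm _ _ h
  have : ∀ k, k < 10 → nib cInit k = k := by decide +kernel
  rw [this k hk, this m hm] at h
  rw [h]

theorem E_lt (k : ℕ) (hk : k < 10) : E1 k < 5 ∧ E2 k < 5 ∧ E1 k ≠ E2 k := by
  interval_cases k <;> decide

theorem C0_spec (a b : ℕ) (ha : a < 5) (hb : b < 5) (hab : a ≠ b) : C0 a b < 10 ∧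
    ((E1 (C0 a b) = a ∧ E2 (C0 a b) = b) ∨ (E1 (C0 a b) = b ∧ E2 (C0 a b) = a)) := by
  interval_cases a <;> interval_cases b <;> first | exact absurd rfl hab | decide

theorem lInit_spec (π : List ℕ) (k : ℕ) (hk : k < 10) : ∃ m, m < 10 ∧ nib (lInit π) k = m ∧
    ((sp π (E1 m) (E1 k) = true ∧ sp π (E2 m) (E2 k) = true) ∨
      (sp π (E1 m) (E2 k) = true ∧ sp π (E2 m) (E1 k) = true)) := by
  have key : ∀ k, k < 10 → ∃ m, m < 10 ∧ ((List.range 10).filter fun m =>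
    (sp π (E1 m) (E1 k) && sp π (E2 m) (E2 k)) ||
      (sp π (E1 m) (E2 k) && sp π (E2 m) (E1 k))).headD 0 = m ∧
    ((sp π (E1 m) (E1 k) = true ∧ sp π (E2 m) (E2 k) = true) ∨
      (sp π (E1 m) (E2 k) = true ∧ sp π (E2 m) (E1 k) = true)) := by
    intro k hk
    have hmem : k ∈ ((List.range 10).filter fun m =>
        (sp π (E1 m) (E1 k) && sp π (E2 m) (E2 k)) ||
        (sp π (E1 m) (E2 k) && sp π (E2 m) (E1 k))) := by
      rw [List.mem_filter]
      refine ⟨List.mem_range.2 hk, ?_⟩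
      have : ∀ i, sp π i i = true := fun i => Nat.beq_refl _
      simp [this]
    rcases hl : ((List.range 10).filter fun m =>
        (sp π (E1 m) (E1 k) && sp π (E2 m) (E2 k)) ||
        (sp π (E1 m) (E2 k) && sp π (E2 m) (E1 k))) with _ | ⟨m, l⟩
    · rw [hl] at hmem; simp at hmem
    · have hm : m ∈ ((List.range 10).filter fun m =>
        (sp π (E1 m) (E1 k) && sp π (E2 m) (E2 k)) ||
        (sp π (E1 m) (E2 k) && sp π (E2 m) (E1 k))) := by rw [hl]; simp
      rw [List.mem_filter] at hm
      refine ⟨m, List.mem_range.1 hm.1, rfl, ?_⟩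
      simpa only [Bool.or_eq_true, Bool.and_eq_true] using hm.2
  obtain ⟨m, h1, h2, h3⟩ := key k hk
  refine ⟨m, h1, ?_, h3⟩
  unfold lInit
  rw [nib_pack _ _ k hk]
  · exact h2
  · intro k'
    rcases hl : ((List.range 10).filter fun m =>
        (sp π (E1 m) (E1 k') && sp π (E2 m) (E2 k')) ||
        (sp π (E1 m) (E2 k') && sp π (E2 m) (E1 k'))) with _ | ⟨m, l⟩
    · simp
    · have hm : m ∈ ((List.range 10).filter fun m =>
        (sp π (E1 m) (E1 k') && sp π (E2 m) (E2 k')) ||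
        (sp π (E1 m) (E2 k') && sp π (E2 m) (E1 k'))) := by rw [hl]; simp
      rw [List.mem_filter] at hm
      have := List.mem_range.1 hm.1
      show m < 16
      omega

section Sound
variable {P L F Tt : Type} [LinearOrder P] [Field F] [Fintype F] [DecidableEq F] [Nonempty Tt]
variable {T : Tmpl P L} {code : Tt → P → P → F}
variable {u : ℕ → P × (Tt → F)} {π : List ℕ} {c b : ℕ}

noncomputable def ecol (T : Tmpl P L) (code : Tt → P → P → F) (u : ℕ → P × (Tt → F)) (k : ℕ) : Colr L F Tt :=
  col T code (u (E1 k)) (u (E2 k))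

def chiE (T : Tmpl P L) (u : ℕ → P × (Tt → F)) (k : ℕ) : L := T.χ (u (E1 k)).1 (u (E2 k)).1

def blk (π : List ℕ) (k : ℕ) : Prop := dp π (E1 k) (E2 k) = true

theorem col_ecol {a b : ℕ} (ha : a < 5) (hb : b < 5) (hab : a ≠ b) :
    col T code (u a) (u b) = ecol T code u (C0 a b) := by
  unfold ecol
  rcases (C0_spec a b ha hb hab).2 with ⟨h1, h2⟩ | ⟨h1, h2⟩
  · rw [h1, h2]
  · rw [h1, h2, col_symm]

theorem COK_of (h : EOK (fun _ => True) (ecol T code u) c) : COK T code u (getP c) := by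
  intro a b c d ha hb hc hd hab hcd he
  rw [col_ecol ha hb hab, col_ecol hc hd hcd]
  exact h _ _ (C0_spec a b ha hb hab).1 (C0_spec c d hc hd hcd).1 trivial trivial
    (Nat.eq_of_beq_eq_true he)

theorem dp_ne {i j : ℕ} (h : dp π i j = true) : i ≠ j := by
  rintro rfl
  rw [dp_iff] at h
  exact h (Nat.beq_refl _)

theorem LOK_of (h : EOK (blk π) (chiE T u) b) : LOK T u π (getP b) := by
  intro a b c d ha hb hc hd hab hcd he
  have key : ∀ a b, a < 5 → b < 5 → dp π a b = true → blk π (C0 a b) ∧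
      T.χ (u a).1 (u b).1 = chiE T u (C0 a b) := by
    intro a b ha hb hab
    unfold blk chiE
    rcases (C0_spec a b ha hb (dp_ne hab)).2 with ⟨h1, h2⟩ | ⟨h1, h2⟩
    · rw [h1, h2]; exact ⟨hab, rfl⟩
    · rw [h1, h2]; exact ⟨dp_symm hab, T.symm _ _⟩
  obtain ⟨h1, h2⟩ := key a b ha hb hab
  obtain ⟨h3, h4⟩ := key c d hc hd hcd
  rw [h2, h4]
  exact h _ _ (C0_spec a b ha hb (dp_ne hab)).1 (C0_spec c d hc hd (dp_ne hcd)).1 h1 h3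
    (Nat.eq_of_beq_eq_true he)

theorem LOK_init (h : Ctx T code u π) : EOK (blk π) (chiE T u) (lInit π) := by
  intro k m hk hm _ _ hkm
  obtain ⟨x, hx, h1, h2⟩ := lInit_spec π k hk
  obtain ⟨y, hy, h3, h4⟩ := lInit_spec π m hm
  have hxy : x = y := by rw [← h1, ← h3, hkm]
  subst hxy
  obtain ⟨x1, x2, -⟩ := E_lt x hx
  obtain ⟨k1, k2, -⟩ := E_lt k hk
  obtain ⟨m1, m2, -⟩ := E_lt m hm
  have e1 : chiE T u x = chiE T u k := by
    unfold chiE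
    rcases h2 with ⟨p, q⟩ | ⟨p, q⟩
    · rw [h.s x1 k1 p, h.s x2 k2 q]
    · rw [h.s x1 k2 p, h.s x2 k1 q, T.symm]
  have e2 : chiE T u x = chiE T u m := by
    unfold chiE
    rcases h4 with ⟨p, q⟩ | ⟨p, q⟩
    · rw [h.s x1 m1 p, h.s x2 m2 q]
    · rw [h.s x1 m2 p, h.s x2 m1 q, T.symm]
  rw [← e1, e2]

theorem mgL_OK (h : Ctx T code u π) {e r : ℕ} (he : e < 10) (hr : r < 10)
    (hg : ecol T code u e = ecol T code u r) (hb : EOK (blk π) (chiE T u) b) :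
    EOK (blk π) (chiE T u) (mgL π b e r) := by
  unfold mgL
  rcases hh : (dp π (E1 e) (E2 e) && dp π (E1 r) (E2 r)) with _ | _
  · exact hb
  · rw [Bool.and_eq_true] at hh
    obtain ⟨e1, e2, -⟩ := E_lt e he
    obtain ⟨r1, r2, -⟩ := E_lt r hr
    exact hb.mg he hr hh.1 hh.2 (col_bulk (h.d e1 e2 hh.1) (h.d r1 r2 hh.2) hg).1

theorem all1_d (h : Ctx T code u π) (h1 : all1 π = true) :
    ∀ i, i < 5 → ∀ j, j < 5 → i ≠ j → (u i).1 ≠ (u j).1 := by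
  simp only [all1, alld, Bool.and_eq_true] at h1
  obtain ⟨h01, h02, h03, h04, h12, h13, h14, h23, h24, h34⟩ := h1
  intro i hi j hj hij
  apply h.d hi hj
  interval_cases i <;> interval_cases j <;> first
    | exact absurd rfl hij | assumption | (apply dp_symm; assumption)

theorem check_sound (h : Ctx T code u π) (hc : check π = true) {e1 r1 e2 r2 e3 r3 : ℕ}
    (h1 : r1 < e1) (h2 : r2 < e2) (h3 : r3 < e3) (h12 : e1 < e2) (h23 : e2 < e3) (h30 : e3 < 10)
    (n1 : r2 ≠ e1) (n2 : r3 ≠ e1) (n3 : r3 ≠ e2) (q1 : ecol T code u e1 = ecol T code u r1)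
    (q2 : ecol T code u e2 = ecol T code u r2) (q3 : ecol T code u e3 = ecol T code u r3) :
    False := by
  have beqf : ∀ {a b : ℕ}, a ≠ b → ¬ (Nat.beq a b = true) := fun hne h => hne (Nat.eq_of_beq_eq_true h)
  have L1 := (allL_iff _ _).1 hc e1 (List.mem_range.2 (by omega))
  have L2 := (allL_iff _ _).1 L1 r1 (List.mem_range.2 h1)
  rw [force_eq, force_eq, Bool.or_eq_true] at L2
  have c1 : EOK (fun _ => True) (ecol T code u) (mg cInit e1 r1) :=
    EOK_init.mg (by omega) (by omega) trivial trivial q1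
  have b1 := mgL_OK h (e := e1) (r := r1) (by omega) (by omega) q1 (LOK_init h)
  replace L2 := L2.resolve_left (fun hv => viol_s h (COK_of c1) (LOK_of b1) hv)
  have L3 := (allL_iff _ _).1 L2 e2 (by rw [List.mem_range'_1]; omega)
  have L4 := (allL_iff _ _).1 L3 r2 (List.mem_range.2 h2)
  rw [Bool.or_eq_true] at L4
  replace L4 := L4.resolve_left (beqf n1)
  rw [force_eq, force_eq, Bool.or_eq_true] at L4
  have c2 := c1.mg (e := e2) (r := r2) (by omega) (by omega) trivial trivial q2
  have b2 := mgL_OK h (e := e2) (r := r2) (by omega) (by omega) q2 b1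
  replace L4 := L4.resolve_left (fun hv => viol_s h (COK_of c2) (LOK_of b2) hv)
  have L5 := (allL_iff _ _).1 L4 e3 (by rw [List.mem_range'_1]; omega)
  have L6 := (allL_iff _ _).1 L5 r3 (List.mem_range.2 h3)
  rw [Bool.or_eq_true, Bool.or_eq_true, Bool.or_eq_true, Bool.and_eq_true] at L6
  rcases L6 with L6 | L6 | ⟨La, Lk⟩ | L6
  · exact beqf n2 L6
  · exact beqf n3 L6
  · have hd := all1_d h La
    have hev : ∀ e r, e < 10 → r < 10 → ecol T code u e = ecol T code u r →
        ∀ t, ev code u t (E1 e) (E2 e) = ev code u t (E1 r) (E2 r) := by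
      intro e r he hr hq
      obtain ⟨e1, e2, e3⟩ := E_lt e he
      obtain ⟨r1, r2, r3⟩ := E_lt r hr
      exact (col_bulk (hd _ e1 _ e2 e3) (hd _ r1 _ r2 r3) hq).2
    exact kill_sound (T := T) (code := code) h.hF h.hbig u hd h.nz e1 r1 e2 r2 e3 r3 (by omega)
      (by omega) (by omega) (by omega) (by omega) (by omega) (hev _ _ (by omega) (by omega) q1)
      (hev _ _ (by omega) (by omega) q2) (hev _ _ (by omega) (by omega) q3) Lk
  · rw [force_eq, force_eq] at L6
    have c3 := c2.mg (e := e3) (r := r3) (by omega) (by omega) trivial trivial q3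
    have b3 := mgL_OK h (e := e3) (r := r3) (by omega) (by omega) q3 b2
    exact viol_s h (COK_of c3) (LOK_of b3) L6

end Sound
end Chk

set_option linter.unusedVariables false
set_option linter.unusedSectionVars false
set_option linter.unusedSimpArgs false

namespace Chk

theorem three_reps {α : Type} (f : ℕ → α) :
    (∃ K : Finset ℕ, K ⊆ Finset.range 10 ∧ 8 ≤ K.card ∧ Set.InjOn f K) ∨
    ∃ e1 r1 e2 r2 e3 r3 : ℕ, r1 < e1 ∧ r2 < e2 ∧ r3 < e3 ∧ e1 < e2 ∧ e2 < e3 ∧ e3 < 10 ∧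
      r2 ≠ e1 ∧ r3 ≠ e1 ∧ r3 ≠ e2 ∧ f e1 = f r1 ∧ f e2 = f r2 ∧ f e3 = f r3 := by
  classical
  let K := (Finset.range 10).filter fun e => ∀ r, r < e → f r ≠ f e
  by_cases hK : 8 ≤ K.card
  · refine Or.inl ⟨K, Finset.filter_subset _ _, hK, ?_⟩
    intro a ha b hb hab
    simp only [K, Finset.coe_filter, Set.mem_ofPred_eq] at ha hb
    by_contra hne
    rcases Nat.lt_or_gt_of_ne hne with h | h
    · exact hb.2 a h hab
    · exact ha.2 b h hab.symm
  · right
    let K' := (Finset.range 10).filter fun e => ¬ ∀ r, r < e → f r ≠ f e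
    have hcard : K.card + K'.card = 10 := by
      have := Finset.card_filter_add_card_filter_not (s := Finset.range 10)
        (fun e => ∀ r, r < e → f r ≠ f e)
      rwa [Finset.card_range] at this
    have h3 : 3 ≤ K'.card := by omega
    obtain ⟨K3, hsub, hc⟩ := Finset.exists_subset_card_eq h3
    let g := K3.orderEmbOfFin hc
    have hg : ∀ i, g i ∈ K' := fun i => hsub (Finset.orderEmbOfFin_mem _ _ i)
    have hr : ∀ e ∈ K', ∃ r, r < e ∧ f e = f r ∧ r ∉ K' := by
      intro e he
      have he' : ∃ r, r < e ∧ f e = f r := by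
        simp only [K', Finset.mem_filter] at he
        have := he.2
        push Not at this
        obtain ⟨r, h1, h2⟩ := this
        exact ⟨r, h1, h2.symm⟩
      refine ⟨Nat.find he', (Nat.find_spec he').1, (Nat.find_spec he').2, ?_⟩
      intro hm
      simp only [K', Finset.mem_filter] at hm
      apply hm.2
      intro r hr heq
      exact Nat.find_min he' hr ⟨hr.trans (Nat.find_spec he').1, (Nat.find_spec he').2.trans heq.symm⟩
    obtain ⟨r1, a1, b1, c1⟩ := hr _ (hg 0)
    obtain ⟨r2, a2, b2, c2⟩ := hr _ (hg 1)
    obtain ⟨r3, a3, b3, c3⟩ := hr _ (hg 2)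
    refine ⟨g 0, r1, g 1, r2, g 2, r3, a1, a2, a3, g.strictMono (by decide),
      g.strictMono (by decide), ?_, ?_, ?_, ?_, b1, b2, b3⟩
    · have := hg 2
      simp only [K', Finset.mem_filter, Finset.mem_range] at this
      exact this.1
    · rintro rfl; exact c2 (hg 0)
    · rintro rfl; exact c3 (hg 0)
    · rintro rfl; exact c3 (hg 1)

def pats : List (List ℕ) :=
  [[0, 0, 0, 0, 0], [0, 0, 0, 0, 1], [0, 0, 0, 3, 3], [0, 0, 0, 3, 4], [0, 0, 2, 2, 4],
    [0, 0, 2, 3, 4], [0, 1, 2, 3, 4]]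

def tup (t : ℕ × ℕ × ℕ × ℕ × ℕ) (i : ℕ) : ℕ :=
  [t.1, t.2.1, t.2.2.1, t.2.2.2.1, t.2.2.2.2].getD i 0

def canonB (g : List ℕ) : Bool :=
  List.anyL perms fun t => List.anyL pats fun π =>
    allL v5 fun i => allL v5 fun j =>
      Nat.beq (g.getD (tup t i) 0) (g.getD (tup t j) 0) == sp π i j

theorem canon_all : allL (List.range 1) (fun a => allL (List.range 2) fun b =>
    allL (List.range 3) fun c => allL (List.range 4) fun d => allL (List.range 5) fun e =>
      canonB [a, b, c, d, e]) = true := by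
  decide +kernel

set_option maxRecDepth 100000

theorem chk0 : check [0, 0, 0, 0, 0] = true := by decide +kernel
theorem chk1 : check [0, 0, 0, 0, 1] = true := by decide +kernel
theorem chk2 : check [0, 0, 0, 3, 3] = true := by decide +kernel
theorem chk3 : check [0, 0, 0, 3, 4] = true := by decide +kernel
theorem chk4 : check [0, 0, 2, 2, 4] = true := by decide +kernel
theorem chk5 : check [0, 0, 2, 3, 4] = true := by decide +kernel
theorem chk60 : lvl1 [0, 1, 2, 3, 4] 0 = true := by decide +kernel
theorem chk61 : lvl1 [0, 1, 2, 3, 4] 1 = true := by decide +kernel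
theorem chk62 : lvl1 [0, 1, 2, 3, 4] 2 = true := by decide +kernel
theorem chk63 : lvl1 [0, 1, 2, 3, 4] 3 = true := by decide +kernel
theorem chk64 : lvl1 [0, 1, 2, 3, 4] 4 = true := by decide +kernel
theorem chk65 : lvl1 [0, 1, 2, 3, 4] 5 = true := by decide +kernel
theorem chk66 : lvl1 [0, 1, 2, 3, 4] 6 = true := by decide +kernel
theorem chk67 : lvl1 [0, 1, 2, 3, 4] 7 = true := by decide +kernel
theorem chk68 : lvl1 [0, 1, 2, 3, 4] 8 = true := by decide +kernel
theorem chk69 : lvl1 [0, 1, 2, 3, 4] 9 = true := by decide +kernel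

theorem chk6 : check [0, 1, 2, 3, 4] = true := by
  unfold check
  rw [allL_iff]
  intro a ha
  rw [List.mem_range] at ha
  interval_cases a
  exacts [chk60, chk61, chk62, chk63, chk64, chk65, chk66, chk67, chk68, chk69]

theorem chk_all : ∀ π ∈ pats, check π = true := by
  intro π h
  simp only [pats, List.mem_cons, List.not_mem_nil, or_false] at h
  rcases h with h | h | h | h | h | h | h <;> rw [h]
  exacts [chk0, chk1, chk2, chk3, chk4, chk5, chk6]

end Chk

set_option linter.unusedVariables false
set_option linter.unusedSectionVars false
set_option linter.unusedSimpArgs false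

namespace Chk

section Sound
variable {P L F Tt : Type} [LinearOrder P] [Field F] [Fintype F] [DecidableEq F] [Nonempty Tt]
variable {T : Tmpl P L} {code : Tt → P → P → F}

theorem canon {Q : Type} (q : ℕ → Q) : ∃ t ∈ perms, ∃ π ∈ pats, ∀ i, i < 5 → ∀ j, j < 5 →
    (q (tup t i) = q (tup t j) ↔ sp π i j = true) := by
  classical
  have hex : ∀ i, ∃ j, q j = q i := fun i => ⟨i, rfl⟩
  let g : ℕ → ℕ := fun i => Nat.find (hex i)
  have hg1 : ∀ i, q (g i) = q i := fun i => Nat.find_spec (hex i)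
  have hg2 : ∀ i, g i < i + 1 := fun i => Nat.lt_succ_of_le (Nat.find_min' (hex i) rfl)
  have hg3 : ∀ i j, q i = q j ↔ g i = g j := by
    intro i j
    constructor
    · intro h; simp only [g, h]
    · intro h; rw [← hg1 i, h, hg1 j]
  have h := canon_all
  simp only [allL_iff, List.mem_range] at h
  have h := h (g 0) (hg2 0) (g 1) (hg2 1) (g 2) (hg2 2) (g 3) (hg2 3) (g 4) (hg2 4)
  simp only [canonB, anyL_iff, allL_iff, mem_v5] at h
  obtain ⟨t, ht, π, hπ, h⟩ := h
  refine ⟨t, ht, π, hπ, ?_⟩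
  intro i hi j hj
  have h := h i hi j hj
  rw [beq_iff_eq] at h
  rw [← h, Nat.beq_eq, hg3]
  have hl : ∀ k, k < 5 → [g 0, g 1, g 2, g 3, g 4].getD k 0 = g k := by
    intro k hk; interval_cases k <;> rfl
  have ht' := (perms_ok t ht).1
  have hlt : ∀ k, k < 5 → tup t k < 5 := by
    intro k hk
    interval_cases k
    exacts [ht'.1, ht'.2.1, ht'.2.2.1, ht'.2.2.2.1, ht'.2.2.2.2]
  rw [hl _ (hlt i hi), hl _ (hlt j hj)]

theorem tup_lt {t : ℕ × ℕ × ℕ × ℕ × ℕ} (ht : t ∈ perms) : ∀ k, k < 5 → tup t k < 5 := by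
  have ht' := (perms_ok t ht).1
  intro k hk
  interval_cases k
  exacts [ht'.1, ht'.2.1, ht'.2.2.1, ht'.2.2.2.1, ht'.2.2.2.2]

theorem tup_ne {t : ℕ × ℕ × ℕ × ℕ × ℕ} (ht : t ∈ perms) :
    ∀ i, i < 5 → ∀ j, j < 5 → i ≠ j → tup t i ≠ tup t j := by
  obtain ⟨-, ⟨h01, h02, h03, h04⟩, ⟨h12, h13, h14⟩, ⟨h23, h24⟩, h34⟩ := perms_ok t ht
  intro i hi j hj hij
  interval_cases i <;> interval_cases j <;> first
    | exact absurd rfl hij | assumption | (apply Ne.symm; assumption)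

/-- Five distinct vertices span at least eight colours. -/
theorem five_colors (hG : ∀ t, Good T (code t)) (hF : BigChar F) (hbig : 2000000 < Fintype.card F)
    (hfive : ∃ U : Fin 5 → P, Function.Injective U) (w : ℕ → P × (Tt → F))
    (inj : ∀ i, i < 5 → ∀ j, j < 5 → i ≠ j → w i ≠ w j) (nz : ∀ i, i < 5 → Nz T code (w i).2) :
    ∃ x y : ℕ → ℕ, (∀ k, k < 10 → x k < 5 ∧ y k < 5 ∧ x k ≠ y k) ∧
      ∃ K : Finset ℕ, K ⊆ Finset.range 10 ∧ 8 ≤ K.card ∧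
        Set.InjOn (fun k => col T code (w (x k)) (w (y k))) K := by
  obtain ⟨t, ht, π, hπ, h⟩ := canon fun i => (w i).1
  have ctx : Ctx T code (fun i => w (tup t i)) π := ⟨hG, hF, hbig, hfive,
    fun i hi j hj hij => inj _ (tup_lt ht i hi) _ (tup_lt ht j hj) (tup_ne ht i hi j hj hij),
    h, fun i hi => nz _ (tup_lt ht i hi)⟩
  refine ⟨fun k => tup t (E1 k), fun k => tup t (E2 k), ?_, ?_⟩
  · intro k hk
    obtain ⟨h1, h2, h3⟩ := E_lt k hk
    exact ⟨tup_lt ht _ h1, tup_lt ht _ h2, tup_ne ht _ h1 _ h2 h3⟩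
  · rcases three_reps (ecol T code fun i => w (tup t i)) with h | h
    · exact h
    · obtain ⟨e1, r1, e2, r2, e3, r3, h1, h2, h3, h4, h5, h6, h7, h8, h9, h10, h11, h12⟩ := h
      exact (check_sound ctx (chk_all π hπ) h1 h2 h3 h4 h5 h6 h7 h8 h9 h10 h11 h12).elim

end Sound
end Chk

set_option linter.unusedVariables false
set_option linter.unusedSectionVars false
set_option linter.unusedSimpArgs false

section Upper

/-- From the algebraic colouring to a bound on the generalized Ramsey number. -/
theorem ramsey_le_of_col {P L F Tt : Type} [LinearOrder P] [Field F] [Fintype F] [DecidableEq F]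
    [Nonempty Tt] [Fintype P] [Fintype L] [Fintype Tt] [DecidableEq Tt] (T : Tmpl P L)
    (code : Tt → P → P → F)
    (hG : ∀ t, Good T (code t)) (hF : BigChar F) (hbig : 2000000 < Fintype.card F)
    (hfive : ∃ U : Fin 5 → P, Function.Injective U) (n : ℕ)
    (hn : n ≤ Nat.card {v : P × (Tt → F) // Nz T code v.2}) :
    genRamsey n 5 8 ≤ (Fintype.card L + Fintype.card F) * Fintype.card F ^ Fintype.card Tt := by
  classical
  rw [Nat.card_eq_fintype_card] at hn
  have hn' : Fintype.card (Fin n) ≤ Fintype.card {v : P × (Tt → F) // Nz T code v.2} := by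
    simpa using hn
  obtain ⟨ψ⟩ := Function.Embedding.nonempty_of_card_le hn'
  have hk : Fintype.card (Colr L F Tt) =
      (Fintype.card L + Fintype.card F) * Fintype.card F ^ Fintype.card Tt := by
    simp only [Fintype.card_sum, Fintype.card_prod, Fintype.card_fun]
    ring
  rw [← hk]
  let enc := Fintype.equivFin (Colr L F Tt)
  let c : Sym2 (Fin n) → Fin (Fintype.card (Colr L F Tt)) :=
    Sym2.lift ⟨fun i j => enc (col T code (ψ i).1 (ψ j).1), fun i j =>
      congrArg enc (col_symm T code _ _)⟩
  apply Nat.sInf_le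
  refine ⟨c, ?_⟩
  intro S hS
  let g := S.orderEmbOfFin hS
  let w : ℕ → P × (Tt → F) := fun i => if h : i < 5 then (ψ (g ⟨i, h⟩)).1 else (ψ (g 0)).1
  have hw : ∀ i (h : i < 5), w i = (ψ (g ⟨i, h⟩)).1 := fun i h => by simp only [w, dif_pos h]
  obtain ⟨x, y, hxy, K, hK, hK8, hinj⟩ := Chk.five_colors (T := T) (code := code) hG hF hbig hfive w
    (by
      intro i hi j hj hij
      rw [hw i hi, hw j hj]
      intro h
      have := g.injective (ψ.injective (Subtype.ext h))
      exact hij (by simpa using this))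
    (by
      intro i hi
      rw [hw i hi]
      exact (ψ _).2)
  unfold numColorsOn
  let f : ℕ → Fin (Fintype.card (Colr L F Tt)) := fun k => enc (col T code (w (x k)) (w (y k)))
  have hsub : (↑(K.image f) : Set (Fin (Fintype.card (Colr L F Tt)))) ⊆
      c '' {e : Sym2 (Fin n) | e ∈ S.sym2 ∧ ¬ e.IsDiag} := by
    intro z hz
    rw [Finset.coe_image] at hz
    obtain ⟨k, hk, rfl⟩ := hz
    obtain ⟨h1, h2, h3⟩ := hxy k (Finset.mem_range.1 (hK hk))
    refine ⟨s(g ⟨x k, h1⟩, g ⟨y k, h2⟩), ⟨?_, ?_⟩, ?_⟩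
    · rw [Finset.mk_mem_sym2_iff]
      exact ⟨Finset.orderEmbOfFin_mem _ _ _, Finset.orderEmbOfFin_mem _ _ _⟩
    · rw [Sym2.mk_isDiag_iff]
      intro h
      have := g.injective h
      exact h3 (by simpa using this)
    · show enc (col T code _ _) = enc (col T code _ _)
      rw [hw _ h1, hw _ h2]
  have := Set.ncard_le_ncard hsub (Set.toFinite _)
  rw [Set.ncard_coe_finset, Finset.card_image_of_injOn] at this
  · omega
  · intro a ha b hb hab
    exact hinj ha hb (enc.injective hab)

theorem card_vanish {F Tt : Type} [Field F] [Fintype F] [DecidableEq F] [Fintype Tt]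
    [DecidableEq Tt] (A : Finset Tt) :
    (Finset.univ.filter fun x : Tt → F => ∀ t ∈ A, x t = 0).card =
      Fintype.card F ^ (Fintype.card Tt - A.card) := by
  have : (Finset.univ.filter fun x : Tt → F => ∀ t ∈ A, x t = 0) =
      Fintype.piFinset (fun t => if t ∈ A then {0} else (Finset.univ : Finset F)) := by
    ext x
    simp only [Finset.mem_filter, Finset.mem_univ, true_and, Fintype.mem_piFinset]
    refine forall_congr' fun t => ?_
    by_cases h : t ∈ A <;> simp [h]
  rw [this, Fintype.card_piFinset]
  have h2 : ∀ t, (if t ∈ A then {0} else (Finset.univ : Finset F)).card =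
      if t ∈ A then 1 else Fintype.card F := by
    intro t; by_cases h : t ∈ A <;> simp [h]
  rw [Finset.prod_congr rfl (fun t _ => h2 t), Finset.prod_ite]
  simp only [Finset.prod_const_one, one_mul, Finset.prod_const]
  congr 1
  rw [← Finset.card_compl]
  congr 1
  ext t; simp

theorem nz_count {P L F Tt : Type} [LinearOrder P] [Field F] [Fintype F] [DecidableEq F]
    [Nonempty Tt] [Fintype P] [Fintype Tt] [DecidableEq Tt] (T : Tmpl P L)
    (code : Tt → P → P → F) [Fintype {α : P → P → F // Good T α}] (r : ℕ)
    (A : {α : P → P → F // Good T α} → Finset Tt) (hA : ∀ a, (A a).card = r)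
    (hcode : ∀ a, ∀ t ∈ A a, code t = a.1) :
    Fintype.card P * Fintype.card F ^ Fintype.card Tt ≤
      Nat.card {v : P × (Tt → F) // Nz T code v.2} + Fintype.card P *
        (Fintype.card {α : P → P → F // Good T α} * Fintype.card F ^ (Fintype.card Tt - r)) := by
  classical
  rw [Nat.card_eq_fintype_card, Fintype.card_subtype]
  have hprod : (Finset.univ.filter fun v : P × (Tt → F) => Nz T code v.2) =
      Finset.univ ×ˢ (Finset.univ.filter fun x : Tt → F => Nz T code x) := by
    ext v; simp
  rw [hprod, Finset.card_product, Finset.card_univ]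
  have hcompl : (Finset.univ.filter fun x : Tt → F => ¬ Nz T code x) ⊆
      Finset.univ.biUnion (fun a : {α : P → P → F // Good T α} =>
        Finset.univ.filter fun x : Tt → F => ∀ t ∈ A a, x t = 0) := by
    intro x hx
    replace hx := (Finset.mem_filter.1 hx).2
    unfold Nz at hx
    push Not at hx
    obtain ⟨α, hα, hx⟩ := hx
    simp only [Finset.mem_biUnion, Finset.mem_univ, true_and, Finset.mem_filter]
    exact ⟨⟨α, hα⟩, fun t ht => hx _ (hcode _ t ht)⟩
  have hbad : (Finset.univ.filter fun x : Tt → F => ¬ Nz T code x).card ≤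
      Fintype.card {α : P → P → F // Good T α} * Fintype.card F ^ (Fintype.card Tt - r) := by
    refine (Finset.card_le_card hcompl).trans (Finset.card_biUnion_le.trans ?_)
    rw [Finset.sum_congr rfl (fun a _ => card_vanish (F := F) (A a))]
    simp [hA]
  have htot : (Finset.univ.filter fun x : Tt → F => Nz T code x).card +
      (Finset.univ.filter fun x : Tt → F => ¬ Nz T code x).card =
        Fintype.card F ^ Fintype.card Tt := by
    rw [Finset.card_filter_add_card_filter_not, Finset.card_univ, Fintype.card_fun]
  rw [← htot, mul_add]
  exact Nat.add_le_add_left (Nat.mul_le_mul_left _ hbad) _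

theorem bigChar_zmod (p : ℕ) [Fact p.Prime] (hp : 2000000 < p) : BigChar (ZMod p) := by
  intro z hz hb h
  rw [ZMod.intCast_zmod_eq_zero_iff_dvd] at h
  have := Int.le_of_dvd (abs_pos.2 hz) ((dvd_abs _ _).2 h)
  omega

theorem ramsey_tmpl (p : ℕ) [Fact p.Prime] (hp : 2000000 < p) (f l : ℕ) (hf : 5 ≤ f)
    (T : Tmpl (Fin f) (Fin l)) (η : ℝ) (hη : 0 < η) : ∃ M0 : ℕ, ∀ M, M0 ≤ M → ∀ n : ℕ,
      (n : ℝ) ≤ (1 - η) * f * p ^ M → genRamsey n 5 8 ≤ (l + p) * p ^ M := by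
  classical
  have hF := bigChar_zmod p hp
  let ι := {α : Fin f → Fin f → ZMod p // Good T α}
  have a0 : ι := ⟨αdef (ZMod p) T, αdef_good hF T⟩
  have hm : 0 < Fintype.card ι := Fintype.card_pos_iff.2 ⟨a0⟩
  set m := Fintype.card ι with hmdef
  have hp1 : (1 : ℝ) < p := by exact_mod_cast (by omega : 1 < p)
  obtain ⟨R, hR⟩ := pow_unbounded_of_one_lt ((m : ℝ) / η) hp1
  refine ⟨m * (R + 1), ?_⟩
  intro M hM n hn
  let r := M / m
  let s := M % m
  have hrs : m * r + s = M := Nat.div_add_mod M m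
  have hr : R + 1 ≤ r := by
    rw [Nat.le_div_iff_mul_le hm, mul_comm]; exact hM
  let Tt := (ι × Fin r) ⊕ Fin s
  have : Nonempty Tt := ⟨Sum.inl (a0, ⟨0, by omega⟩)⟩
  have hTt : Fintype.card Tt = M := by
    simp only [Tt, Fintype.card_sum, Fintype.card_prod, Fintype.card_fin]
    exact hrs
  let code : Tt → Fin f → Fin f → ZMod p := fun t => (Sum.elim (fun a => a.1) (fun _ => a0) t : ι).1
  have hcard : Fintype.card (ZMod p) = p := ZMod.card p
  have key := ramsey_le_of_col (Tt := Tt) T code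
    (fun t => (Sum.elim (fun a => a.1) (fun _ => a0) t : ι).2) hF (by rw [hcard]; exact hp)
    ⟨Fin.castLE hf, Fin.castLE_injective hf⟩ n
  rw [hcard, hTt, Fintype.card_fin] at key
  apply key
  have hcount := nz_count (Tt := Tt) T code r
    (fun a : ι => Finset.univ.image fun j : Fin r => (Sum.inl (a, j) : Tt))
    (fun a => by
      rw [Finset.card_image_of_injective]
      · simp
      · intro i j hij
        exact (Prod.mk.inj (Sum.inl.inj hij)).2)
    (fun a t ht => by
      rw [Finset.mem_image] at ht
      obtain ⟨j, -, rfl⟩ := ht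
      rfl)
  rw [hcard, hTt, Fintype.card_fin] at hcount
  set V := Nat.card {v : Fin f × (Tt → ZMod p) // Nz T code v.2}
  have hrM : r ≤ M := Nat.div_le_self _ _
  have h1 : (m : ℝ) * p ^ (M - r) ≤ η * p ^ M := by
    have e2 : (p : ℝ) ^ M = p ^ r * p ^ (M - r) := by rw [← pow_add]; congr 1; omega
    have e3 : (m : ℝ) ≤ η * p ^ r := by
      have : (p : ℝ) ^ R ≤ p ^ r := pow_le_pow_right₀ hp1.le (by omega)
      have := hR.le.trans this
      rwa [div_le_iff₀ hη, mul_comm] at this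
    have e4 : (0 : ℝ) ≤ (p : ℝ) ^ (M - r) := by positivity
    calc (m : ℝ) * p ^ (M - r) ≤ (η * p ^ r) * p ^ (M - r) := mul_le_mul_of_nonneg_right e3 e4
      _ = η * p ^ M := by rw [e2]; ring
  have h2 : (f : ℝ) * p ^ M ≤ V + f * (m * p ^ (M - r)) := by exact_mod_cast hcount
  have h3 : (n : ℝ) ≤ V := by
    have hfpos : (0 : ℝ) ≤ f := by positivity
    have := mul_le_mul_of_nonneg_left h1 hfpos
    linarith
  exact_mod_cast h3

theorem ramsey_tmpl' (p : ℕ) [Fact p.Prime] (hp : 2000000 < p) (s N : ℕ) (hN : Odd N)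
    (hf : 5 ≤ 15 ^ s * N) (η : ℝ) (hη : 0 < η) : ∃ M0 : ℕ, ∀ M, M0 ≤ M → ∀ n : ℕ,
      (n : ℝ) ≤ (1 - η) * (15 ^ s * N) * p ^ M →
        (7 : ℝ) * genRamsey n 5 8 ≤ (6 * (15 ^ s * N) + N + 7 * p) * p ^ M := by
  obtain ⟨l, ⟨T⟩, hl⟩ := tmpl_exists s N hN
  obtain ⟨M0, h⟩ := ramsey_tmpl p hp _ l hf T η hη
  refine ⟨M0, fun M hM n hn => ?_⟩
  have h1 := h M hM n (by push_cast; exact hn)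
  have h2 : 7 * genRamsey n 5 8 ≤ (6 * (15 ^ s * N) + N + 7 * p) * p ^ M := by
    calc 7 * genRamsey n 5 8 ≤ 7 * ((l + p) * p ^ M) := Nat.mul_le_mul_left _ h1
      _ = (7 * l + 7 * p) * p ^ M := by ring
      _ ≤ _ := Nat.mul_le_mul_right _ (by omega)
  exact_mod_cast h2

theorem ramsey_upper_small (ε : ℝ) (hε : 0 < ε) (hε1 : ε ≤ 1) :
    ∃ N : ℕ, ∀ n : ℕ, N ≤ n → (genRamsey n 5 8 : ℝ) ≤ (6 / 7 + ε) * n := by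
  obtain ⟨p, hp, hpp⟩ := Nat.exists_infinite_primes 2000001
  have : Fact p.Prime := ⟨hpp⟩
  have hp' : 2000000 < p := by omega
  obtain ⟨s, hs⟩ := pow_unbounded_of_one_lt (8 / ε) (by norm_num : (1 : ℝ) < 15)
  obtain ⟨N0, hN0⟩ := exists_nat_gt (4 * (2 + (p : ℝ)) / ε)
  set Q : ℝ := 15 ^ s with hQ
  have hQ1 : 1 ≤ Q := one_le_pow₀ (by norm_num)
  have hp1 : (1 : ℝ) < p := by exact_mod_cast (by omega : 1 < p)
  have hN0' : (4 * (2 + (p : ℝ))) < ε * N0 := by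
    rwa [div_lt_iff₀ hε, mul_comm (N0 : ℝ)] at hN0
  have hN0pos : (0 : ℝ) < N0 := by
    by_contra hc
    have : (N0 : ℝ) ≤ 0 := not_lt.1 hc
    nlinarith
  have hN05 : (5 : ℝ) < N0 := by nlinarith
  set η := ε / 32 with hηd
  have hη : 0 < η := by positivity
  have hη2 : η ≤ 1 / 2 := by rw [hηd]; linarith
  -- thresholds for all admissible sizes
  let N1 := 2 * N0 * p + 2
  have hthr : ∃ M1 : ℕ, ∀ N, N ≤ N1 → Odd N → 5 ≤ 15 ^ s * N → ∀ M, M1 ≤ M → ∀ n : ℕ,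
      (n : ℝ) ≤ (1 - η) * (15 ^ s * N) * p ^ M →
        (7 : ℝ) * genRamsey n 5 8 ≤ (6 * (15 ^ s * N) + N + 7 * p) * p ^ M := by
    choose! g hg using fun (N : ℕ) (h : Odd N ∧ 5 ≤ 15 ^ s * N) =>
      ramsey_tmpl' p hp' s N h.1 h.2 η hη
    refine ⟨(Finset.range (N1 + 1)).sup g, fun N hN hodd h5 M hM n hn => ?_⟩
    exact hg N ⟨hodd, h5⟩ M ((Finset.le_sup (Finset.mem_range.2 (by omega))).trans hM) n hn
  obtain ⟨M1, hM1⟩ := hthr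
  let B := N0 * 15 ^ s
  have hBpos : 0 < B := Nat.mul_pos (by exact_mod_cast hN0pos) (by positivity)
  refine ⟨B * p ^ M1, fun n hn => ?_⟩
  have hnB : p ^ M1 ≤ n / B := by
    rw [Nat.le_div_iff_mul_le hBpos, mul_comm]; exact hn
  have hnB0 : n / B ≠ 0 := by
    have : 0 < p ^ M1 := by positivity
    omega
  set M := Nat.log p (n / B) with hMdef
  have hM1M : M1 ≤ M := Nat.le_log_of_pow_le (by omega) hnB
  have hlow : p ^ M ≤ n / B := Nat.pow_log_le_self p hnB0
  have hup : n / B < p ^ (M + 1) := Nat.lt_pow_succ_log_self (by omega) _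
  rw [Nat.le_div_iff_mul_le hBpos] at hlow
  rw [Nat.div_lt_iff_lt_mul hBpos] at hup
  have hBR : (B : ℝ) = N0 * Q := by simp [B, hQ]
  have hlowR : (p : ℝ) ^ M * (N0 * Q) ≤ n := by rw [← hBR]; exact_mod_cast hlow
  have hupR : (n : ℝ) ≤ p ^ (M + 1) * (N0 * Q) := by rw [← hBR]; exact_mod_cast hup.le
  have hpM : (0 : ℝ) < (p : ℝ) ^ M := by positivity
  set X : ℝ := (p : ℝ) ^ M with hX
  have hη1 : 0 < 1 - η := by linarith
  -- smallest odd number that is large enough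
  set y : ℝ := n / ((1 - η) * Q * X) with hy
  have hden : 0 < (1 - η) * Q * X := by positivity
  have hy0 : 0 ≤ y := by positivity
  have : ∃ N : ℕ, Odd N ∧ y ≤ N ∧ (N : ℝ) ≤ y + 2 := by
    have h1 := Nat.le_ceil y
    have h2 := Nat.ceil_lt_add_one hy0
    rcases Nat.even_or_odd ⌈y⌉₊ with h | h
    · exact ⟨⌈y⌉₊ + 1, h.add_one, by push_cast; linarith, by push_cast; linarith⟩
    · exact ⟨⌈y⌉₊, h, h1, by linarith⟩
  obtain ⟨N, hodd, hyN, hNy⟩ := this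
  have hyeq : y * ((1 - η) * Q * X) = n := by rw [hy]; field_simp
  have hyN0 : (N0 : ℝ) ≤ y := by
    rw [hy, le_div_iff₀ hden]
    have : (N0 : ℝ) * ((1 - η) * Q * X) ≤ X * (N0 * Q) := by
      have : (1 - η) * (N0 * Q * X) ≤ 1 * (N0 * Q * X) :=
        mul_le_mul_of_nonneg_right (by linarith) (by positivity)
      linarith
    linarith
  have hyle : y ≤ 2 * N0 * p := by
    rw [hy, div_le_iff₀ hden]
    have h1 : (n : ℝ) ≤ (N0 * p * Q * X) := by
      calc (n : ℝ) ≤ p ^ (M + 1) * (N0 * Q) := hupR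
        _ = N0 * p * Q * X := by rw [pow_succ, hX]; ring
    have h2 : (1 : ℝ) * (N0 * p * Q * X) ≤ (2 * (1 - η)) * (N0 * p * Q * X) :=
      mul_le_mul_of_nonneg_right (by linarith) (by positivity)
    linarith
  have hNN1 : N ≤ N1 := by
    have : (N : ℝ) ≤ ((N1 : ℕ) : ℝ) := by
      simp only [N1]; push_cast; linarith
    exact_mod_cast this
  have hN5 : 5 ≤ 15 ^ s * N := by
    have h5 : (5 : ℝ) ≤ N := by linarith
    have h5' : 5 ≤ N := by exact_mod_cast h5
    exact h5'.trans (Nat.le_mul_of_pos_left _ (by positivity))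
  have hfin := hM1 N hNN1 hodd hN5 M hM1M n (by
    rw [← hyeq]
    have := mul_le_mul_of_nonneg_right hyN hden.le
    calc y * ((1 - η) * Q * X) ≤ N * ((1 - η) * Q * X) := this
      _ = (1 - η) * (Q * N) * X := by ring)
  have hfin' : (7 : ℝ) * genRamsey n 5 8 ≤ (6 * (Q * N) + N + 7 * p) * X := hfin
  -- final estimate
  have hn0 : (0 : ℝ) ≤ n := by positivity
  have hXn : X * (N0 * Q) ≤ n := hlowR
  -- Q * y * X = n / (1 - η) ≤ (1 + 2 η) n
  have hQyX : Q * y * X ≤ (1 + 2 * η) * n := by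
    have hnon : 0 ≤ Q * y * X := by positivity
    have : (1 : ℝ) ≤ (1 + 2 * η) * (1 - η) := by nlinarith
    calc Q * y * X = 1 * (Q * y * X) := by ring
      _ ≤ ((1 + 2 * η) * (1 - η)) * (Q * y * X) := mul_le_mul_of_nonneg_right this hnon
      _ = (1 + 2 * η) * (y * ((1 - η) * Q * X)) := by ring
      _ = (1 + 2 * η) * n := by rw [hyeq]
  have hQε : 8 ≤ Q * ε := by
    have := hs.le
    rwa [div_le_iff₀ hε] at this
  have hyX : y * X * 8 ≤ ε * ((1 + 2 * η) * n) := by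
    have hnon : 0 ≤ y * X := by positivity
    calc y * X * 8 ≤ y * X * (Q * ε) := mul_le_mul_of_nonneg_left hQε hnon
      _ = ε * (Q * y * X) := by ring
      _ ≤ _ := mul_le_mul_of_nonneg_left hQyX hε.le
  have hXQ : (4 * (2 + (p : ℝ))) * (X * Q) ≤ ε * n := by
    have hnon : 0 ≤ X * Q := by positivity
    calc (4 * (2 + (p : ℝ))) * (X * Q) ≤ (ε * N0) * (X * Q) :=
          mul_le_mul_of_nonneg_right hN0'.le hnon
      _ = ε * (X * (N0 * Q)) := by ring
      _ ≤ ε * n := mul_le_mul_of_nonneg_left hXn hε.le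
  have hNX : (N : ℝ) * X ≤ y * X + 2 * X := by nlinarith
  have hNQX : Q * N * X ≤ Q * y * X + 2 * (X * Q) := by
    have := mul_le_mul_of_nonneg_left hNX (by positivity : 0 ≤ Q)
    linarith
  have hXle : X ≤ X * Q := by nlinarith
  have hpX : (p : ℝ) * X ≤ p * (X * Q) := mul_le_mul_of_nonneg_left hXle (by positivity)
  have hηn : 2 * η * n = ε / 16 * n := by rw [hηd]; ring
  have hηn' : ε * ((1 + 2 * η) * n) ≤ 2 * (ε * n) := by
    have h1 : (1 + 2 * η) ≤ 2 := by linarith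
    have h0 : 0 ≤ ε * n := by positivity
    have h2 := mul_le_mul_of_nonneg_right h1 h0
    linarith
  have hεn : 0 ≤ ε * n := by positivity
  have e1 : (1 + 2 * η) * (n : ℝ) = n + ε * n / 16 := by rw [hηd]; ring
  rw [e1] at hQyX
  have e2 : 7 * (genRamsey n 5 8 : ℝ) ≤ 6 * (Q * N * X) + N * X + 7 * (p * X) := by
    calc _ ≤ _ := hfin'
      _ = _ := by ring
  have e3 : (6 / 7 + ε) * (n : ℝ) = 6 / 7 * n + ε * n := by ring
  rw [e3]
  have e4 : 8 * (X * Q) + 4 * (p * (X * Q)) ≤ ε * n := by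
    calc _ = (4 * (2 + (p : ℝ))) * (X * Q) := by ring
      _ ≤ _ := hXQ
  linarith

theorem genRamsey_five_eight_upper (ε : ℝ) (hε : 0 < ε) :
    ∃ N : ℕ, ∀ n : ℕ, N ≤ n → (genRamsey n 5 8 : ℝ) ≤ (6 / 7 + ε) * n := by
  obtain ⟨N, hN⟩ := ramsey_upper_small (min ε 1) (lt_min hε one_pos) (min_le_right _ _)
  refine ⟨N, fun n hn => (hN n hn).trans ?_⟩
  have : min ε 1 ≤ ε := min_le_left _ _
  exact mul_le_mul_of_nonneg_right (by linarith) (by positivity)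

end Upper

set_option linter.unusedVariables false
set_option linter.unusedSectionVars false
set_option linter.unusedSimpArgs false

section Lower

theorem rainbow_ok (n : ℕ) : ∃ k, ∃ c : Sym2 (Fin n) → Fin k, IsPQColoring n 5 8 c := by
  classical
  refine ⟨_, Fintype.equivFin (Sym2 (Fin n)), ?_⟩
  intro S hS
  unfold numColorsOn
  rw [Set.ncard_image_of_injective _ (Equiv.injective _)]
  have hsub : (↑(S.offDiag.image (fun p => s(p.1, p.2))) : Set (Sym2 (Fin n))) ⊆
      {e : Sym2 (Fin n) | e ∈ S.sym2 ∧ ¬ e.IsDiag} := by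
    intro e he
    rw [Finset.coe_image] at he
    obtain ⟨p, hp, rfl⟩ := he
    rw [Finset.mem_coe, Finset.mem_offDiag] at hp
    exact ⟨Finset.mk_mem_sym2_iff.2 ⟨hp.1, hp.2.1⟩, fun h => hp.2.2 (Sym2.mk_isDiag_iff.1 h)⟩
  have h := Set.ncard_le_ncard hsub (Set.toFinite _)
  have h10 : (S.offDiag.image (fun p => s(p.1, p.2))).card = 10 := by
    have := Sym2.card_image_offDiag S
    rw [hS] at this
    exact this
  rw [Set.ncard_coe_finset, h10] at h
  omega

def ne2 {V : Type} (a b c d : V) : Prop := ¬ ((a = c ∧ b = d) ∨ (a = d ∧ b = c))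

/-- no five vertices carry three repeated colours -/
def No3 {V K : Type} [DecidableEq V] (χ : V → V → K) : Prop :=
  ∀ (S : Finset V), S.card ≤ 5 → ∀ a1 b1 c1 d1 a2 b2 c2 d2 a3 b3 c3 d3 : V,
    (a1 ∈ S ∧ b1 ∈ S ∧ c1 ∈ S ∧ d1 ∈ S ∧ a2 ∈ S ∧ b2 ∈ S ∧ c2 ∈ S ∧ d2 ∈ S ∧ a3 ∈ S ∧ b3 ∈ S ∧
      c3 ∈ S ∧ d3 ∈ S) →
    (a1 ≠ b1 ∧ a2 ≠ b2 ∧ a3 ≠ b3 ∧ c1 ≠ d1 ∧ c2 ≠ d2 ∧ c3 ≠ d3) →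
    (ne2 a1 b1 a2 b2 ∧ ne2 a1 b1 a3 b3 ∧ ne2 a2 b2 a3 b3) →
    (ne2 c1 d1 a1 b1 ∧ ne2 c1 d1 a2 b2 ∧ ne2 c1 d1 a3 b3) →
    (ne2 c2 d2 a1 b1 ∧ ne2 c2 d2 a2 b2 ∧ ne2 c2 d2 a3 b3) →
    (ne2 c3 d3 a1 b1 ∧ ne2 c3 d3 a2 b2 ∧ ne2 c3 d3 a3 b3) →
    χ a1 b1 = χ c1 d1 → χ a2 b2 = χ c2 d2 → χ a3 b3 = χ c3 d3 → False

theorem no3_of {n k : ℕ} (hn : 5 ≤ n) (c : Sym2 (Fin n) → Fin k) (hc : IsPQColoring n 5 8 c) :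
    No3 (fun a b => c s(a, b)) := by
  classical
  intro S hS a1 b1 c1 d1 a2 b2 c2 d2 a3 b3 c3 d3 hm hd h1 h2 h3 h4 q1 q2 q3
  obtain ⟨S', hSS', hS'⟩ := Finset.exists_superset_card_eq hS (by simpa using hn)
  have h8 := hc S' hS'
  unfold numColorsOn at h8
  let E := S'.offDiag.image (fun p => s(p.1, p.2))
  have hE : E.card = 10 := by
    have := Sym2.card_image_offDiag S'
    rw [hS'] at this
    exact this
  have hmemE : ∀ a b, s(a, b) ∈ E ↔ a ∈ S' ∧ b ∈ S' ∧ a ≠ b := by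
    intro a b
    simp only [E, Finset.mem_image, Finset.mem_offDiag, Prod.exists, Sym2.eq_iff]
    constructor
    · rintro ⟨x, y, ⟨h1, h2, h3⟩, ⟨rfl, rfl⟩ | ⟨rfl, rfl⟩⟩
      · exact ⟨h1, h2, h3⟩
      · exact ⟨h2, h1, h3.symm⟩
    · rintro h
      exact ⟨a, b, h, Or.inl ⟨rfl, rfl⟩⟩
  have hn2 : ∀ {a b c d : Fin n}, ne2 a b c d → s(a, b) ≠ s(c, d) := by
    intro a b c d h he
    exact h (Sym2.eq_iff.1 he)
  obtain ⟨m1, m2, m3, m4, m5, m6, m7, m8, m9, m10, m11, m12⟩ := hm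
  obtain ⟨k1, k2, k3, k4, k5, k6⟩ := hd
  let D : Finset (Sym2 (Fin n)) := {s(a1, b1), s(a2, b2), s(a3, b3)}
  have hD : D.card = 3 := Finset.card_eq_three.2
    ⟨_, _, _, hn2 h1.1, hn2 h1.2.1, hn2 h1.2.2, rfl⟩
  have hDE : D ⊆ E := by
    intro e he
    simp only [D, Finset.mem_insert, Finset.mem_singleton] at he
    rcases he with rfl | rfl | rfl
    · exact (hmemE _ _).2 ⟨hSS' m1, hSS' m2, k1⟩
    · exact (hmemE _ _).2 ⟨hSS' m5, hSS' m6, k2⟩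
    · exact (hmemE _ _).2 ⟨hSS' m9, hSS' m10, k3⟩
  have hcard : (E \ D).card = 7 := by
    rw [Finset.card_sdiff_of_subset hDE, hE, hD]
  have hr : ∀ a b, a ∈ S' → b ∈ S' → a ≠ b → ne2 a b a1 b1 → ne2 a b a2 b2 → ne2 a b a3 b3 →
      s(a, b) ∈ E \ D := by
    intro a b ha hb hab n1 n2 n3
    rw [Finset.mem_sdiff]
    refine ⟨(hmemE _ _).2 ⟨ha, hb, hab⟩, ?_⟩
    simp only [D, Finset.mem_insert, Finset.mem_singleton, not_or]
    exact ⟨hn2 n1, hn2 n2, hn2 n3⟩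
  have hsub : c '' {e : Sym2 (Fin n) | e ∈ S'.sym2 ∧ ¬ e.IsDiag} ⊆ ↑((E \ D).image c) := by
    rintro _ ⟨e, ⟨he1, he2⟩, rfl⟩
    rw [Finset.mem_coe, Finset.mem_image]
    have heE : e ∈ E := by
      induction e with
      | _ a b =>
        rw [Finset.mk_mem_sym2_iff] at he1
        rw [Sym2.mk_isDiag_iff] at he2
        exact (hmemE _ _).2 ⟨he1.1, he1.2, he2⟩
    by_cases heD : e ∈ D
    · simp only [D, Finset.mem_insert, Finset.mem_singleton] at heD
      rcases heD with rfl | rfl | rfl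
      · exact ⟨_, hr c1 d1 (hSS' m3) (hSS' m4) k4 h2.1 h2.2.1 h2.2.2, q1.symm⟩
      · exact ⟨_, hr c2 d2 (hSS' m7) (hSS' m8) k5 h3.1 h3.2.1 h3.2.2, q2.symm⟩
      · exact ⟨_, hr c3 d3 (hSS' m11) (hSS' m12) k6 h4.1 h4.2.1 h4.2.2, q3.symm⟩
    · exact ⟨e, Finset.mem_sdiff.2 ⟨heE, heD⟩, rfl⟩
  have h := Set.ncard_le_ncard hsub (Finset.finite_toSet _)
  rw [Set.ncard_coe_finset] at h
  have := h.trans Finset.card_image_le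
  omega

variable {V K : Type} [DecidableEq V] {χ : V → V → K}

/-- convenience form of `No3` -/
theorem No3.use (h : No3 χ) (x1 x2 x3 x4 x5 a1 b1 c1 d1 a2 b2 c2 d2 a3 b3 c3 d3 : V)
    (q1 : χ a1 b1 = χ c1 d1) (q2 : χ a2 b2 = χ c2 d2) (q3 : χ a3 b3 = χ c3 d3)
    (hm : a1 ∈ ({x1, x2, x3, x4, x5} : Finset V) ∧ b1 ∈ ({x1, x2, x3, x4, x5} : Finset V) ∧
      c1 ∈ ({x1, x2, x3, x4, x5} : Finset V) ∧ d1 ∈ ({x1, x2, x3, x4, x5} : Finset V) ∧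
      a2 ∈ ({x1, x2, x3, x4, x5} : Finset V) ∧ b2 ∈ ({x1, x2, x3, x4, x5} : Finset V) ∧
      c2 ∈ ({x1, x2, x3, x4, x5} : Finset V) ∧ d2 ∈ ({x1, x2, x3, x4, x5} : Finset V) ∧
      a3 ∈ ({x1, x2, x3, x4, x5} : Finset V) ∧ b3 ∈ ({x1, x2, x3, x4, x5} : Finset V) ∧
      c3 ∈ ({x1, x2, x3, x4, x5} : Finset V) ∧ d3 ∈ ({x1, x2, x3, x4, x5} : Finset V))
    (hd : (a1 ≠ b1 ∧ a2 ≠ b2 ∧ a3 ≠ b3 ∧ c1 ≠ d1 ∧ c2 ≠ d2 ∧ c3 ≠ d3))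
    (h1 : (ne2 a1 b1 a2 b2 ∧ ne2 a1 b1 a3 b3 ∧ ne2 a2 b2 a3 b3))
    (h2 : (ne2 c1 d1 a1 b1 ∧ ne2 c1 d1 a2 b2 ∧ ne2 c1 d1 a3 b3))
    (h3 : (ne2 c2 d2 a1 b1 ∧ ne2 c2 d2 a2 b2 ∧ ne2 c2 d2 a3 b3))
    (h4 : (ne2 c3 d3 a1 b1 ∧ ne2 c3 d3 a2 b2 ∧ ne2 c3 d3 a3 b3)) : False :=
  h {x1, x2, x3, x4, x5} Finset.card_le_five a1 b1 c1 d1 a2 b2 c2 d2 a3 b3 c3 d3 hm hd h1 h2 h3 h4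
    q1 q2 q3

def Tri (χ : V → V → K) (z : K) : Prop :=
  ∃ x y w, x ≠ y ∧ y ≠ w ∧ x ≠ w ∧ χ x y = z ∧ χ y w = z ∧ χ x w = z

/-- cherry at `v` -/
def Chy (χ : V → V → K) (v a b : V) : Prop := v ≠ a ∧ v ≠ b ∧ a ≠ b ∧ χ v a = χ v b

theorem Chy.sy {v a b : V} (h : Chy χ v a b) : Chy χ v b a :=
  ⟨h.2.1, h.1, h.2.2.1.symm, h.2.2.2.symm⟩

variable (hχ : ∀ a b, χ a b = χ b a) (h3 : No3 χ)
include hχ h3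

/-- a triangle colour is not used elsewhere -/
theorem tri_only {x y w a b : V} (h1 : x ≠ y) (h2 : y ≠ w) (h4 : x ≠ w) (e1 : χ x y = χ y w)
    (e2 : χ x w = χ y w) (hab : a ≠ b) (e : χ a b = χ y w) :
    (a = x ∨ a = y ∨ a = w) ∧ (b = x ∨ b = y ∨ b = w) := by
  by_contra hc
  refine h3.use x y w a b x y y w x w y w a b y w e1 e2 e (by simp) ?_ ?_ ?_ ?_ ?_ <;>
    (try simp only [ne2]) <;> grind

theorem tri_cherry {z : K} (hz : Tri χ z) {v a b : V} (h : Chy χ v a b) (hc : ¬ Tri χ (χ v a)) :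
    χ a b ≠ z := by
  intro hab
  obtain ⟨x, y, w, h1, h2, h4, e1, e2, e4⟩ := id hz
  subst hab
  obtain ⟨va, vb, ab, hq⟩ := h
  have hcz : χ v a ≠ χ a b := fun e => hc (e ▸ hz)
  obtain ⟨ha, hb⟩ := tri_only hχ h3 h1 h2 h4 (e1.trans e2.symm) (e4.trans e2.symm) ab e2.symm
  have hv : v ≠ x ∧ v ≠ y ∧ v ≠ w := by
    grind
  refine h3.use x y w v x x y y w x w y w v a v b (e1.trans e2.symm) (e4.trans e2.symm) hq
    (by grind) ?_ ?_ ?_ ?_ ?_ <;>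
    (try simp only [ne2]) <;> grind

/-- the full quadruple -/
structure Qd (χ : V → V → K) (v a b d : V) : Prop where
  chy : Chy χ v a b
  nt : χ v a ≠ χ a b
  vd : v ≠ d
  q : χ v d = χ a b

omit hχ h3 in
theorem Qd.da {v a b d : V} (h : Qd χ v a b d) : d ≠ a ∧ d ≠ b := by
  obtain ⟨⟨h1, h2, h3, h4⟩, h5, h6, h7⟩ := h
  constructor
  · rintro rfl; exact h5 h7
  · rintro rfl; exact h5 (h4.trans h7)

omit h3 in
theorem Qd.sy {v a b d : V} (h : Qd χ v a b d) : Qd χ v b a d :=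
  ⟨h.chy.sy, by rw [← h.chy.2.2.2, hχ b a]; exact h.nt, h.vd, by rw [hχ b a]; exact h.q⟩

/-- no further repetition -/
theorem Qd.no {v a b d : V} (h : Qd χ v a b d) (x p q r s : V) (hq : χ p q = χ r s)
    (hm : p ∈ ({v, a, b, d, x} : Finset V) ∧ q ∈ ({v, a, b, d, x} : Finset V) ∧
      r ∈ ({v, a, b, d, x} : Finset V) ∧ s ∈ ({v, a, b, d, x} : Finset V)) (hpq : p ≠ q) (hrs : r ≠ s)
    (n1 : ne2 p q v b) (n2 : ne2 p q a b) (n3 : ne2 p q v a) (n4 : ne2 p q v d)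
    (n5 : ne2 r s p q) : False := by
  obtain ⟨h0, h1⟩ := h.da
  obtain ⟨⟨va, vb, ab, h4⟩, h5, vd, h7⟩ := h
  by_cases c1 : ne2 r s v b
  · by_cases c2 : ne2 r s a b
    · refine h3.use v a b d x v b v a a b v d p q r s h4.symm h7.symm hq ?_ ?_ ?_ ?_ ?_ ?_ <;>
        simp only [ne2] at * <;> grind
    · refine h3.use v a b d x v b v a a b v d p q v d h4.symm h7.symm ?_ ?_ ?_ ?_ ?_ ?_ ?_ <;>
        simp only [ne2] at * <;> grind
  · refine h3.use v a b d x v b v a a b v d p q v a h4.symm h7.symm ?_ ?_ ?_ ?_ ?_ ?_ ?_ <;>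
        simp only [ne2] at * <;> grind

theorem Qd.u1 {v a b d x : V} (h : Qd χ v a b d) (hx : x ≠ a) (e : χ a x = χ v a) : x = v := by
  obtain ⟨h0, h1⟩ := h.da
  by_contra hv
  obtain ⟨⟨va, vb, ab, h4⟩, h5, vd, h7⟩ := id h
  have hxb : x ≠ b := by rintro rfl; exact h5 e.symm
  refine h.no hχ h3 x a x v a e (by simp) hx.symm va ?_ ?_ ?_ ?_ ?_ <;> (try simp only [ne2]) <;> grind

theorem Qd.u2 {v a b d x : V} (h : Qd χ v a b d) (hx : x ≠ a) (e : χ a x = χ a b) : x = b := by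
  obtain ⟨h0, h1⟩ := h.da
  by_contra hv
  obtain ⟨⟨va, vb, ab, h4⟩, h5, vd, h7⟩ := id h
  have hxb : x ≠ v := by rintro rfl; rw [hχ] at e; exact h5 e
  refine h.no hχ h3 x a x a b e (by simp) hx.symm ab ?_ ?_ ?_ ?_ ?_ <;> (try simp only [ne2]) <;> grind

theorem Qd.u3 {v a b d x : V} (h : Qd χ v a b d) (hx : x ≠ v) (e : χ v x = χ a b) : x = d := by
  obtain ⟨h0, h1⟩ := h.da
  by_contra hv
  obtain ⟨⟨va, vb, ab, h4⟩, h5, vd, h7⟩ := id h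
  have hxa : x ≠ a := by rintro rfl; exact h5 e
  have hxb : x ≠ b := by rintro rfl; exact h5 (h4.trans e)
  refine h.no hχ h3 x v x a b e (by simp) hx.symm ab ?_ ?_ ?_ ?_ ?_ <;> (try simp only [ne2]) <;> grind

end Lower

set_option linter.unusedVariables false
set_option linter.unusedSectionVars false
set_option linter.unusedSimpArgs false

section Lower2

variable {V K : Type} [DecidableEq V] {χ : V → V → K}

def TN (χ : V → V → K) (v : V) (c : K) (x : V) (y : K) : Prop :=
  x = v ∧ (∀ t, t ≠ v → χ v t ≠ y) ∧ ∃ a b, Chy χ v a b ∧ χ v a = c ∧ χ a b = y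
def TA (χ : V → V → K) (v : V) (c : K) (x : V) (y : K) : Prop :=
  ∃ b d, Qd χ v x b d ∧ χ v x = c ∧ y = c
def TB (χ : V → V → K) (v : V) (c : K) (x : V) (y : K) : Prop :=
  ∃ b d, Qd χ v x b d ∧ χ v x = c ∧ y = χ x b
def TC (χ : V → V → K) (v : V) (c : K) (x : V) (y : K) : Prop :=
  x = v ∧ ∃ a b d, Qd χ v a b d ∧ χ v a = c ∧ y = χ a b

def NB (χ : V → V → K) (v : V) (c : K) (x : V) (y : K) : Prop :=
  TN χ v c x y ∨ TA χ v c x y ∨ TB χ v c x y ∨ TC χ v c x y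

variable (hχ : ∀ a b, χ a b = χ b a) (h3 : No3 χ)
include hχ h3

/-- two cherries with distinct colours at `v` cannot be closed by the same colour -/
theorem two_chy {v a b a' b' : V} (h : Chy χ v a b) (h' : Chy χ v a' b') (hz : χ a b = χ a' b') :
    χ v a = χ v a' := by
  by_contra hc
  obtain ⟨va, vb, ab, e⟩ := h
  obtain ⟨va', vb', ab', e'⟩ := h'
  have n1 : a ≠ a' := by rintro rfl; exact hc rfl
  have n2 : a ≠ b' := by rintro rfl; exact hc e'.symm
  have n3 : b ≠ a' := by rintro rfl; exact hc e
  have n4 : b ≠ b' := by rintro rfl; exact hc (e.trans e'.symm)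
  refine h3.use v a b a' b' v a v b v a' v b' a b a' b' e e' hz (by simp) ?_ ?_ ?_ ?_ ?_ <;>
    (try simp only [ne2]) <;> grind

omit h3 in
theorem dis_NA {v v' x : V} {c c' y : K} (h : TN χ v c x y) (h' : TA χ v' c' x y) : False := by
  obtain ⟨rfl, hn, -⟩ := h
  obtain ⟨b, d, q, e, rfl⟩ := h'
  exact hn v' q.chy.1 (by rw [hχ]; exact e)

omit hχ h3 in
theorem dis_NB {v v' x : V} {c c' y : K} (h : TN χ v c x y) (h' : TB χ v' c' x y) : False := by
  obtain ⟨rfl, hn, -⟩ := h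
  obtain ⟨b, d, q, e, rfl⟩ := h'
  exact hn b q.chy.2.2.1.symm rfl

omit hχ h3 in
theorem dis_NC {v v' x : V} {c c' y : K} (h : TN χ v c x y) (h' : TC χ v' c' x y) : False := by
  obtain ⟨rfl, hn, -⟩ := h
  obtain ⟨rfl, a, b, d, q, e, rfl⟩ := h'
  exact hn d q.vd.symm q.q

theorem dis_NN {v v' x : V} {c c' y : K} (h : TN χ v c x y) (h' : TN χ v' c' x y) :
    v = v' ∧ c = c' := by
  obtain ⟨rfl, -, a, b, h, rfl, e⟩ := h
  obtain ⟨rfl, -, a', b', h', rfl, e'⟩ := h'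
  exact ⟨rfl, two_chy hχ h3 h h' (e.trans e'.symm)⟩

theorem dis_CC {v v' x : V} {c c' y : K} (h : TC χ v c x y) (h' : TC χ v' c' x y) :
    v = v' ∧ c = c' := by
  obtain ⟨rfl, a, b, d, h, rfl, e⟩ := h
  obtain ⟨rfl, a', b', d', h', rfl, e'⟩ := h'
  exact ⟨rfl, two_chy hχ h3 h.chy h'.chy (e.symm.trans e')⟩

theorem dis_AA {v v' x : V} {c c' y : K} (h : TA χ v c x y) (h' : TA χ v' c' x y) :
    v = v' ∧ c = c' := by
  obtain ⟨b, d, q, e, rfl⟩ := h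
  obtain ⟨b', d', q', e', rfl⟩ := h'
  exact ⟨(q.u1 hχ h3 q'.chy.1 (by rw [hχ, e', e])).symm, rfl⟩

theorem dis_AB {v v' x : V} {c c' y : K} (h : TA χ v c x y) (h' : TB χ v' c' x y) : False := by
  obtain ⟨b, d, q, e, rfl⟩ := h
  obtain ⟨b', d', q', e', e''⟩ := h'
  obtain rfl : v = b' := q'.u2 hχ h3 q.chy.1 (by rw [hχ, e, e''])
  obtain ⟨h0, h1⟩ := q.da
  obtain ⟨⟨va, vb, ab, h4⟩, h5, vd, h7⟩ := id q
  obtain ⟨⟨va', vb', ab', h4'⟩, h5', vd', h7'⟩ := id q'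
  by_cases hb : v' = b
  · subst hb
    exact h5 (by rw [h4, hχ v v', ← h4', hχ])
  · have : v' ≠ d ∨ v' = d := by tauto
    refine q.no hχ h3 v' v' x v' v h4' (by simp) va' vb' ?_ ?_ ?_ ?_ ?_ <;>
      (try simp only [ne2]) <;> grind

theorem dis_BB {v v' x : V} {c c' y : K} (h : TB χ v c x y) (h' : TB χ v' c' x y) :
    v = v' ∧ c = c' := by
  obtain ⟨b, d, q, e, rfl⟩ := h
  obtain ⟨b', d', q', e', e''⟩ := h'
  obtain rfl : b = b' := q'.u2 hχ h3 q.chy.2.2.1.symm e''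
  obtain ⟨h0, h1⟩ := q.da
  obtain ⟨⟨va, vb, ab, h4⟩, h5, vd, h7⟩ := id q
  obtain ⟨⟨va', vb', ab', h4'⟩, h5', vd', h7'⟩ := id q'
  by_cases hb : v = v'
  · subst hb
    exact ⟨rfl, e.symm.trans e'⟩
  · exfalso
    refine q.no hχ h3 v' v' x v' b h4' (by simp) va' vb' ?_ ?_ ?_ ?_ ?_ <;>
      (try simp only [ne2]) <;> grind

theorem dis_AC {v v' x : V} {c c' y : K} (h : TA χ v c x y) (h' : TC χ v' c' x y) : False := by
  obtain ⟨b, d, q, e, rfl⟩ := h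
  obtain ⟨rfl, a', b', d', q', e', e''⟩ := h'
  obtain rfl : v = d' := q'.u3 hχ h3 q.chy.1 (by rw [hχ, e, e''])
  obtain ⟨h0, h1⟩ := q.da
  obtain ⟨h0', h1'⟩ := q'.da
  obtain ⟨⟨va, vb, ab, h4⟩, h5, vd, h7⟩ := id q
  obtain ⟨⟨va', vb', ab', h4'⟩, h5', vd', h7'⟩ := id q'
  refine h3.use v x b a' b' v b v x a' b' v x x a' x b' h4.symm (by rw [hχ v x, h7']) h4'
    (by simp) ?_ ?_ ?_ ?_ ?_ <;>
      (try simp only [ne2]) <;> grind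

theorem dis_BC {v v' x : V} {c c' y : K} (h : TB χ v c x y) (h' : TC χ v' c' x y) : False := by
  obtain ⟨b, d, q, e, rfl⟩ := h
  obtain ⟨rfl, a', b', d', q', e', e''⟩ := h'
  obtain rfl : b = d' := q'.u3 hχ h3 q.chy.2.2.1.symm e''
  obtain ⟨h0, h1⟩ := q.da
  obtain ⟨h0', h1'⟩ := q'.da
  obtain ⟨⟨va, vb, ab, h4⟩, h5, vd, h7⟩ := id q
  obtain ⟨⟨va', vb', ab', h4'⟩, h5', vd', h7'⟩ := id q'
  have hav : a' ≠ v := by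
    rintro rfl
    exact ab' (q.u1 hχ h3 vb'.symm (by rw [← h4', hχ])).symm
  have hbv : b' ≠ v := by
    rintro rfl
    exact ab' (q.u1 hχ h3 va'.symm (by rw [h4', hχ]))
  refine h3.use v x b a' b' v b v x a' b' x b x a' x b' h4.symm e''.symm h4'
    (by simp) ?_ ?_ ?_ ?_ ?_ <;>
      (try simp only [ne2]) <;> grind

theorem dis_all {v v' x : V} {c c' y : K} (h : NB χ v c x y) (h' : NB χ v' c' x y) :
    v = v' ∧ c = c' := by
  rcases h with h | h | h | h <;> rcases h' with h' | h' | h' | h'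
  · exact dis_NN hχ h3 h h'
  · exact (dis_NA hχ h h').elim
  · exact (dis_NB h h').elim
  · exact (dis_NC h h').elim
  · exact (dis_NA hχ h' h).elim
  · exact dis_AA hχ h3 h h'
  · exact (dis_AB hχ h3 h h').elim
  · exact (dis_AC hχ h3 h h').elim
  · exact (dis_NB h' h).elim
  · exact (dis_AB hχ h3 h' h).elim
  · exact dis_BB hχ h3 h h'
  · exact (dis_BC hχ h3 h h').elim
  · exact (dis_NC h' h).elim
  · exact (dis_AC hχ h3 h' h).elim
  · exact (dis_BC hχ h3 h' h).elim
  · exact dis_CC hχ h3 h h'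

end Lower2

set_option linter.unusedVariables false
set_option linter.unusedSectionVars false
set_option linter.unusedSimpArgs false

section Lower3
open Classical in
noncomputable def Nbs {V K : Type} [Fintype V] (χ : V → V → K) (v : V) (c : K) : Finset V :=
  Finset.univ.filter (fun x => x ≠ v ∧ χ v x = c)

theorem mem_Nbs {V K : Type} [Fintype V] {χ : V → V → K} {v : V} {c : K} {x : V} :
    x ∈ Nbs χ v c ↔ x ≠ v ∧ χ v x = c := by
  classical
  simp [Nbs]

open Classical in
noncomputable def LT' {V K : Type} [Fintype V] [Fintype K] (χ : V → V → K) (v : V) (c : K) :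
    Finset (V × K) :=
  Finset.univ.filter (fun p => ¬ Tri χ p.2 ∧ (Nbs χ p.1 p.2).card ≤ 1 ∧ NB χ v c p.1 p.2)

theorem mem_LT' {V K : Type} [Fintype V] [Fintype K] {χ : V → V → K} {v : V} {c : K}
    {p : V × K} : p ∈ LT' χ v c ↔ ¬ Tri χ p.2 ∧ (Nbs χ p.1 p.2).card ≤ 1 ∧ NB χ v c p.1 p.2 := by
  classical
  simp [LT']

variable {V K : Type} [DecidableEq V] [Fintype V] [Fintype K] {χ : V → V → K}
variable (hχ : ∀ a b, χ a b = χ b a) (h3 : No3 χ)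
include hχ h3

theorem Nbs_le3 (v : V) (c : K) : (Nbs χ v c).card ≤ 3 := by
  classical
  by_contra h
  obtain ⟨s, hs, hc⟩ := Finset.exists_subset_card_eq (s := Nbs χ v c) (n := 4) (by omega)
  obtain ⟨a, b, d, e, ab, ad, ae, bd, be, de, rfl⟩ := Finset.card_eq_four.1 hc
  have ha := mem_Nbs.1 (hs (show a ∈ _ by simp))
  have hb := mem_Nbs.1 (hs (show b ∈ _ by simp))
  have hd := mem_Nbs.1 (hs (show d ∈ _ by simp))
  have he := mem_Nbs.1 (hs (show e ∈ _ by simp))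
  refine h3.use v a b d e v b v a v d v a v e v a (hb.2.trans ha.2.symm) (hd.2.trans ha.2.symm)
    (he.2.trans ha.2.symm) (by simp) ?_ ?_ ?_ ?_ ?_ <;>
      (try simp only [ne2]) <;> grind

theorem star3_diff {v a b e : V} (va : v ≠ a) (vb : v ≠ b) (ve : v ≠ e) (ab : a ≠ b) (ae : a ≠ e)
    (be : b ≠ e) (q1 : χ v b = χ v a) (q2 : χ v e = χ v a) : χ a b ≠ χ a e := by
  intro h
  refine h3.use v a b e e v b v a v e v a a b a e q1 q2 h (by simp) ?_ ?_ ?_ ?_ ?_ <;>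
      (try simp only [ne2]) <;> grind

theorem star3_un {v a b e t : V} (va : v ≠ a) (vb : v ≠ b) (ve : v ≠ e) (ab : a ≠ b) (ae : a ≠ e)
    (be : b ≠ e) (q1 : χ v b = χ v a) (q2 : χ v e = χ v a) (hn : χ a b ≠ χ v a) (ht : t ≠ v) :
    χ v t ≠ χ a b := by
  intro h
  have t1 : t ≠ a := by rintro rfl; exact hn h.symm
  have t2 : t ≠ b := by rintro rfl; exact hn (h.symm.trans q1)
  have t3 : t ≠ e := by rintro rfl; exact hn (h.symm.trans q2)
  refine h3.use v a b e t v b v a v e v a a b v t q1 q2 h.symm (by simp) ?_ ?_ ?_ ?_ ?_ <;>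
      (try simp only [ne2]) <;> grind

omit h3 in
theorem chy_nt {v a b : V} (h : Chy χ v a b) (hc : ¬ Tri χ (χ v a)) : χ a b ≠ χ v a := by
  intro e
  exact hc ⟨v, a, b, h.1, h.2.2.1, h.2.1, rfl, e, h.2.2.2.symm⟩

/-- unused closing colours lie in the charge set -/
theorem un_mem {v a b : V} (h : Chy χ v a b) (hc : ¬ Tri χ (χ v a))
    (hu : ∀ t, t ≠ v → χ v t ≠ χ a b) :
    (v, χ a b) ∈ LT' χ v (χ v a) ∧ (Nbs χ v (χ a b)).card = 0 := by
  have h0 : (Nbs χ v (χ a b)).card = 0 := by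
    rw [Finset.card_eq_zero, Finset.eq_empty_iff_forall_notMem]
    intro x hx
    rw [mem_Nbs] at hx
    exact hu x hx.1 hx.2
  refine ⟨mem_LT'.2 ⟨fun ht => tri_cherry hχ h3 ht h hc rfl, by simp only [h0]; omega,
    Or.inl ⟨rfl, hu, a, b, h, rfl, rfl⟩⟩, h0⟩

theorem local_charge (v : V) (c : K) (hc : ¬ Tri χ c) (h2 : 2 ≤ (Nbs χ v c).card) :
    6 * ((Nbs χ v c).card : ℤ) - 7 ≤
      ∑ p ∈ LT' χ v c, (7 - 6 * ((Nbs χ p.1 p.2).card : ℤ)) := by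
  classical
  have hpos : ∀ p ∈ LT' χ v c, (1 : ℤ) ≤ 7 - 6 * ((Nbs χ p.1 p.2).card : ℤ) := by
    intro p hp
    have := (mem_LT'.1 hp).2.1
    omega
  have hsub : ∀ T : Finset (V × K), T ⊆ LT' χ v c →
      ∑ p ∈ T, (7 - 6 * ((Nbs χ p.1 p.2).card : ℤ)) ≤
      ∑ p ∈ LT' χ v c, (7 - 6 * ((Nbs χ p.1 p.2).card : ℤ)) := by
    intro T hT
    exact Finset.sum_le_sum_of_subset_of_nonneg hT (fun p hp _ => by have := hpos p hp; omega)
  have hle := Nbs_le3 hχ h3 v c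
  rcases (by omega : (Nbs χ v c).card = 2 ∨ (Nbs χ v c).card = 3) with hcd | hcd
  · obtain ⟨a, b, ab, hs⟩ := Finset.card_eq_two.1 hcd
    have ha := mem_Nbs.1 (show a ∈ Nbs χ v c by rw [hs]; simp)
    have hb := mem_Nbs.1 (show b ∈ Nbs χ v c by rw [hs]; simp)
    rw [hcd]
    have hch : Chy χ v a b := ⟨ha.1.symm, hb.1.symm, ab, ha.2.trans hb.2.symm⟩
    obtain rfl := ha.2
    by_cases hu : ∀ t, t ≠ v → χ v t ≠ χ a b
    · obtain ⟨hm, h0⟩ := un_mem hχ h3 hch hc hu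
      have := hsub {(v, χ a b)} (by simpa using hm)
      rw [Finset.sum_singleton] at this
      simp only [h0] at this
      push_cast at this ⊢
      omega
    · push Not at hu
      obtain ⟨d, hd, hq⟩ := hu
      have hzc := chy_nt hχ hch hc
      have q : Qd χ v a b d := ⟨hch, hzc.symm, hd.symm, hq⟩
      have q' := q.sy hχ
      have hz : ¬ Tri χ (χ a b) := fun ht => tri_cherry hχ h3 ht hch hc rfl
      have one : ∀ (x y : V) (z : K), (∀ t, t ≠ x → χ x t = z → t = y) → (Nbs χ x z).card ≤ 1 := by
        intro x y z h
        rw [Finset.card_le_one]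
        intro s hs t ht
        rw [mem_Nbs] at hs ht
        rw [h s hs.1 hs.2, h t ht.1 ht.2]
      have m1 : (a, χ v a) ∈ LT' χ v (χ v a) := mem_LT'.2 ⟨hc, one a v _ (fun t h e => q.u1 hχ h3 h e),
        Or.inr (Or.inl ⟨b, d, q, rfl, rfl⟩)⟩
      have m2 : (b, χ v a) ∈ LT' χ v (χ v a) := mem_LT'.2 ⟨hc, one b v _
        (fun t h e => q'.u1 hχ h3 h (e.trans hch.2.2.2)),
        Or.inr (Or.inl ⟨a, d, q', hch.2.2.2.symm, rfl⟩)⟩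
      have m3 : (a, χ a b) ∈ LT' χ v (χ v a) := mem_LT'.2 ⟨hz, one a b _ (fun t h e => q.u2 hχ h3 h e),
        Or.inr (Or.inr (Or.inl ⟨b, d, q, rfl, rfl⟩))⟩
      have m4 : (b, χ a b) ∈ LT' χ v (χ v a) := mem_LT'.2 ⟨hz, one b a _
        (fun t h e => q'.u2 hχ h3 h (e.trans (hχ a b))),
        Or.inr (Or.inr (Or.inl ⟨a, d, q', hch.2.2.2.symm, hχ a b⟩))⟩
      have m5 : (v, χ a b) ∈ LT' χ v (χ v a) := mem_LT'.2 ⟨hz, one v d _ (fun t h e => q.u3 hχ h3 h e),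
        Or.inr (Or.inr (Or.inr ⟨rfl, a, b, d, q, rfl, rfl⟩))⟩
      have hT : ({(a, χ v a), (b, χ v a), (a, χ a b), (b, χ a b), (v, χ a b)} : Finset (V × K)) ⊆
          LT' χ v (χ v a) := by
        intro p hp
        simp only [Finset.mem_insert, Finset.mem_singleton] at hp
        rcases hp with rfl | rfl | rfl | rfl | rfl <;> assumption
      have hT5 : ({(a, χ v a), (b, χ v a), (a, χ a b), (b, χ a b), (v, χ a b)} :
          Finset (V × K)).card = 5 := by
        have h1 := hch.1
        have h2 := hch.2.1
        have h1' := h1.symm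
        have h2' := h2.symm
        have ab' := ab.symm
        have hzc' := hzc.symm
        rw [Finset.card_insert_of_notMem, Finset.card_insert_of_notMem, Finset.card_insert_of_notMem,
          Finset.card_insert_of_notMem, Finset.card_singleton] <;>
          simp only [Finset.mem_insert, Finset.mem_singleton, Prod.mk.injEq] <;> tauto
      have hcard := Finset.card_le_card hT
      have := Finset.card_nsmul_le_sum (LT' χ v (χ v a)) _ 1 hpos
      rw [nsmul_eq_mul, mul_one] at this
      push_cast
      omega
  · obtain ⟨a, b, e, ab, ae, be, hs⟩ := Finset.card_eq_three.1 hcd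
    have ha := mem_Nbs.1 (show a ∈ Nbs χ v c by rw [hs]; simp)
    have hb := mem_Nbs.1 (show b ∈ Nbs χ v c by rw [hs]; simp)
    have he := mem_Nbs.1 (show e ∈ Nbs χ v c by rw [hs]; simp)
    rw [hcd]
    have hch : Chy χ v a b := ⟨ha.1.symm, hb.1.symm, ab, ha.2.trans hb.2.symm⟩
    have hce : Chy χ v a e := ⟨ha.1.symm, he.1.symm, ae, ha.2.trans he.2.symm⟩
    obtain rfl := ha.2
    obtain ⟨hm, h0⟩ := un_mem hχ h3 hch hc (fun t ht => star3_un hχ h3 ha.1.symm hb.1.symm he.1.symm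
      ab ae be hb.2 he.2 (chy_nt hχ hch hc) ht)
    obtain ⟨hm', h0'⟩ := un_mem hχ h3 hce hc (fun t ht => star3_un hχ h3 ha.1.symm he.1.symm hb.1.symm
      ae ab be.symm he.2 hb.2 (chy_nt hχ hce hc) ht)
    have hd := star3_diff hχ h3 ha.1.symm hb.1.symm he.1.symm ab ae be hb.2 he.2
    have := hsub {(v, χ a b), (v, χ a e)} (by
      intro p hp
      simp only [Finset.mem_insert, Finset.mem_singleton] at hp
      rcases hp with rfl | rfl <;> assumption)
    rw [Finset.sum_pair (by simpa using hd)] at this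
    simp only [h0, h0'] at this
    push_cast at this ⊢
    omega

theorem tri_col (hn : 6 ≤ Fintype.card V) (c : K) (hc : Tri χ c) :
    ∑ v : V, (6 * ((Nbs χ v c).card : ℤ) - 7) ≤ 0 := by
  classical
  obtain ⟨x, y, w, h1, h2, h4, e1, e2, e4⟩ := hc
  subst e2
  have hb : ∀ v, (Nbs χ v (χ y w)).card ≤ if v ∈ ({x, y, w} : Finset V) then 2 else 0 := by
    intro v
    have hsub : Nbs χ v (χ y w) ⊆ ({x, y, w} : Finset V).erase v := by
      intro t ht
      rw [mem_Nbs] at ht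
      have := tri_only hχ h3 h1 h2 h4 e1 e4 ht.1.symm ht.2
      simp only [Finset.mem_erase, Finset.mem_insert, Finset.mem_singleton]
      exact ⟨ht.1, this.2⟩
    split_ifs with hv
    · refine (Finset.card_le_card hsub).trans ?_
      rw [Finset.card_erase_of_mem hv]
      have := Finset.card_le_three (a := x) (b := y) (c := w)
      omega
    · rw [Nat.le_zero, Finset.card_eq_zero, Finset.eq_empty_iff_forall_notMem]
      intro t ht
      rw [mem_Nbs] at ht
      have := tri_only hχ h3 h1 h2 h4 e1 e4 ht.1.symm ht.2
      apply hv
      simp only [Finset.mem_insert, Finset.mem_singleton]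
      exact this.1
  have hs : ∑ v : V, (Nbs χ v (χ y w)).card ≤ 6 := by
    refine (Finset.sum_le_sum (fun v _ => hb v)).trans ?_
    rw [Finset.sum_ite_mem, Finset.univ_inter, Finset.sum_const]
    have := Finset.card_le_three (a := x) (b := y) (c := w)
    simp only [smul_eq_mul]
    omega
  rw [Finset.sum_sub_distrib, ← Finset.mul_sum, Finset.sum_const, ← Nat.cast_sum, Finset.card_univ,
    nsmul_eq_mul]
  have : ((∑ v : V, (Nbs χ v (χ y w)).card : ℕ) : ℤ) ≤ 6 := by exact_mod_cast hs
  push_cast at this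
  omega

open Classical in
theorem nontri_sum :
    ∑ p ∈ Finset.univ.filter (fun p : V × K => ¬ Tri χ p.2),
      (6 * ((Nbs χ p.1 p.2).card : ℤ) - 7) ≤ 0 := by
  set X := Finset.univ.filter (fun p : V × K => ¬ Tri χ p.2) with hX
  rw [← Finset.sum_filter_add_sum_filter_not X (fun p => 2 ≤ (Nbs χ p.1 p.2).card)]
  set H := X.filter (fun p => 2 ≤ (Nbs χ p.1 p.2).card) with hH
  set Lo := X.filter (fun p => ¬ 2 ≤ (Nbs χ p.1 p.2).card) with hLo
  have hdis : (H : Set (V × K)).PairwiseDisjoint (fun h => LT' χ h.1 h.2) := by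
    intro h _ h' _ hne
    rw [Function.onFun, Finset.disjoint_left]
    intro p hp hp'
    have := dis_all hχ h3 (mem_LT'.1 hp).2.2 (mem_LT'.1 hp').2.2
    exact hne (Prod.ext this.1 this.2)
  have hsub : H.biUnion (fun h => LT' χ h.1 h.2) ⊆ Lo := by
    intro p hp
    rw [Finset.mem_biUnion] at hp
    obtain ⟨h, _, hp⟩ := hp
    rw [mem_LT'] at hp
    rw [hLo, Finset.mem_filter, hX, Finset.mem_filter]
    exact ⟨⟨Finset.mem_univ _, hp.1⟩, by omega⟩
  have h1 := Finset.sum_le_sum_of_subset_of_nonneg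
    (f := fun p => 7 - 6 * ((Nbs χ p.1 p.2).card : ℤ)) hsub (by
      intro p hp _
      rw [hLo, Finset.mem_filter] at hp
      have := hp.2
      omega)
  rw [Finset.sum_biUnion hdis] at h1
  have h2 : ∑ h ∈ H, (6 * ((Nbs χ h.1 h.2).card : ℤ) - 7) ≤
      ∑ h ∈ H, ∑ p ∈ LT' χ h.1 h.2, (7 - 6 * ((Nbs χ p.1 p.2).card : ℤ)) := by
    refine Finset.sum_le_sum (fun h hh => ?_)
    rw [hH, Finset.mem_filter, hX, Finset.mem_filter] at hh
    exact local_charge hχ h3 h.1 h.2 hh.1.2 hh.2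
  have h5 : ∑ p ∈ Lo, (6 * ((Nbs χ p.1 p.2).card : ℤ) - 7) =
      - ∑ p ∈ Lo, (7 - 6 * ((Nbs χ p.1 p.2).card : ℤ)) := by
    rw [← Finset.sum_neg_distrib]
    exact Finset.sum_congr rfl (fun p _ => by ring)
  rw [h5]
  linarith

theorem total_sum (hn : 6 ≤ Fintype.card V) :
    ∑ c : K, ∑ v : V, (6 * ((Nbs χ v c).card : ℤ) - 7) ≤ 0 := by
  classical
  refine le_trans ?_ (nontri_sum hχ h3)
  rw [Finset.sum_filter, Fintype.sum_prod_type_right]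
  refine Finset.sum_le_sum (fun c _ => ?_)
  by_cases hc : Tri χ c
  · simpa [hc] using tri_col hχ h3 hn c hc
  · simp [hc]

omit hχ h3 in
theorem sum_Nbs (v : V) : ∑ c : K, (Nbs χ v c).card = Fintype.card V - 1 := by
  classical
  have := Finset.card_eq_sum_card_fiberwise (s := Finset.univ.erase v) (t := (Finset.univ : Finset K))
    (f := fun x => χ v x) (fun _ _ => by simp)
  rw [Finset.card_erase_of_mem (Finset.mem_univ _), Finset.card_univ] at this
  rw [this]
  refine Finset.sum_congr rfl (fun c _ => ?_)
  congr 1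
  ext x
  simp [mem_Nbs]

theorem lower_count (hn : 6 ≤ Fintype.card V) :
    6 * ((Fintype.card V : ℤ) - 1) ≤ 7 * Fintype.card K := by
  have h := total_sum hχ h3 hn
  rw [Finset.sum_comm] at h
  have h' : ∀ v : V, ∑ c : K, (6 * ((Nbs χ v c).card : ℤ) - 7) =
      6 * ((Fintype.card V : ℤ) - 1) - 7 * Fintype.card K := by
    intro v
    rw [Finset.sum_sub_distrib, ← Finset.mul_sum, Finset.sum_const, ← Nat.cast_sum, sum_Nbs,
      Finset.card_univ, nsmul_eq_mul, Nat.cast_sub (by omega)]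
    push_cast
    ring
  rw [Finset.sum_congr rfl (fun v _ => h' v), Finset.sum_const, Finset.card_univ, nsmul_eq_mul] at h
  have hp : (0 : ℤ) < Fintype.card V := by omega
  have := nonpos_of_mul_nonpos_right h hp
  linarith

end Lower3

theorem genRamsey_five_eight_lower (n : ℕ) (hn : 6 ≤ n) :
    (6 / 7 : ℝ) * ((n : ℝ) - 1) ≤ (genRamsey n 5 8 : ℝ) := by
  obtain ⟨c, hc⟩ := Nat.sInf_mem (s := {k | ∃ c : Sym2 (Fin n) → Fin k, IsPQColoring n 5 8 c})
    (rainbow_ok n)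
  have h := lower_count (χ := fun a b => c s(a, b)) (fun a b => by rw [Sym2.eq_swap])
    (no3_of (by omega) c hc) (by simpa using hn)
  rw [Fintype.card_fin, Fintype.card_fin] at h
  have h' : 6 * ((n : ℤ) - 1) ≤ 7 * (genRamsey n 5 8 : ℤ) := h
  have h'' : 6 * ((n : ℝ) - 1) ≤ 7 * (genRamsey n 5 8 : ℝ) := by exact_mod_cast h'
  linarith

/-- `f(n,5,8) = (6/7)n + o(n)`: for every `ε > 0` eventually
`(6/7 − ε)n ≤ f(n,5,8) ≤ (6/7 + ε)n`; equivalently `f(n,5,8)/n → 6/7`. -/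
theorem genRamsey_five_eight_asymptotics :
    (∀ ε : ℝ, 0 < ε → ∃ N : ℕ, ∀ n : ℕ, N ≤ n →
      (6 / 7 - ε) * n ≤ (genRamsey n 5 8 : ℝ) ∧ (genRamsey n 5 8 : ℝ) ≤ (6 / 7 + ε) * n) ∧
    Filter.Tendsto (fun n : ℕ => (genRamsey n 5 8 : ℝ) / n) Filter.atTop (nhds (6 / 7)) := by
  have key : ∀ ε : ℝ, 0 < ε → ∃ N : ℕ, ∀ n : ℕ, N ≤ n →
      (6 / 7 - ε) * n ≤ (genRamsey n 5 8 : ℝ) ∧ (genRamsey n 5 8 : ℝ) ≤ (6 / 7 + ε) * n := by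
    intro ε hε
    obtain ⟨N, hN⟩ := genRamsey_five_eight_upper ε hε
    obtain ⟨M, hM⟩ := exists_nat_gt (1 / ε)
    refine ⟨max N (max M 6), fun n hn => ⟨?_, hN n (le_trans (le_max_left _ _) hn)⟩⟩
    have h6 : 6 ≤ n := le_trans (le_trans (le_max_right _ _) (le_max_right _ _)) hn
    have hMn : M ≤ n := le_trans (le_trans (le_max_left _ _) (le_max_right _ _)) hn
    have hMn' : (M : ℝ) ≤ n := by exact_mod_cast hMn
    have h1 : 1 < ε * n := by
      have h2 : 1 / ε < n := lt_of_lt_of_le hM hMn'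
      rw [div_lt_iff₀ hε] at h2
      linarith
    have := genRamsey_five_eight_lower n h6
    nlinarith
  refine ⟨key, ?_⟩
  rw [Metric.tendsto_atTop]
  intro ε hε
  obtain ⟨N, hN⟩ := key (ε / 2) (by linarith)
  refine ⟨max N 1, fun n hn => ?_⟩
  have hn1 : 1 ≤ n := le_trans (le_max_right _ _) hn
  have hpos : (0 : ℝ) < n := by exact_mod_cast hn1
  obtain ⟨h1, h2⟩ := hN n (le_trans (le_max_left _ _) hn)
  rw [Real.dist_eq, abs_lt]
  constructor
  · have : 6 / 7 - ε / 2 ≤ (genRamsey n 5 8 : ℝ) / n := by rwa [le_div_iff₀ hpos]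
    linarith
  · have : (genRamsey n 5 8 : ℝ) / n ≤ 6 / 7 + ε / 2 := by rwa [div_le_iff₀ hpos]
    linarith
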